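/- For every Δ ∈ ℕ and δ > 0 there exist n₀ = n₀(Δ,δ) > 0 and C = C(Δ,δ) > 0 such that for every graph G on n ≥ n₀ vertices with minimum degree δ(G) ≥ (1/2 + δ)·n and every tree T on n vertices with maximum degree Δ(T) ≤ Δ, there exists a (C/n)-vertex-spread distribution on graph embeddings of T into G (injections V(T) → V(G) mapping edges of T to edges of G). -/

import Mathlib

open Finset

/-- A distribution `μ` over functions `X → Y` is `q`-vertex-spread: for all sequences of
distinct `x i` and distinct `y i`, the probability that `φ (x i) = y i` for all `i` is at most
`q ^ k`.  (The distributions considered are supported on injections.) -/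
def IsVertexSpread {X Y : Type*} [Fintype X] [Fintype Y] [DecidableEq X] [DecidableEq Y]
    (q : ℝ) (μ : (X → Y) → ℝ) : Prop :=
  ∀ (k : ℕ) (x : Fin k → X) (y : Fin k → Y), Function.Injective x → Function.Injective y →
    ∑ φ ∈ Finset.univ.filter (fun φ : X → Y => ∀ i, φ (x i) = y i), μ φ ≤ q ^ k

section RandomExtension

variable {α β : Type*} [Fintype α] [Fintype β] [DecidableEq α] [DecidableEq β]

/-- There is a `q`-spread random modification `ψ` of `φ` on `E` that always satisfies `Q` and
whose expected cost `F ψ` is at most `c`. -/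
def RandomExtension (q : ℝ) (φ : α → β) (E : Finset α) (Q : (α → β) → Prop)
    (F : (α → β) → ℝ) (c : ℝ) : Prop :=
  ∃ ν : (α → β) → ℝ, (∀ ψ, 0 ≤ ν ψ) ∧ ∑ ψ, ν ψ = 1 ∧
    (∀ ψ, ν ψ ≠ 0 → (∀ x ∉ E, ψ x = φ x) ∧ Q ψ) ∧
    (∀ X ⊆ E, ∀ y : α → β, ∑ ψ with ∀ x ∈ X, ψ x = y x, ν ψ ≤ q ^ #X) ∧
    ∑ ψ, ν ψ * F ψ ≤ c

namespace RandomExtension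

variable {q : ℝ} {φ : α → β} {E : Finset α} {Q : (α → β) → Prop} {F : (α → β) → ℝ} {c : ℝ}

lemma refl (hQ : Q φ) (hF : F φ ≤ c) : RandomExtension q φ ∅ Q F c := by
  refine ⟨fun ψ => if ψ = φ then 1 else 0, fun ψ => by positivity, by simp, ?_, ?_, by simpa⟩
  · intro ψ hψ
    have : ψ = φ := by by_contra h; simp [h] at hψ
    subst this
    exact ⟨fun _ _ => rfl, hQ⟩
  · intro X hX y
    obtain rfl := subset_empty.1 hX
    simp

lemma mono {q' : ℝ} {Q' : (α → β) → Prop} (h : RandomExtension q φ E Q F c) (hq : 0 ≤ q)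
    (hqq : q ≤ q') (hQ : ∀ ψ, (∀ x ∉ E, ψ x = φ x) → Q ψ → Q' ψ) :
    RandomExtension q' φ E Q' F c := by
  obtain ⟨ν, h0, h1, h2, h3, h4⟩ := h
  exact ⟨ν, h0, h1, fun ψ hψ => ⟨(h2 ψ hψ).1, hQ ψ (h2 ψ hψ).1 (h2 ψ hψ).2⟩,
    fun X hX y => (h3 X hX y).trans (pow_le_pow_left₀ hq hqq _), h4⟩

lemma bind {E₁ E₂ : Finset α} {Q₁ : (α → β) → Prop} {F₁ : (α → β) → ℝ} (hq : 0 ≤ q)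
    (hE : Disjoint E₁ E₂) (h₁ : RandomExtension q φ E₁ Q₁ F₁ c)
    (h₂ : ∀ ψ, (∀ x ∉ E₁, ψ x = φ x) → Q₁ ψ → RandomExtension q ψ E₂ Q F (F₁ ψ)) :
    RandomExtension q φ (E₁ ∪ E₂) Q F c := by
  classical
  obtain ⟨ν, h0, h1, hs, hp, hF⟩ := h₁
  have key : ∀ ψ, ∃ κ : (α → β) → ℝ, ν ψ ≠ 0 → (∀ χ, 0 ≤ κ χ) ∧ ∑ χ, κ χ = 1 ∧
    (∀ χ, κ χ ≠ 0 → (∀ x ∉ E₂, χ x = ψ x) ∧ Q χ) ∧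
    (∀ X ⊆ E₂, ∀ y : α → β, ∑ χ with ∀ x ∈ X, χ x = y x, κ χ ≤ q ^ #X) ∧
    ∑ χ, κ χ * F χ ≤ F₁ ψ := by
    intro ψ
    by_cases h : ν ψ = 0
    · exact ⟨0, fun h' => absurd h h'⟩
    · obtain ⟨κ, hκ⟩ := h₂ ψ (hs ψ h).1 (hs ψ h).2
      exact ⟨κ, fun _ => hκ⟩
  choose κ hκ using key
  refine ⟨fun χ => ∑ ψ, ν ψ * κ ψ χ, ?_, ?_, ?_, ?_, ?_⟩
  · intro χ
    refine sum_nonneg fun ψ _ => ?_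
    by_cases h : ν ψ = 0
    · simp [h]
    · exact mul_nonneg (h0 ψ) ((hκ ψ h).1 χ)
  · rw [sum_comm, ← h1]
    refine sum_congr rfl fun ψ _ => ?_
    rw [← mul_sum]
    by_cases h : ν ψ = 0
    · simp [h]
    · rw [(hκ ψ h).2.1, mul_one]
  · intro χ hχ
    obtain ⟨ψ, -, hψ⟩ := exists_ne_zero_of_sum_ne_zero hχ
    have hν : ν ψ ≠ 0 := left_ne_zero_of_mul hψ
    have := (hκ ψ hν).2.2.1 χ (right_ne_zero_of_mul hψ)
    refine ⟨fun x hx => ?_, this.2⟩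
    rw [mem_union, not_or] at hx
    rw [this.1 x hx.2, (hs ψ hν).1 x hx.1]
  · intro X hX y
    have hcard : #X = #(X ∩ E₁) + #(X ∩ E₂) := by
      rw [← card_union_of_disjoint (hE.mono inter_subset_right inter_subset_right),
        ← inter_union_distrib_left, inter_eq_left.2 hX]
    rw [sum_comm, hcard, pow_add]
    calc ∑ ψ, ∑ χ with ∀ x ∈ X, χ x = y x, ν ψ * κ ψ χ
        ≤ ∑ ψ, if ∀ x ∈ X ∩ E₁, ψ x = y x then ν ψ * q ^ #(X ∩ E₂) else 0 := ?_
      _ = (∑ ψ with ∀ x ∈ X ∩ E₁, ψ x = y x, ν ψ) * q ^ #(X ∩ E₂) := by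
          rw [← sum_filter, sum_mul]
      _ ≤ _ := by
          gcongr
          exact hp _ inter_subset_right y
    refine sum_le_sum fun ψ _ => ?_
    by_cases h : ν ψ = 0
    · simp [h]
    obtain ⟨k0, -, ks, kp, -⟩ := hκ ψ h
    split_ifs with hy
    · rw [← mul_sum]
      refine mul_le_mul_of_nonneg_left ?_ (h0 ψ)
      refine le_trans (sum_le_sum_of_subset_of_nonneg ?_ fun _ _ _ => k0 _)
        (kp _ inter_subset_right y)
      intro χ hχ
      simp only [mem_filter, mem_univ, true_and] at hχ ⊢
      exact fun x hx => hχ x (mem_of_mem_inter_left hx)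
    · refine le_of_eq (sum_eq_zero fun χ hχ => ?_)
      by_contra hne
      refine hy fun x hx => ?_
      simp only [mem_filter, mem_univ, true_and] at hχ
      rw [mem_inter] at hx
      rw [← hχ x hx.1, (ks χ (right_ne_zero_of_mul hne)).1 x (disjoint_left.1 hE hx.2)]
  · calc ∑ χ, (∑ ψ, ν ψ * κ ψ χ) * F χ = ∑ ψ, ν ψ * ∑ χ, κ ψ χ * F χ := by
          simp_rw [sum_mul, mul_sum]
          rw [sum_comm]
          simp_rw [mul_assoc]
      _ ≤ ∑ ψ, ν ψ * F₁ ψ := by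
          refine sum_le_sum fun ψ _ => ?_
          by_cases h : ν ψ = 0
          · simp [h]
          · exact mul_le_mul_of_nonneg_left (hκ ψ h).2.2.2.2 (h0 ψ)
      _ ≤ c := hF

lemma update {x : α} {C : Finset β} (hC : C.Nonempty) (hq : 1 ≤ q * #C)
    (hQ : ∀ v ∈ C, Q (Function.update φ x v))
    (hF : ∑ v ∈ C, F (Function.update φ x v) ≤ #C * c) :
    RandomExtension q φ {x} Q F c := by
  classical
  have hC0 : (0 : ℝ) < #C := by exact_mod_cast hC.card_pos
  have hinj : Set.InjOn (fun v => Function.update φ x v) (C : Set β) :=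
    (Function.update_injective φ x).injOn
  set I := C.image (fun v => Function.update φ x v) with hI
  have hIc : #I = #C := card_image_of_injOn hinj
  refine ⟨fun ψ => if ψ ∈ I then (#C : ℝ)⁻¹ else 0, fun ψ => by positivity, ?_, ?_, ?_, ?_⟩
  · rw [sum_ite_mem, univ_inter, sum_const, hIc, nsmul_eq_mul, mul_inv_cancel₀ hC0.ne']
  · intro ψ hψ
    have : ψ ∈ I := by by_contra h; simp [h] at hψ
    obtain ⟨v, hv, rfl⟩ := mem_image.1 this
    exact ⟨fun z hz => Function.update_of_ne (by simpa using hz) _ _, hQ v hv⟩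
  · intro X hX y
    obtain rfl | rfl := subset_singleton_iff.1 hX
    · simp [sum_ite_mem, hIc, hC0.ne']
    · simp only [mem_singleton, forall_eq, card_singleton, pow_one]
      calc ∑ ψ with ψ x = y x, (if ψ ∈ I then (#C : ℝ)⁻¹ else 0)
          ≤ ∑ ψ ∈ {Function.update φ x (y x)}, (#C : ℝ)⁻¹ := by
            rw [← sum_filter]
            refine sum_le_sum_of_subset_of_nonneg ?_ fun _ _ _ => by positivity
            intro ψ hψ
            simp only [mem_filter, mem_univ, true_and, hI, mem_image] at hψ
            obtain ⟨h1, v, -, rfl⟩ := hψ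
            simp at h1
            simp [h1]
        _ ≤ q := by
            rw [sum_singleton, inv_le_iff_one_le_mul₀ hC0]
            linarith
  · simp only [ite_mul, zero_mul]
    rw [sum_ite_mem, univ_inter, sum_image hinj, ← mul_sum, inv_mul_le_iff₀ hC0]
    exact hF

/-- Modify the coordinates of `E` one at a time, in the order given by `rk`. -/
lemma iterate {rk : α → ℕ} (hrk : Function.Injective rk) (hq : 0 ≤ q)
    (P : Finset α → (α → β) → Prop) (W : Finset α → (α → β) → ℝ) (h0 : P ∅ φ)
    (step : ∀ x ∈ E, ∀ ψ, (∀ z ∉ {y ∈ E | rk y < rk x}, ψ z = φ z) →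
      P {y ∈ E | rk y < rk x} ψ →
      ∃ C : Finset β, 1 ≤ q * #C ∧
        (∀ v ∈ C, P (insert x {y ∈ E | rk y < rk x}) (Function.update ψ x v)) ∧
        ∑ v ∈ C, W (insert x {y ∈ E | rk y < rk x}) (Function.update ψ x v) ≤
          #C * W {y ∈ E | rk y < rk x} ψ) :
    RandomExtension q φ E (P E) (W E) (W ∅ φ) := by
  have key : ∀ k : ℕ, RandomExtension q φ {y ∈ E | rk y < k} (P {y ∈ E | rk y < k})
      (W {y ∈ E | rk y < k}) (W ∅ φ) := by
    intro k
    induction k with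
    | zero => simpa using refl (q := q) (Q := P ∅) (F := W ∅) h0 le_rfl
    | succ k ih =>
      by_cases hx : ∃ x ∈ E, rk x = k
      · obtain ⟨x, hxE, rfl⟩ := hx
        have hins : {y ∈ E | rk y < rk x + 1} = insert x {y ∈ E | rk y < rk x} := by
          ext y
          simp only [mem_filter, mem_insert, Nat.lt_succ_iff_lt_or_eq, hrk.eq_iff]
          constructor
          · rintro ⟨h1, h2 | h2⟩
            · exact .inr ⟨h1, h2⟩
            · exact .inl h2
          · rintro (rfl | ⟨h1, h2⟩)
            · exact ⟨hxE, .inr rfl⟩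
            · exact ⟨h1, .inl h2⟩
        rw [hins, insert_eq, union_comm]
        refine bind hq (by simp) ih fun ψ hψ hP => ?_
        obtain ⟨C, hC, hCP, hCW⟩ := step x hxE ψ hψ hP
        rw [union_comm, ← insert_eq]
        refine update (C := C) ?_ hC hCP hCW
        rw [nonempty_iff_ne_empty]
        rintro rfl
        norm_num at hC
      · have hins : {y ∈ E | rk y < k + 1} = {y ∈ E | rk y < k} := by
          ext y
          simp only [mem_filter, Nat.lt_succ_iff_lt_or_eq]
          constructor
          · rintro ⟨h1, h2 | h2⟩
            · exact ⟨h1, h2⟩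
            · exact absurd ⟨y, h1, h2⟩ hx
          · rintro ⟨h1, h2⟩
            exact ⟨h1, .inl h2⟩
        rwa [hins]
  have hE : {y ∈ E | rk y < E.sup rk + 1} = E :=
    filter_true_of_mem fun y hy => Nat.lt_succ_of_le (le_sup hy)
  have := key (E.sup rk + 1)
  rwa [hE] at this

/-- Version of `RandomExtension.iterate` without a cost. -/
lemma iterate_zero {rk : α → ℕ} (hrk : Function.Injective rk) (hq : 0 ≤ q)
    (P : Finset α → (α → β) → Prop) (h0 : P ∅ φ)
    (step : ∀ x ∈ E, ∀ ψ, (∀ z ∉ {y ∈ E | rk y < rk x}, ψ z = φ z) →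
      P {y ∈ E | rk y < rk x} ψ →
      ∃ C : Finset β, 1 ≤ q * #C ∧
        ∀ v ∈ C, P (insert x {y ∈ E | rk y < rk x}) (Function.update ψ x v)) :
    RandomExtension q φ E (P E) 0 0 := by
  refine iterate hrk hq P 0 h0 fun x hx ψ hψ hP => ?_
  obtain ⟨C, h1, h2⟩ := step x hx ψ hψ hP
  exact ⟨C, h1, h2, by simp⟩

/-- Conditioning on the cost being at most twice its expectation. -/
lemma condition (hq : 0 ≤ q) (hF : ∀ ψ, 0 ≤ F ψ) (hc : 0 < c) (h : RandomExtension q φ E Q F c) :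
    RandomExtension (2 * q) φ E (fun ψ => Q ψ ∧ F ψ ≤ 2 * c) 0 0 := by
  obtain ⟨ν, h0, h1, h2, h3, h4⟩ := h
  set Z := ∑ ψ with F ψ ≤ 2 * c, ν ψ with hZ
  have hZ2 : 1 / 2 ≤ Z := by
    have hsplit : Z + ∑ ψ with ¬ F ψ ≤ 2 * c, ν ψ = 1 := by
      rw [hZ, sum_filter_add_sum_filter_not, h1]
    have : (∑ ψ with ¬ F ψ ≤ 2 * c, ν ψ) * (2 * c) ≤ c := by
      rw [sum_mul]
      refine le_trans (sum_le_sum fun ψ hψ => ?_)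
        ((sum_le_sum_of_subset_of_nonneg (filter_subset _ _) fun ψ _ _ =>
          mul_nonneg (h0 ψ) (hF ψ)).trans h4)
      simp only [mem_filter, mem_univ, true_and, not_le] at hψ
      exact mul_le_mul_of_nonneg_left hψ.le (h0 ψ)
    nlinarith
  have hZ0 : 0 < Z := by linarith
  refine ⟨fun ψ => if F ψ ≤ 2 * c then ν ψ / Z else 0, ?_, ?_, ?_, ?_, by simp⟩
  · intro ψ
    have := h0 ψ
    positivity
  · rw [← sum_filter, ← sum_div, ← hZ, div_self hZ0.ne']
  · intro ψ hψ
    by_cases hle : F ψ ≤ 2 * c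
    · simp only [hle, if_true] at hψ
      have := h2 ψ (by rintro h; simp [h] at hψ)
      exact ⟨this.1, this.2, hle⟩
    · simp [hle] at hψ
  · intro X hX y
    obtain rfl | hne := X.eq_empty_or_nonempty
    · simp only [notMem_empty, false_imp_iff, implies_true, filter_true, card_empty, pow_zero]
      rw [← sum_filter, ← sum_div, ← hZ, div_self hZ0.ne']
    · calc ∑ ψ with ∀ x ∈ X, ψ x = y x, (if F ψ ≤ 2 * c then ν ψ / Z else 0)
          ≤ ∑ ψ with ∀ x ∈ X, ψ x = y x, 2 * ν ψ := by
            refine sum_le_sum fun ψ _ => ?_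
            have := h0 ψ
            split_ifs
            · rw [div_le_iff₀ hZ0]
              nlinarith
            · positivity
        _ ≤ 2 * q ^ #X := by
            rw [← mul_sum]
            exact mul_le_mul_of_nonneg_left (h3 X hX y) zero_le_two
        _ ≤ (2 * q) ^ #X := by
            rw [mul_pow]
            refine mul_le_mul_of_nonneg_right ?_ (by positivity)
            exact le_self_pow₀ one_le_two hne.card_pos.ne'

end RandomExtension

end RandomExtension

section TreeOrder

/-- A root of a tree with parent pointers, a vertex order in which parents come first, and the
proper two-colouring. -/
structure TreeOrder {α : Type*} (T : SimpleGraph α) where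
  root : α
  par : α → α
  rk : α → ℕ
  col : α → Bool
  par_root : par root = root
  adj_par : ∀ x, x ≠ root → T.Adj x (par x)
  adj_cases : ∀ u v, T.Adj u v → (u ≠ root ∧ par u = v) ∨ (v ≠ root ∧ par v = u)
  rk_injective : Function.Injective rk
  rk_par : ∀ x, x ≠ root → rk (par x) < rk x
  col_par : ∀ x, x ≠ root → col (par x) ≠ col x

variable {α : Type*} [Fintype α] [DecidableEq α] {T : SimpleGraph α}

lemma SimpleGraph.IsTree.nonempty_treeOrder (hT : T.IsTree) : Nonempty (TreeOrder T) := by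
  classical
  obtain ⟨r⟩ := hT.1.nonempty
  have hpar : ∀ x, ∃ y, (x = r → y = r) ∧ (x ≠ r → T.Adj x y ∧ T.dist r x = T.dist r y + 1) := by
    intro x
    by_cases hx : x = r
    · exact ⟨r, fun _ => rfl, fun h => absurd hx h⟩
    obtain ⟨w, hw⟩ := hT.1.exists_walk_length_eq_dist x r
    cases w with
    | nil => exact absurd rfl hx
    | cons h w =>
      rename_i y
      refine ⟨y, fun h' => absurd h' hx, fun _ => ⟨h, ?_⟩⟩
      have h1 : T.dist y r ≤ w.length := SimpleGraph.dist_le w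
      rw [SimpleGraph.Walk.length_cons] at hw
      rw [SimpleGraph.dist_comm (u := r) (v := x), SimpleGraph.dist_comm (u := r) (v := y)]
      have h2 : T.dist x r ≤ T.dist x y + T.dist y r := hT.1.dist_triangle
      rw [SimpleGraph.dist_eq_one_iff_adj.2 h] at h2
      omega
  choose par hp1 hp2 using hpar
  have hsurj : ∀ e ∈ T.edgeFinset, ∃ x ∈ univ.erase r, s(x, par x) = e := by
    intro e he
    refine surj_on_of_inj_on_of_card_le (fun x _ => s(x, par x)) ?_ ?_ ?_ e he |>.imp
      fun x ⟨hx, h⟩ => ⟨hx, h.symm⟩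
    · intro x hx
      rw [SimpleGraph.mem_edgeFinset, SimpleGraph.mem_edgeSet]
      exact (hp2 x (ne_of_mem_erase hx)).1
    · intro x y hx hy hxy
      have h1 := (hp2 x (ne_of_mem_erase hx)).2
      have h2 := (hp2 y (ne_of_mem_erase hy)).2
      rw [Sym2.eq_iff] at hxy
      rcases hxy with h | h
      · exact h.1
      · rw [h.2] at h1
        rw [← h.1] at h2
        omega
    · rw [card_erase_of_mem (mem_univ _), card_univ, ← hT.card_edgeFinset]
      simp
  let e := Fintype.equivFin α
  refine ⟨r, par, fun x => T.dist r x * Fintype.card α + e x, fun x => decide (Even (T.dist r x)),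
    hp1 r rfl, fun x hx => (hp2 x hx).1, ?_, ?_, ?_, ?_⟩
  · intro u v huv
    obtain ⟨x, hx, h⟩ := hsurj s(u, v) (by simpa using huv)
    rw [Sym2.eq_iff] at h
    rcases h with ⟨rfl, h⟩ | ⟨rfl, h⟩
    · exact .inl ⟨ne_of_mem_erase hx, h⟩
    · exact .inr ⟨ne_of_mem_erase hx, h⟩
  · intro x y hxy
    have := congrArg (· % Fintype.card α) hxy
    simp only [Nat.mul_add_mod_self_right, Nat.mod_eq_of_lt (e x).2,
      Nat.mod_eq_of_lt (e y).2] at this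
    exact e.injective (Fin.ext this)
  · intro x hx
    have := (hp2 x hx).2
    have h3 := (e (par x)).2
    rw [this]
    nlinarith
  · intro x hx
    have := (hp2 x hx).2
    simp only [this, Nat.even_add_one, ne_eq, decide_eq_decide]
    tauto

namespace TreeOrder

variable (O : TreeOrder T)

lemma rk_iterate_le (k : ℕ) (x : α) : O.rk (O.par^[k] x) ≤ O.rk x := by
  induction k generalizing x with
  | zero => rfl
  | succ k ih =>
    rw [Function.iterate_succ_apply]
    refine (ih _).trans ?_
    by_cases hx : x = O.root
    · rw [hx, O.par_root]
    · exact (O.rk_par x hx).le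

lemma exists_iterate_eq_root (x : α) : ∃ k, O.par^[k] x = O.root := by
  induction h : O.rk x using Nat.strong_induction_on generalizing x with
  | _ n ih =>
    by_cases hx : x = O.root
    · exact ⟨0, hx⟩
    · obtain ⟨k, hk⟩ := ih _ (h ▸ O.rk_par x hx) _ rfl
      exact ⟨k + 1, hk⟩

/-- The vertices of `U` in the subtree below `v`. -/
noncomputable def below (U : Finset α) (v : α) : Finset α :=
  open scoped Classical in {x ∈ U | ∃ k, O.par^[k] x = v}

variable {O}

lemma mem_below {U : Finset α} {v x : α} : x ∈ O.below U v ↔ x ∈ U ∧ ∃ k, O.par^[k] x = v := by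
  simp [below]

lemma exists_child {x v : α} {k : ℕ} (hk : O.par^[k] x = v) (hx : x ≠ v) :
    ∃ j, O.par^[j] x ≠ O.root ∧ O.par (O.par^[j] x) = v := by
  induction k with
  | zero => exact absurd hk hx
  | succ k ih =>
    by_cases h : O.par^[k] x = v
    · exact ih h
    · rw [Function.iterate_succ_apply'] at hk
      refine ⟨k, fun hr => h ?_, hk⟩
      rw [hr, O.par_root] at hk
      rw [hr, hk]

lemma card_below_le {Δ p : ℕ} (hΔ : ∀ v, #{c | c ≠ O.root ∧ O.par c = v} ≤ Δ) {U : Finset α}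
    (hU : ∀ x ∈ U, O.par x ∈ U) {v : α}
    (hv : ∀ c, O.rk v < O.rk c → c ∈ U → #(O.below U c) ≤ p) : #(O.below U v) ≤ Δ * p + 1 := by
  have hiter : ∀ k, ∀ x ∈ U, O.par^[k] x ∈ U := by
    intro k
    induction k with
    | zero => exact fun x hx => hx
    | succ k ih => exact fun x hx => ih _ (hU x hx)
  have hsub : O.below U v ⊆ insert v
      (({c | c ≠ O.root ∧ O.par c = v} : Finset α).biUnion
        fun c => if c ∈ U then O.below U c else ∅) := by
    intro x hx
    obtain ⟨hxU, k, hk⟩ := mem_below.1 hx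
    rw [mem_insert]
    refine or_iff_not_imp_left.2 fun hne => ?_
    obtain ⟨j, hj⟩ := exists_child hk hne
    refine mem_biUnion.2 ⟨O.par^[j] x, by simpa using hj, ?_⟩
    rw [if_pos (hiter j x hxU)]
    exact mem_below.2 ⟨hxU, j, rfl⟩
  refine (card_le_card hsub).trans ((card_insert_le _ _).trans ?_)
  gcongr
  refine (card_biUnion_le_card_mul _ _ p ?_).trans (Nat.mul_le_mul_right _ (hΔ v))
  intro c hc
  simp only [mem_filter, mem_univ, true_and] at hc
  split_ifs with hcU
  · exact hv c (hc.2 ▸ O.rk_par c hc.1) hcU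
  · simp

lemma exists_blocks_aux {Δ p : ℕ} (hΔ : ∀ v, #{c | c ≠ O.root ∧ O.par c = v} ≤ Δ) (hp : 1 ≤ p)
    (m : ℕ) : ∀ U : Finset α, (∀ x ∈ U, O.par x ∈ U) → #U = m →
    ∃ (blk : α → ℕ) (B : ℕ), (∀ x ∈ U, blk x < B) ∧ B * p ≤ #U + p ∧
      (∀ x ∈ U, blk (O.par x) ≤ blk x) ∧ (∀ j, #{x ∈ U | blk x = j} ≤ Δ * p + p + 1) ∧
      ∀ x ∈ U, ∀ y ∈ U, (x = O.root ∨ blk (O.par x) < blk x) →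
        (y = O.root ∨ blk (O.par y) < blk y) → blk x = blk y → x = y := by
  induction m using Nat.strong_induction_on with
  | _ m ih =>
    intro U hU hm
    by_cases hne : ({v ∈ U | p ≤ #(O.below U v)} : Finset α).Nonempty
    · obtain ⟨v, hv, hmax⟩ := exists_max_image _ O.rk hne
      simp only [mem_filter] at hv hmax
      have hsub : O.below U v ⊆ U := fun x hx => (mem_below.1 hx).1
      have hcard := card_sdiff_add_card_eq_card hsub
      have hUD : ∀ x ∈ U \ O.below U v, O.par x ∈ U \ O.below U v := by
        intro x hx
        simp only [mem_sdiff, mem_below, not_and, not_exists] at hx ⊢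
        refine ⟨hU x hx.1, fun _ k hk => hx.2 hx.1 (k + 1) hk⟩
      have hin : ∀ x ∈ O.below U v, x ≠ v → O.par x ∈ O.below U v := by
        intro x hx hxv
        obtain ⟨hxU, k, hk⟩ := mem_below.1 hx
        refine mem_below.2 ⟨hU x hxU, ?_⟩
        cases k with
        | zero => exact absurd hk hxv
        | succ k => exact ⟨k, hk⟩
      have hout : v ≠ O.root → O.par v ∉ O.below U v := by
        intro hvr hmem
        obtain ⟨-, k, hk⟩ := mem_below.1 hmem
        have := O.rk_iterate_le k (O.par v)
        rw [hk] at this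
        exact absurd (O.rk_par v hvr) (not_lt.2 this)
      obtain ⟨blk, B, h1, h2, h3, h4, h5⟩ := ih _ (by omega) (U \ O.below U v) hUD rfl
      have hD : ∀ x, x ∈ O.below U v → (if x ∈ O.below U v then B else blk x) = B :=
        fun x hx => if_pos hx
      have hN : ∀ x, x ∉ O.below U v → (if x ∈ O.below U v then B else blk x) = blk x :=
        fun x hx => if_neg hx
      have hroot : ∀ x ∈ O.below U v, (x = O.root ∨
          (if O.par x ∈ O.below U v then B else blk (O.par x)) <
            (if x ∈ O.below U v then B else blk x)) → x = v := by
        intro x hx h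
        by_contra hxv
        rw [hD _ hx, hD _ (hin x hx hxv)] at h
        rcases h with rfl | h
        · obtain ⟨-, k, hk⟩ := mem_below.1 hx
          rw [Function.iterate_fixed O.par_root] at hk
          exact hxv hk
        · exact lt_irrefl _ h
      refine ⟨fun x => if x ∈ O.below U v then B else blk x, B + 1, ?_, ?_, ?_, ?_, ?_⟩
      · intro x hx
        dsimp only
        split_ifs with hxD
        · omega
        · have := h1 x (mem_sdiff.2 ⟨hx, hxD⟩)
          omega
      · have := hv.2
        nlinarith
      · intro x hx
        dsimp only
        by_cases hxD : x ∈ O.below U v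
        · rw [hD x hxD]
          split_ifs with hpx
          · rfl
          · exact (h1 _ (mem_sdiff.2 ⟨hU x hx, hpx⟩)).le
        · have hx' := mem_sdiff.2 ⟨hx, hxD⟩
          rw [hN x hxD, hN _ (mem_sdiff.1 (hUD x hx')).2]
          exact h3 x hx'
      · intro j
        have hle : #(O.below U v) ≤ Δ * p + 1 := by
          refine card_below_le hΔ hU fun c hc hcU => ?_
          by_contra! hlt
          exact absurd (hmax c ⟨hcU, hlt.le⟩) (not_le.2 hc)
        by_cases hj : j = B
        · subst hj
          refine (card_le_card (fun x hx => ?_)).trans (hle.trans (by omega))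
          simp only [mem_filter] at hx
          by_contra hxD
          rw [hN x hxD] at hx
          have := h1 x (mem_sdiff.2 ⟨hx.1, hxD⟩)
          omega
        · refine (card_le_card (fun x hx => ?_)).trans (h4 j)
          simp only [mem_filter] at hx ⊢
          have hxD : x ∉ O.below U v := by
            intro hxD
            rw [hD x hxD] at hx
            exact hj hx.2.symm
          rw [hN x hxD] at hx
          exact ⟨mem_sdiff.2 ⟨hx.1, hxD⟩, hx.2⟩
      · intro x hx y hy hxr hyr hxy
        dsimp only at hxr hyr hxy
        by_cases hxD : x ∈ O.below U v <;> by_cases hyD : y ∈ O.below U v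
        · rw [hroot x hxD hxr, hroot y hyD hyr]
        · rw [hD x hxD, hN y hyD] at hxy
          have := h1 y (mem_sdiff.2 ⟨hy, hyD⟩)
          omega
        · rw [hN x hxD, hD y hyD] at hxy
          have := h1 x (mem_sdiff.2 ⟨hx, hxD⟩)
          omega
        · have hx' := mem_sdiff.2 ⟨hx, hxD⟩
          have hy' := mem_sdiff.2 ⟨hy, hyD⟩
          rw [hN x hxD, hN _ (mem_sdiff.1 (hUD x hx')).2] at hxr
          rw [hN y hyD, hN _ (mem_sdiff.1 (hUD y hy')).2] at hyr
          rw [hN x hxD, hN y hyD] at hxy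
          exact h5 x hx' y hy' hxr hyr hxy
    · obtain rfl | hUne := U.eq_empty_or_nonempty
      · exact ⟨0, 0, by simp⟩
      · have hr : O.root ∈ U := by
          obtain ⟨x, hx⟩ := hUne
          obtain ⟨k, hk⟩ := O.exists_iterate_eq_root x
          have : ∀ k, O.par^[k] x ∈ U := by
            intro k
            induction k with
            | zero => exact hx
            | succ k ih => rw [Function.iterate_succ_apply']; exact hU _ ih
          exact hk ▸ this k
        have hall : O.below U O.root = U :=
          Subset.antisymm (fun x hx => (mem_below.1 hx).1)
            fun x hx => mem_below.2 ⟨hx, O.exists_iterate_eq_root x⟩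
        have hlt : #U < p := by
          by_contra! h
          exact hne ⟨O.root, mem_filter.2 ⟨hr, by rwa [hall]⟩⟩
        refine ⟨0, 1, by simp, by simp, by simp, fun j => ?_, ?_⟩
        · exact (card_filter_le _ _).trans (by omega)
        · intro x _ y _ hx hy _
          simp only [Pi.zero_apply, lt_irrefl, or_false] at hx hy
          rw [hx, hy]

/-- A bounded-degree tree splits into few small connected blocks, ordered top-down. -/
lemma exists_blocks (O : TreeOrder T) {Δ p : ℕ}
    (hΔ : ∀ v, #{c | c ≠ O.root ∧ O.par c = v} ≤ Δ) (hp : 1 ≤ p) :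
    ∃ (blk : α → ℕ) (B : ℕ), (∀ x, blk x < B) ∧ B * p ≤ Fintype.card α + p ∧
      (∀ x, blk (O.par x) ≤ blk x) ∧ (∀ j, #{x | blk x = j} ≤ Δ * p + p + 1) ∧
      ∀ x y, (x = O.root ∨ blk (O.par x) < blk x) →
        (y = O.root ∨ blk (O.par y) < blk y) → blk x = blk y → x = y := by
  simpa using exists_blocks_aux hΔ hp _ univ (by simp) rfl

end TreeOrder

end TreeOrder

section Matching

open scoped Classical in
/-- A graph of minimum degree at least half the number of vertices has a matching that misses at
most one vertex. -/
lemma SimpleGraph.exists_involution_of_card_le_two_mul_degree {κ : Type*} [Fintype κ]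
    (R : SimpleGraph κ) (hR : ∀ v, Fintype.card κ ≤ 2 * #{w | R.Adj v w}) :
    ∃ f : κ → κ, (∀ v, f (f v) = v) ∧ (∀ v, f v ≠ v → R.Adj v (f v)) ∧
      ∀ x y, f x = x → f y = y → x = y := by
  let S : Finset (κ → κ) := {f | (∀ v, f (f v) = v) ∧ ∀ v, f v ≠ v → R.Adj v (f v)}
  obtain ⟨f, hfS, hmin⟩ := exists_min_image S (fun f => #{v | f v = v}) ⟨id, by simp [S]⟩
  obtain ⟨hf, hfR⟩ : (∀ v, f (f v) = v) ∧ ∀ v, f v ≠ v → R.Adj v (f v) := by simpa [S] using hfS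
  have himp : ∀ g : κ → κ, (∀ v, g (g v) = v) → (∀ v, g v ≠ v → R.Adj v (g v)) →
      ∀ x, f x = x → g x ≠ x → (∀ v, g v = v → f v = v) → False := by
    intro g hg hgR x hx hgx hsub
    refine (hmin g (mem_filter.2 ⟨mem_univ _, hg, hgR⟩)).not_gt (card_lt_card ?_)
    rw [ssubset_iff_of_subset (fun v hv => by simpa using hsub v (by simpa using hv))]
    exact ⟨x, by simpa using hx, by simpa using hgx⟩
  refine ⟨f, hf, hfR, fun x y hx hy => ?_⟩
  by_contra hxy
  have hfix : ∀ x z, f x = x → f z = z → ¬ R.Adj x z := by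
    intro x z hx hz hadj
    have hne := hadj.ne
    refine himp (fun v => if v = x then z else if v = z then x else f v) ?_ ?_ x hx
      (by simpa using hne.symm) ?_
    · intro v
      have := hf v
      grind
    · intro v hv
      have := hfR v
      have := hadj.symm
      grind
    · intro v hv
      grind
  have hd : Disjoint (({w | R.Adj x w} : Finset κ).image f) ({w | R.Adj y w} : Finset κ) := by
    rw [Finset.disjoint_left]
    simp only [mem_image, mem_filter, mem_univ, true_and, forall_exists_index, and_imp]
    rintro _ a hxa rfl hya
    have hane : f a ≠ a := fun h => hfix x a hx h hxa
    have h1 := hxa.ne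
    have h2 := hya.ne
    have h3 : f a ≠ x := fun h => h1 (by rw [← hf a, h, hx])
    have h4 : a ≠ y := fun h => by rw [h, hy] at h2; exact h2 rfl
    have hxa' := hxa.symm
    have hya' := hya.symm
    have hfa := hf a
    refine himp (fun v => if v = x then a else if v = a then x else if v = y then f a else
      if v = f a then y else f v) ?_ ?_ x hx (by simpa using h1.symm) ?_
    · intro v
      have := hf v
      grind
    · intro v hv
      have := hfR v
      grind
    · intro v hv
      grind
  have hinj : Function.Injective f := Function.LeftInverse.injective hf
  have hsub : ({w | R.Adj x w} : Finset κ).image f ∪ ({w | R.Adj y w} : Finset κ) ⊆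
      univ.erase x := by
    intro v hv
    simp only [mem_erase, mem_univ, and_true]
    rintro rfl
    simp only [mem_union, mem_image, mem_filter, mem_univ, true_and] at hv
    rcases hv with ⟨a, ha, hav⟩ | hv
    · rw [← hf a, hav, hx] at ha
      exact ha.ne rfl
    · exact hfix _ _ hy hx hv
  have hc := card_le_card hsub
  rw [card_union_of_disjoint hd, card_image_of_injective _ hinj, card_erase_of_mem (mem_univ _),
    card_univ] at hc
  have h1 := hR x
  have h2 := hR y
  have : 0 < Fintype.card κ := Fintype.card_pos_iff.2 ⟨x⟩
  omega

end Matching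

section HittingSets

variable {ι β : Type*} [DecidableEq β]

lemma exists_subset_sum_half_pow_le (I : Finset ι) (F : ι → Finset β) (X : Finset β) {b : ℝ}
    (hF : ∀ i ∈ I, b * #X ≤ #(F i ∩ X)) (hb1 : b ≤ 1) (w : ℕ) (hw : w ≤ b * #X / 2) :
    ∃ W ⊆ X, #W = w ∧ ∑ i ∈ I, (1 / 2 : ℝ) ^ #(W ∩ F i) ≤ #I * (1 - b / 4) ^ w := by
  induction w with
  | zero => exact ⟨∅, by simp⟩
  | succ w ih =>
    push_cast at hw
    obtain ⟨W, hWX, hWc, hW⟩ := ih (by linarith)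
    have hXW : (#(X \ W) : ℝ) = #X - w := by
      rw [card_sdiff_of_subset hWX, hWc, Nat.cast_sub (hWc ▸ card_le_card hWX)]
    have hpos : (0 : ℝ) < #X - w := by
      have : (0 : ℝ) ≤ #X := by positivity
      nlinarith [Nat.cast_nonneg (α := ℝ) w]
    have hne : (X \ W).Nonempty := by
      rw [← card_pos, ← Nat.cast_pos (α := ℝ), hXW]; exact hpos
    have hb0 : 0 ≤ b := by
      by_contra h
      have : (0 : ℝ) ≤ #X := by positivity
      nlinarith [Nat.cast_nonneg (α := ℝ) w]
    have hsum : ∑ x ∈ X \ W, ∑ i ∈ I, (1 / 2 : ℝ) ^ #(insert x W ∩ F i) ≤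
        ∑ x ∈ X \ W, (#I * (1 - b / 4) ^ (w + 1) : ℝ) := by
      rw [sum_comm, sum_const, nsmul_eq_mul, hXW]
      calc ∑ i ∈ I, ∑ x ∈ X \ W, (1 / 2 : ℝ) ^ #(insert x W ∩ F i)
          ≤ ∑ i ∈ I, (#X - w) * (1 - b / 4) * (1 / 2 : ℝ) ^ #(W ∩ F i) := by
            refine sum_le_sum fun i hi => ?_
            have hx : ∀ x ∈ X \ W, (1 / 2 : ℝ) ^ #(insert x W ∩ F i) =
                (1 / 2 : ℝ) ^ #(W ∩ F i) - if x ∈ F i then (1 / 2 : ℝ) ^ #(W ∩ F i) / 2 else 0 := by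
              intro x hx
              by_cases hxF : x ∈ F i
              · rw [insert_inter_of_mem hxF, card_insert_of_notMem (by simp_all), pow_succ,
                  if_pos hxF]
                ring
              · rw [insert_inter_of_notMem hxF, if_neg hxF, sub_zero]
            rw [sum_congr rfl hx, sum_sub_distrib, sum_const, ← sum_filter, sum_const,
              nsmul_eq_mul, nsmul_eq_mul, hXW]
            have hcard : b * #X - w ≤ (#{x ∈ X \ W | x ∈ F i} : ℝ) := by
              have h1 : #(F i ∩ X) ≤ #{x ∈ X \ W | x ∈ F i} + #W := by
                refine (card_le_card ?_).trans (card_union_le _ _)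
                intro x
                simp only [mem_inter, mem_union, mem_filter, mem_sdiff]
                tauto
              have h2 : (#(F i ∩ X) : ℝ) ≤ #{x ∈ X \ W | x ∈ F i} + #W := by exact_mod_cast h1
              rw [hWc] at h2
              linarith [hF i hi]
            have hp : (0 : ℝ) < (1 / 2) ^ #(W ∩ F i) := by positivity
            have : b / 2 * (#X - w) ≤ (#{x ∈ X \ W | x ∈ F i} : ℝ) := by
              nlinarith [Nat.cast_nonneg (α := ℝ) w]
            nlinarith
        _ ≤ (#X - w) * (#I * (1 - b / 4) ^ (w + 1)) := by
            rw [← mul_sum, pow_succ]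
            have : 0 ≤ (#X - w) * (1 - b / 4) := mul_nonneg hpos.le (by linarith)
            nlinarith
    obtain ⟨x, hx, hle⟩ := exists_le_of_sum_le hne hsum
    rw [mem_sdiff] at hx
    exact ⟨insert x W, insert_subset hx.1 hWX, by rw [card_insert_of_notMem hx.2, hWc], hle⟩

/-- A dense family of subsets of `X` of subexponential size has a common proportional sample. -/
lemma exists_sample (I : Finset ι) (F : ι → Finset β) (X : Finset β) {b : ℝ}
    (hF : ∀ i ∈ I, b * #X ≤ #(F i ∩ X)) (hb1 : b ≤ 1) (w : ℕ) (hw : w ≤ b * #X / 2)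
    (hI : (#I : ℝ) ≤ Real.exp (b / 8 * w)) :
    ∃ W ⊆ X, #W = w ∧ ∀ i ∈ I, b / 8 * w ≤ #(W ∩ F i) := by
  obtain ⟨W, hWX, hWc, hW⟩ := exists_subset_sum_half_pow_le I F X hF hb1 w hw
  refine ⟨W, hWX, hWc, fun i hi => ?_⟩
  by_contra! h
  have h1 : Real.exp (-(#(W ∩ F i) : ℝ)) ≤ (1 / 2 : ℝ) ^ #(W ∩ F i) := by
    have : Real.exp (-1) ≤ 1 / 2 := by
      rw [Real.exp_neg, one_div]
      exact inv_anti₀ (by norm_num) (by linarith [Real.add_one_le_exp (1 : ℝ)])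
    calc Real.exp (-(#(W ∩ F i) : ℝ)) = Real.exp (-1) ^ #(W ∩ F i) := by
          rw [← Real.exp_nat_mul]; ring_nf
      _ ≤ _ := by gcongr
  have h2 : (1 / 2 : ℝ) ^ #(W ∩ F i) ≤ #I * (1 - b / 4) ^ w :=
    (single_le_sum (f := fun i => (1 / 2 : ℝ) ^ #(W ∩ F i)) (fun _ _ => by positivity) hi).trans hW
  have h3 : (1 - b / 4) ^ w ≤ Real.exp (-(b / 4) * w) := by
    rw [mul_comm, Real.exp_nat_mul]
    exact pow_le_pow_left₀ (by linarith) (by linarith [Real.add_one_le_exp (-(b / 4))]) _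
  have h4 : (#I : ℝ) * (1 - b / 4) ^ w ≤ Real.exp (b / 8 * w) * Real.exp (-(b / 4) * w) :=
    mul_le_mul hI h3 (pow_nonneg (by linarith) _) (Real.exp_pos _).le
  rw [← Real.exp_add] at h4
  have h5 := Real.exp_le_exp.1 (h1.trans (h2.trans h4))
  linarith

end HittingSets

section RegularPartition

open scoped Classical in
/-- All large subpairs of `(X, Y)` have edge density at least `d`. -/
def DensePair {β : Type*} (G : SimpleGraph β) (ε d : ℝ) (X Y : Finset β) : Prop :=
  ∀ A ⊆ X, ∀ B ⊆ Y, ε * #X ≤ #A → ε * #Y ≤ #B →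
    d * (#A * #B) ≤ ∑ a ∈ A, (#{b ∈ B | G.Adj a b} : ℝ)

set_option maxHeartbeats 1000000 in
open scoped Classical in
lemma exists_regular_partition {ε η : ℝ} (hε : 0 < ε) (hεη : ε ≤ η / 16) (hη : η ≤ 1) :
    ∃ K N₀ : ℕ, ∀ {V : Type} [Fintype V] (G : SimpleGraph V), N₀ ≤ Fintype.card V →
      (∀ v, (1 / 2 + η) * Fintype.card V ≤ #{w | G.Adj v w}) →
      ∃ (κ : Type) (_ : Fintype κ) (X : κ → Finset V) (h : ℕ) (R : SimpleGraph κ)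
        (bad : Finset κ), Fintype.card κ ≤ K ∧ 1 ≤ ε * Fintype.card κ ∧ (∀ v, ∃ i, v ∈ X i) ∧
        (∀ i j, i ≠ j → Disjoint (X i) (X j)) ∧ (∀ i, h ≤ #(X i) ∧ #(X i) ≤ h + 1) ∧
        (∀ i j, R.Adj i j → DensePair G ε (η / 16) (X i) (X j)) ∧
        #bad ≤ ε * Fintype.card κ ∧
        ∀ i ∉ bad, (1 / 2 + η / 2) * Fintype.card κ ≤ #{j | R.Adj i j} := by
  set l := ⌈1 / ε⌉₊ with hl
  set K := SzemerediRegularity.bound (ε ^ 2) l with hK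
  have hη0 : 0 < η := by linarith
  have hε1 : ε < 1 := by linarith
  refine ⟨K, l + (K + 1) * (⌈8 / η⌉₊ + 1), fun {V} _ G hN hdeg => ?_⟩
  obtain ⟨P, hPeq, hlP, hPK, hPu⟩ := szemeredi_regularity (α := V) G (ε := ε ^ 2) (l := l)
    (by positivity) (by omega)
  set k := #P.parts with hk
  set N := Fintype.card V with hNdef
  have hlpos : 0 < l := Nat.ceil_pos.2 (by positivity)
  have hkpos : 0 < k := by omega
  have hk0 : (0 : ℝ) < k := by exact_mod_cast hkpos
  set h := N / k with hh
  have hkh : k * h ≤ N := Nat.mul_div_le _ _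
  have hh8 : 8 / η ≤ h := by
    have h1 : ⌈8 / η⌉₊ ≤ h := by
      rw [hh, Nat.le_div_iff_mul_le hkpos]
      have : k ≤ K + 1 := by omega
      nlinarith [Nat.zero_le (⌈8 / η⌉₊)]
    exact (Nat.le_ceil _).trans (by exact_mod_cast h1)
  have hh0 : (0 : ℝ) < h := lt_of_lt_of_le (by positivity) hh8
  have hhη : (h + 1) * (1 - η / 8) ≤ (h : ℝ) := by
    rw [div_le_iff₀ hη0] at hh8
    nlinarith
  have hsize : ∀ p ∈ P.parts, h ≤ #p ∧ #p ≤ h + 1 := fun p hp =>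
    ⟨by simpa using hPeq.average_le_card_part hp, by simpa using hPeq.card_part_le_average_add_one hp⟩
  let R : SimpleGraph {p // p ∈ P.parts} :=
    { Adj := fun i j => i ≠ j ∧ G.IsUniform (ε ^ 2) i.1 j.1 ∧ η / 8 ≤ (G.edgeDensity i.1 j.1 : ℝ)
      symm := ⟨fun i j hij => ⟨hij.1.symm, hij.2.1.symm, by
        rw [SimpleGraph.edgeDensity_comm]; exact hij.2.2⟩⟩
      loopless := ⟨fun i hi => hi.1 rfl⟩ }
  have hcard : ∀ A B : Finset V, (#(G.interedges A B) : ℝ) = ∑ a ∈ A, (#{b ∈ B | G.Adj a b} : ℝ) := by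
    intro A B
    rw [SimpleGraph.interedges, Rel.interedges, card_filter, sum_product]
    push_cast
    refine sum_congr rfl fun a _ => ?_
    rw [card_filter]
    push_cast
    rfl
  have hdens : ∀ A B : Finset V, (G.edgeDensity A B : ℝ) * (#A * #B) =
      ∑ a ∈ A, (#{b ∈ B | G.Adj a b} : ℝ) := by
    intro A B
    rw [← hcard, SimpleGraph.edgeDensity_def]
    push_cast
    by_cases h0 : (#A : ℝ) * #B = 0
    · rw [h0, mul_zero]
      have := G.card_interedges_le_mul A B
      have h2 : (#(G.interedges A B) : ℝ) ≤ #A * #B := by exact_mod_cast this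
      have h3 : (0 : ℝ) ≤ #(G.interedges A B) := by positivity
      linarith
    · rw [div_mul_cancel₀ _ h0]
  have hcardκ : Fintype.card {p // p ∈ P.parts} = k := by simp [hk]
  set bad : Finset {p // p ∈ P.parts} :=
    {i | ε * k < #{j : {p // p ∈ P.parts} | i ≠ j ∧ ¬ G.IsUniform (ε ^ 2) i.1 j.1}} with hbad
  refine ⟨{p // p ∈ P.parts}, inferInstance, Subtype.val, h, R,
    bad, ?_, ?_, ?_, ?_, ?_, ?_, ?_, ?_⟩
  · simpa using hPK
  · have : 1 / ε ≤ k := (Nat.le_ceil _).trans (by exact_mod_cast hlP)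
    rw [div_le_iff₀ hε] at this
    simpa [mul_comm] using this
  · intro v
    obtain ⟨p, hp, hv⟩ := P.exists_mem (mem_univ v)
    exact ⟨⟨p, hp⟩, hv⟩
  · intro i j hij
    exact P.disjoint i.2 j.2 (fun h => hij (Subtype.ext h))
  · exact fun i => hsize i.1 i.2
  · rintro i j ⟨-, hu, hd⟩ A hA B hB hAc hBc
    rw [← hdens]
    have hε2 : ε ^ 2 ≤ ε := by nlinarith
    have := hu hA hB (by nlinarith [Nat.cast_nonneg (α := ℝ) #i.1])
      (by nlinarith [Nat.cast_nonneg (α := ℝ) #j.1])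
    rw [abs_lt] at this
    have h1 : η / 16 ≤ (G.edgeDensity A B : ℝ) := by linarith
    exact mul_le_mul_of_nonneg_right h1 (by positivity)
  · rw [hcardκ]
    have h1 : ∑ i : {p // p ∈ P.parts}, #{j : {p // p ∈ P.parts} |
        i ≠ j ∧ ¬ G.IsUniform (ε ^ 2) i.1 j.1} ≤ #(P.nonUniforms G (ε ^ 2)) := by
      rw [← card_sigma]
      refine card_le_card_of_injOn (fun x => (x.1.1, x.2.1)) ?_ ?_
      · rintro ⟨i, j⟩ hij
        simp only [coe_sigma, Set.mem_sigma_iff, mem_coe, mem_univ, mem_filter, true_and] at hij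
        rw [mem_coe, Finpartition.mk_mem_nonUniforms]
        exact ⟨i.2, j.2, fun h => hij.1 (Subtype.ext h), hij.2⟩
      · rintro ⟨i, j⟩ - ⟨i', j'⟩ - hij
        simp only [Prod.mk.injEq] at hij
        obtain rfl := Subtype.ext hij.1
        obtain rfl := Subtype.ext hij.2
        rfl
    have h2 : #bad * (ε * k) ≤ (#(P.nonUniforms G (ε ^ 2)) : ℝ) := by
      refine le_trans ?_ (Nat.cast_le.2 h1)
      push_cast
      rw [← nsmul_eq_mul]
      refine (card_nsmul_le_sum bad _ _ fun i hi => (mem_filter.1 hi).2.le).trans ?_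
      exact sum_le_sum_of_subset_of_nonneg (subset_univ _) fun _ _ _ => by positivity
    have h3 : (#(P.nonUniforms G (ε ^ 2)) : ℝ) ≤ (ε * k) * (ε * k) := by
      refine le_trans hPu ?_
      have : ((k * (k - 1) : ℕ) : ℝ) ≤ k * k := by
        exact_mod_cast Nat.mul_le_mul_left k (Nat.sub_le k 1)
      nlinarith [sq_nonneg ε]
    exact le_of_mul_le_mul_right (h2.trans h3) (by positivity)
  · intro i hi
    rw [hcardκ]
    have hi' : (#{j : {p // p ∈ P.parts} | i ≠ j ∧ ¬ G.IsUniform (ε ^ 2) i.1 j.1} : ℝ) ≤ ε * k := by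
      simpa [hbad] using hi
    have hX0 : (0 : ℝ) < #i.1 := lt_of_lt_of_le hh0 (by exact_mod_cast (hsize i.1 i.2).1)
    have hsumN : ∑ j : {p // p ∈ P.parts}, (#j.1 : ℝ) = N := by
      rw [sum_coe_sort P.parts (fun p => (#p : ℝ)), ← Nat.cast_sum, P.sum_card_parts, card_univ]
    have hlow : #i.1 * ((1 / 2 + η) * N) ≤ (#(G.interedges i.1 univ) : ℝ) := by
      rw [hcard, ← nsmul_eq_mul]
      exact card_nsmul_le_sum _ _ _ fun a _ => hdeg a
    have hup : (#(G.interedges i.1 univ) : ℝ) ≤ ∑ j : {p // p ∈ P.parts},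
        (#i.1 * (h + 1) * ((if R.Adj i j then 1 else 0) +
          (if i ≠ j ∧ ¬ G.IsUniform (ε ^ 2) i.1 j.1 then 1 else 0) + if i = j then 1 else 0) +
          η / 8 * #i.1 * #j.1) := by
      have : #(G.interedges i.1 univ) = ∑ p ∈ P.parts, #(G.interedges i.1 p) :=
        Rel.card_interedges_finpartition_right G.Adj i.1 P
      rw [this, ← sum_coe_sort]
      push_cast
      refine sum_le_sum fun j _ => ?_
      have hle : (#(G.interedges i.1 j.1) : ℝ) ≤ #i.1 * (h + 1) := by
        have h1 : #(G.interedges i.1 j.1) ≤ #i.1 * (h + 1) :=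
          (G.card_interedges_le_mul i.1 j.1).trans (Nat.mul_le_mul_left _ (hsize j.1 j.2).2)
        exact_mod_cast h1
      have hnn : 0 ≤ η / 8 * #i.1 * #j.1 := by positivity
      have hnn' : (0 : ℝ) ≤ #i.1 * (h + 1) := by positivity
      by_cases h1 : i = j
      · subst h1
        simp only [SimpleGraph.irrefl, if_true, if_false, ne_eq, not_true, false_and]
        linarith
      · by_cases h2 : G.IsUniform (ε ^ 2) i.1 j.1
        · by_cases h3 : η / 8 ≤ (G.edgeDensity i.1 j.1 : ℝ)
          · rw [if_pos (show R.Adj i j from ⟨h1, h2, h3⟩)]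
            simp only [h1, h2, if_false, not_true, and_false]
            linarith
          · have : ¬ R.Adj i j := fun h => h3 h.2.2
            simp only [this, h1, h2, if_false, not_true, and_false]
            rw [hcard, ← hdens]
            nlinarith
        · have : ¬ R.Adj i j := fun h => h2 h.2.1
          simp only [this, h1, h2, if_false, if_true, ne_eq, not_false_eq_true, true_and]
          linarith
    rw [sum_add_distrib, ← mul_sum, ← mul_sum, hsumN, sum_add_distrib, sum_add_distrib,
      sum_boole, sum_boole, sum_boole, filter_eq univ i, if_pos (mem_univ i), card_singleton] at hup
    have hkey : (1 / 2 + η) * N ≤ (h + 1) * ((#{j | R.Adj i j} : ℝ) + ε * k + ε * k) + η / 8 * N := by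
      have h1k : 1 ≤ ε * k := by
        have : 1 / ε ≤ k := (Nat.le_ceil _).trans (by exact_mod_cast hlP)
        rw [div_le_iff₀ hε] at this
        linarith
      have h2 : (#i.1 : ℝ) * ((1 / 2 + η) * N) ≤
          #i.1 * ((h + 1) * ((#{j | R.Adj i j} : ℝ) + ε * k + ε * k) + η / 8 * N) := by
        refine (hlow.trans hup).trans ?_
        have : (#i.1 : ℝ) * (h + 1) * (#{j | R.Adj i j} +
            #{j : {p // p ∈ P.parts} | i ≠ j ∧ ¬ G.IsUniform (ε ^ 2) i.1 j.1} + (1 : ℕ)) ≤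
            #i.1 * (h + 1) * (#{j | R.Adj i j} + ε * k + ε * k) := by
          refine mul_le_mul_of_nonneg_left ?_ (by positivity)
          push_cast
          linarith
        linarith
      exact le_of_mul_le_mul_left h2 hX0
    have hNk : (k : ℝ) * h ≤ N := by exact_mod_cast hkh
    have h5 : (1 / 2 + 7 / 8 * η) * (k * ((h + 1) * (1 - η / 8))) ≤
        (h + 1) * ((#{j | R.Adj i j} : ℝ) + 2 * ε * k) := by
      have h8 := mul_le_mul_of_nonneg_left
        ((mul_le_mul_of_nonneg_left hhη hk0.le).trans hNk) (show 0 ≤ 1 / 2 + 7 / 8 * η by linarith)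
      linarith
    have h6 : (1 / 2 + 7 / 8 * η) * (k * (1 - η / 8)) ≤ (#{j | R.Adj i j} : ℝ) + 2 * ε * k := by
      refine le_of_mul_le_mul_left (a := (h : ℝ) + 1) ?_ (by positivity)
      linarith
    have h7 : (1 / 2 + η / 2) + 2 * ε ≤ (1 / 2 + 7 / 8 * η) * (1 - η / 8) := by nlinarith
    have h8 := mul_le_mul_of_nonneg_right h7 hk0.le
    have h9 : (1 / 2 + η / 2) * k ≤ (#{j | R.Adj i j} : ℝ) := by linarith
    convert h9

end RegularPartition

section Frame

lemma DensePair.map_comap {V β : Type*} {G : SimpleGraph β} (f : V ↪ β) {ε d : ℝ} {X Y : Finset V}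
    (h : DensePair (G.comap f) ε d X Y) : DensePair G ε d (X.map f) (Y.map f) := by
  classical
  intro A hA B hB hAc hBc
  obtain ⟨A, hA', rfl⟩ := subset_map_iff.1 hA
  obtain ⟨B, hB', rfl⟩ := subset_map_iff.1 hB
  simp only [card_map] at hAc hBc ⊢
  refine (h A hA' B hB' hAc hBc).trans (le_of_eq ?_)
  rw [sum_map]
  refine sum_congr rfl fun a _ => ?_
  rw [filter_map, card_map]
  congr 2

open scoped Classical in
lemma DensePair.card_atypical_lt {β : Type*} {G : SimpleGraph β} {ε d : ℝ} (hε : 0 ≤ ε) (hd : 0 < d)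
    {X Y A B : Finset β} (h : DensePair G ε (2 * d) X Y) (hA : A ⊆ X) (hB : B ⊆ Y)
    (hBc : ε * #Y ≤ #B) (hB0 : 0 < #B) :
    (#{a ∈ A | (#{b ∈ B | G.Adj a b} : ℝ) < d * #B} : ℝ) ≤ ε * #X := by
  set A' : Finset β := {a ∈ A | (#{b ∈ B | G.Adj a b} : ℝ) < d * #B} with hA'
  by_contra! hlt
  have h1 := h A' ((filter_subset _ _).trans hA) B hB hlt.le hBc
  have h2 : ∑ a ∈ A', (#{b ∈ B | G.Adj a b} : ℝ) ≤ #A' • (d * #B) :=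
    sum_le_card_nsmul _ _ _ fun a ha => (mem_filter.1 ha).2.le
  rw [nsmul_eq_mul] at h2
  have hA1 : (0 : ℝ) < #A' := lt_of_le_of_lt (by positivity) hlt
  have hB1 : (0 : ℝ) < #B := by exact_mod_cast hB0
  have : 0 < d * (#A' * #B) := by positivity
  linarith

open scoped Classical in
lemma exists_regular_partition_compl {ε η : ℝ} (hε : 0 < ε) (hεη : ε ≤ η / 16) (hη : η ≤ 1) :
    ∃ K N₀ : ℕ, ∀ {β : Type} [Fintype β] (G : SimpleGraph β) (I : Finset β),
      N₀ ≤ #Iᶜ → (∀ v, (1 / 2 + η) * #Iᶜ ≤ #{w ∈ Iᶜ | G.Adj v w}) →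
      ∃ (κ : Type) (_ : Fintype κ) (X : κ → Finset β) (h : ℕ) (R : SimpleGraph κ)
        (bad : Finset κ), Fintype.card κ ≤ K ∧ 1 ≤ ε * Fintype.card κ ∧ univ.biUnion X = Iᶜ ∧
        (∀ i j, i ≠ j → Disjoint (X i) (X j)) ∧ (∀ i, h ≤ #(X i) ∧ #(X i) ≤ h + 1) ∧
        (∀ i j, R.Adj i j → DensePair G ε (η / 16) (X i) (X j)) ∧
        #bad ≤ ε * Fintype.card κ ∧
        ∀ i ∉ bad, (1 / 2 + η / 2) * Fintype.card κ ≤ #{j | R.Adj i j} := by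
  obtain ⟨K, N₀, H⟩ := exists_regular_partition hε hεη hη
  refine ⟨K, N₀, fun {β} _ G I hN hdeg => ?_⟩
  have hcard : Fintype.card {v // v ∈ Iᶜ} = #Iᶜ := Fintype.card_coe _
  let f : {v // v ∈ Iᶜ} ↪ β := Function.Embedding.subtype _
  obtain ⟨κ, _, X, h, R, bad, h1, h2, h3, h4, h5, h6, h7, h8⟩ := H (G.comap f) (by rwa [hcard]) (by
    intro v
    rw [hcard]
    refine (hdeg v).trans (Nat.cast_le.2 ?_)
    rw [← card_map f]
    refine card_le_card fun w hw => ?_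
    rw [mem_filter] at hw
    rw [mem_map]
    exact ⟨⟨w, hw.1⟩, by simpa [f] using hw.2, rfl⟩)
  refine ⟨κ, inferInstance, fun i => (X i).map f, h, R, bad, h1, h2, ?_, ?_, ?_, ?_, h7, h8⟩
  · ext v
    simp only [mem_biUnion, mem_univ, true_and, mem_map]
    constructor
    · rintro ⟨i, w, -, rfl⟩
      exact w.2
    · intro hv
      obtain ⟨i, hi⟩ := h3 ⟨v, hv⟩
      exact ⟨i, _, hi, rfl⟩
  · intro i j hij
    exact disjoint_map f |>.2 (h4 i j hij)
  · simpa using h5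
  · exact fun i j hij => (h6 i j hij).map_comap f

open scoped Classical in
/-- A structure left in the complement of `I₀` by the regularity lemma: pairs of clusters that
are dense and regular, and a reservoir `W` through which every vertex reaches every cluster. -/
structure Frame {β : Type} [Fintype β] (G : SimpleGraph β) (I₀ : Finset β) (κ : Type)
    (d L c : ℝ) where
  U : κ → Finset β
  mate : κ → κ
  W : Finset β
  disjoint_U : ∀ i j, i ≠ j → Disjoint (U i) (U j)
  disjoint_W : ∀ i, Disjoint (U i) W
  disjoint_I : ∀ i, Disjoint (U i) I₀
  W_disjoint_I : Disjoint W I₀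
  mate_mate : ∀ i, mate (mate i) = i
  mate_ne : ∀ i, mate i ≠ i
  card_le : ∀ i, #(U i) ≤ #(U (mate i)) + 1
  card_atypical : ∀ i, ∀ A ⊆ U i, ∀ B ⊆ U (mate i), L ≤ #A → L ≤ #B →
    (#{a ∈ A | (#{b ∈ B | G.Adj a b} : ℝ) < d * #B} : ℝ) ≤ d / 2 * L
  card_reservoir : ∀ u i, ∀ A ⊆ U i, L ≤ #A →
    c * Fintype.card β ≤ #{x ∈ W | G.Adj u x ∧ d * #A ≤ #{a ∈ A | G.Adj x a}}

set_option maxHeartbeats 2000000 in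
open scoped Classical in
lemma exists_frame {δ γ : ℝ} (hδ : 0 < δ) (hδ1 : δ ≤ 1) (hγ : 0 < γ) (hγ1 : γ ≤ 1) :
    ∃ d l c : ℝ, 0 < d ∧ 0 < l ∧ 0 < c ∧ ∃ N₀ : ℕ, ∀ {β : Type} [Fintype β] (G : SimpleGraph β)
      (I₀ : Finset β), N₀ ≤ Fintype.card β →
      (∀ v, (1 / 2 + δ) * Fintype.card β ≤ #{w | G.Adj v w}) →
      #I₀ ≤ δ / 2 * Fintype.card β →
      ∃ (κ : Type) (_ : Fintype κ) (L : ℝ) (F : Frame G I₀ κ d L c), l * Fintype.card β ≤ L ∧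
        Fintype.card κ * L ≤ γ * Fintype.card β ∧
        Fintype.card β - #I₀ - γ * Fintype.card β ≤ ∑ i, (#(F.U i) : ℝ) := by
  set θ : ℝ := min γ δ / 8 with hθ
  have hθ0 : 0 < θ := by positivity
  have hθγ : θ ≤ γ / 8 := by rw [hθ]; gcongr; exact min_le_left _ _
  have hθδ : θ ≤ δ / 8 := by rw [hθ]; gcongr; exact min_le_right _ _
  set ε : ℝ := δ * θ / 512 with hε
  have hε0 : 0 < ε := by positivity
  have hεδ : ε ≤ (δ / 2) / 16 := by rw [hε]; nlinarith
  have hεθ : ε ≤ θ / 512 := by rw [hε]; nlinarith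
  have hεγ : ε ≤ δ * γ / 512 := by rw [hε]; nlinarith
  obtain ⟨K', N₁, H⟩ := exists_regular_partition_compl hε0 hεδ (by linarith)
  set K : ℝ := K' + 1 with hK
  have hK0 : 0 < K := by positivity
  set a : ℝ := δ * θ / (256 * K) with ha
  have ha0 : 0 < a := by positivity
  set H₀ : ℝ := 4 / θ + 2 / δ + 1 with hH₀
  refine ⟨δ / 64, γ / (8 * K), δ * θ / (512 * K), by positivity, by positivity, by positivity,
    2 * N₁ + ⌈4 * K * H₀⌉₊ + ⌈2 / a ^ 2⌉₊, fun {β} _ G I₀ hn hdeg hI => ?_⟩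
  set n : ℝ := (Fintype.card β : ℝ) with hndef
  have hn1 : 2 * (N₁ : ℝ) + 4 * K * H₀ + 2 / a ^ 2 ≤ n := by
    have h1 : ((2 * N₁ + ⌈4 * K * H₀⌉₊ + ⌈2 / a ^ 2⌉₊ : ℕ) : ℝ) ≤ n := Nat.cast_le.2 hn
    push_cast at h1
    linarith [Nat.le_ceil (4 * K * H₀), Nat.le_ceil (2 / a ^ 2)]
  have hH₀0 : 0 < H₀ := by positivity
  have hn0 : 0 < n := lt_of_lt_of_le (by positivity) hn1
  have hNI : (#I₀ᶜ : ℝ) = n - #I₀ := by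
    rw [card_compl, Nat.cast_sub (card_le_univ _)]
  set N : ℝ := (#I₀ᶜ : ℝ) with hN
  have hNn : n ≤ 2 * N := by nlinarith
  have hNn' : N ≤ n := by rw [hNI]; linarith [Nat.cast_nonneg (α := ℝ) #I₀]
  have ha2 : 0 < 2 / a ^ 2 := by positivity
  have hnbr : ∀ v, (1 / 2 + δ / 2) * n ≤ (#{w ∈ I₀ᶜ | G.Adj v w} : ℝ) := by
    intro v
    have h1 : #{w | G.Adj v w} ≤ #{w ∈ I₀ᶜ | G.Adj v w} + #I₀ := by
      refine (card_le_card ?_).trans (card_union_le _ _)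
      intro w
      simp only [mem_filter, mem_univ, true_and, mem_union, mem_compl]
      tauto
    have h2 : (#{w | G.Adj v w} : ℝ) ≤ #{w ∈ I₀ᶜ | G.Adj v w} + #I₀ := by exact_mod_cast h1
    linarith [hdeg v]
  obtain ⟨κ₀, _, X, h, R, bad, hk, hεk, hXU, hXd, hXc, hR, hbad, hRdeg⟩ := H G I₀ (by
    have : (0:ℝ) < 4 * K * H₀ := by positivity
    have : (N₁ : ℝ) ≤ #I₀ᶜ := by linarith
    exact_mod_cast this) (fun v => le_trans (by gcongr) (hnbr v))
  set k : ℝ := (Fintype.card κ₀ : ℝ) with hkdef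
  have hkK : k ≤ K := by
    have : k ≤ K' := Nat.cast_le.2 hk
    linarith
  have hk0 : 0 < k := by
    by_contra! h0
    nlinarith
  have hsum : ∑ i, (#(X i) : ℝ) = N := by
    rw [hN, ← hXU, card_biUnion fun i _ j _ hij => hXd i j hij]
    push_cast
    rfl
  have hXl : ∀ i, (h : ℝ) ≤ #(X i) := fun i => by exact_mod_cast (hXc i).1
  have hXu : ∀ i, (#(X i) : ℝ) ≤ h + 1 := fun i => by exact_mod_cast (hXc i).2
  have hkh : k * h ≤ N := by
    rw [← hsum, ← nsmul_eq_mul]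
    exact card_nsmul_le_sum univ (fun i => (#(X i) : ℝ)) _ fun i _ => hXl i
  have hkh' : N ≤ k * (h + 1) := by
    rw [← hsum, ← nsmul_eq_mul]
    exact sum_le_card_nsmul univ (fun i => (#(X i) : ℝ)) _ fun i _ => hXu i
  have hH₀1 : 4 / θ + 2 / δ + 1 ≤ H₀ := le_rfl
  have h4θ : 0 < 4 / θ := by positivity
  have h2δ : 0 < 2 / δ := by positivity
  have hh1 : 1 ≤ (h : ℝ) := by
    have h1 : 4 * K * H₀ ≤ 2 * K * (h + 1) := by
      have := mul_le_mul_of_nonneg_right hkK (show (0 : ℝ) ≤ h + 1 by positivity)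
      linarith [Nat.cast_nonneg (α := ℝ) N₁]
    have h2 : 2 * H₀ ≤ h + 1 := by
      refine le_of_mul_le_mul_left (a := 2 * K) ?_ (by positivity)
      linarith
    linarith
  have hhn : n ≤ 4 * K * h := by
    have := mul_le_mul_of_nonneg_right hkK (show (0 : ℝ) ≤ h + 1 by positivity)
    nlinarith
  have hhH : H₀ ≤ h := by
    refine le_of_mul_le_mul_left (a := 4 * K) ?_ (by positivity)
    linarith [Nat.cast_nonneg (α := ℝ) N₁]
  have hθh : 4 ≤ θ * h := by
    have : 4 / θ ≤ h := by linarith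
    rw [div_le_iff₀ hθ0] at this
    linarith
  have hδh : 2 ≤ δ * h := by
    have : 2 / δ ≤ h := by linarith
    rw [div_le_iff₀ hδ] at this
    linarith
  set w := ⌊θ * h⌋₊ with hw
  have hwu : (w : ℝ) ≤ θ * h := Nat.floor_le (by positivity)
  have hwl : θ * h / 2 ≤ w := by
    have := Nat.lt_floor_add_one (θ * h)
    linarith
  have hδwl := mul_le_mul_of_nonneg_left hwl hδ.le
  have hδn : δ * θ / (512 * K) * n ≤ δ * w / 64 := by
    have h1 : δ * θ / (512 * K) * n ≤ δ * θ / (512 * K) * (4 * K * h) := by gcongr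
    have h2 : δ * θ / (512 * K) * (4 * K * h) = δ * (θ * h / 2) / 64 := by field_simp; norm_num
    linarith
  have hsample : ∀ i, ∃ Y ⊆ X i, #Y = w ∧
      ∀ u ∈ ({u | δ / 4 * #(X i) ≤ #(({x | G.Adj u x} : Finset β) ∩ X i)} : Finset β),
        δ / 4 / 8 * w ≤ #(Y ∩ ({x | G.Adj u x} : Finset β)) := by
    intro i
    refine exists_sample _ (fun u => ({x | G.Adj u x} : Finset β)) (X i)
      (fun u hu => (mem_filter.1 hu).2) (by linarith) w ?_ ?_
    · have := hXl i
      nlinarith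
    · have h1 : a * n ≤ δ / 4 / 8 * w := by
        have : a * n = 2 * (δ * θ / (512 * K) * n) := by rw [ha]; field_simp; norm_num
        linarith
      refine le_trans ?_ (Real.exp_le_exp.2 h1)
      refine le_trans ?_ (Real.quadratic_le_exp_of_nonneg (by positivity))
      have h2 : (#{u | δ / 4 * #(X i) ≤ (#(({x | G.Adj u x} : Finset β) ∩ X i) : ℝ)} : ℝ) ≤ n := by
        exact Nat.cast_le.2 (card_le_univ _)
      refine h2.trans ?_
      have h3 : 2 / a ^ 2 ≤ n := by linarith [Nat.cast_nonneg (α := ℝ) N₁, mul_pos (mul_pos four_pos hK0) hH₀0]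
      rw [div_le_iff₀ (by positivity)] at h3
      have : 0 < a * n := by positivity
      nlinarith
  choose Y hYX hYc hY using hsample
  have hεh : ε * (h + 1) ≤ δ * θ * h / 256 := by
    have : ε * (h + 1) ≤ ε * (2 * h) := by gcongr; linarith
    rw [hε] at this ⊢
    linarith
  obtain ⟨f, hff, hfR, hf1⟩ :=
    (R.comap (Subtype.val : {i // i ∉ bad} → κ₀)).exists_involution_of_card_le_two_mul_degree (by
      intro i
      have h1 := hRdeg i.1 i.2
      have h2 : #{j | R.Adj i.1 j} ≤ #bad +
          #{j | (R.comap (Subtype.val : {i // i ∉ bad} → κ₀)).Adj i j} := by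
        rw [← card_map (Function.Embedding.subtype _)
          (s := ({j | (R.comap (Subtype.val : {i // i ∉ bad} → κ₀)).Adj i j} : Finset _))]
        refine (card_le_card ?_).trans (card_union_le _ _)
        intro j hj
        rw [mem_union, or_iff_not_imp_left]
        intro hjb
        rw [mem_map]
        exact ⟨⟨j, hjb⟩, by simpa using hj, rfl⟩
      have h3 : (#{j | R.Adj i.1 j} : ℝ) ≤ #bad +
          #{j | (R.comap (Subtype.val : {i // i ∉ bad} → κ₀)).Adj i j} := by exact_mod_cast h2
      have h4 : Fintype.card {i // i ∉ bad} ≤ Fintype.card κ₀ := Fintype.card_subtype_le _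
      have h5 : (Fintype.card {i // i ∉ bad} : ℝ) ≤ k := Nat.cast_le.2 h4
      have h6 : ε * k ≤ δ / 4 * k := by gcongr; linarith
      have h7 : (Fintype.card {i // i ∉ bad} : ℝ) ≤
          2 * #{j | (R.comap (Subtype.val : {i // i ∉ bad} → κ₀)).Adj i j} := by linarith
      exact_mod_cast h7)
  have hL0 : 0 < γ * h / 2 := by positivity
  have hεL : ε * (h + 1) ≤ γ * h / 2 := by
    have : δ * θ * h ≤ 1 * γ * h := by gcongr; linarith
    linarith
  have hεdL : ε * (h + 1) ≤ δ / 64 / 2 * (γ * h / 2) := by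
    have : δ * θ * h ≤ δ * (γ / 8) * h := by gcongr
    have : 0 < δ * γ * h := by positivity
    linarith
  have hεX : ∀ i, ε * #(X i) ≤ ε * (h + 1) := fun i => by gcongr; exact hXu i
  have hdens : ∀ i j, R.Adj i j → DensePair G ε (2 * (δ / 64)) (X i) (X j) := by
    intro i j hij
    convert hR i j hij using 1
    ring
  let e : {i : {i // i ∉ bad} // f i ≠ i} → κ₀ := fun i => i.1.1
  have he : Function.Injective e := fun i j hij => Subtype.ext (Subtype.ext hij)
  let F : Frame G I₀ {i : {i // i ∉ bad} // f i ≠ i} (δ / 64) (γ * h / 2) (δ * θ / (512 * K)) :=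
    { U := fun i => X (e i) \ Y (e i)
      mate := fun i => ⟨f i.1, by rw [hff]; exact i.2.symm⟩
      W := univ.biUnion Y
      disjoint_U := fun i j hij =>
        (hXd _ _ (he.ne hij)).mono sdiff_subset sdiff_subset
      disjoint_W := by
        intro i
        rw [disjoint_biUnion_right]
        intro j _
        by_cases hij : e i = j
        · rw [← hij]
          exact sdiff_disjoint
        · exact (hXd _ _ hij).mono sdiff_subset (hYX j)
      disjoint_I := by
        intro i
        refine disjoint_of_subset_left (sdiff_subset.trans ?_) disjoint_compl_left
        rw [← hXU]
        exact subset_biUnion_of_mem X (mem_univ _)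
      W_disjoint_I := by
        refine disjoint_of_subset_left ?_ disjoint_compl_left
        rw [← hXU]
        exact biUnion_mono fun i _ => hYX i
      mate_mate := fun i => Subtype.ext (hff i.1)
      mate_ne := fun i h => i.2 (congrArg Subtype.val h)
      card_le := by
        intro i
        rw [card_sdiff_of_subset (hYX _), card_sdiff_of_subset (hYX _), hYc, hYc]
        have h1 := (hXc (e i)).2
        have h2 := (hXc (e ⟨f i.1, by rw [hff]; exact i.2.symm⟩)).1
        omega
      card_atypical := by
        intro i A hA B hB hAL hBL
        have hadj : R.Adj (e i) (e ⟨f i.1, by rw [hff]; exact i.2.symm⟩) := hfR i.1 i.2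
        refine le_trans ?_ (((hεX (e i))).trans hεdL)
        refine (hdens _ _ hadj).card_atypical_lt hε0.le (by positivity) (hA.trans sdiff_subset)
          (hB.trans sdiff_subset) (((hεX _).trans hεL).trans hBL) ?_
        exact_mod_cast hL0.trans_le hBL
      card_reservoir := by
        intro u i A hA hAL
        have hex : ∃ j, R.Adj (e i) j ∧ δ / 4 * #(X j) ≤ #(({x | G.Adj u x} : Finset β) ∩ X j) := by
          by_contra! hcon
          have h1 : (#{w ∈ I₀ᶜ | G.Adj u w} : ℝ) =
              ∑ j, (#(({x | G.Adj u x} : Finset β) ∩ X j) : ℝ) := by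
            rw [← Nat.cast_sum, ← card_biUnion, ← inter_biUnion, hXU]
            · congr 2
              ext
              simp [and_comm]
            · intro i _ j _ hij
              exact (hXd i j hij).mono inter_subset_right inter_subset_right
          have h2 : ∑ j, (#(({x | G.Adj u x} : Finset β) ∩ X j) : ℝ) ≤
              ∑ j, (h + 1) * (1 - (1 - δ / 4) * if R.Adj (e i) j then 1 else 0) := by
            refine sum_le_sum fun j _ => ?_
            by_cases hj : R.Adj (e i) j
            · have h3 := hcon j hj
              have h4 : δ / 4 * #(X j) ≤ δ / 4 * (h + 1) := by gcongr; exact hXu j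
              rw [if_pos hj]
              linarith
            · rw [if_neg hj]
              have h3 : (#(({x | G.Adj u x} : Finset β) ∩ X j) : ℝ) ≤ #(X j) := by
                exact_mod_cast card_le_card inter_subset_right
              linarith [hXu j]
          rw [← mul_sum, sum_sub_distrib, ← mul_sum, sum_boole, sum_const, card_univ, nsmul_eq_mul,
            mul_one] at h2
          have h3 := hRdeg (e i) i.1.2
          have h4 : k / 2 ≤ (1 - δ / 4) * #{j | R.Adj (e i) j} := by
            have h5 : (1 - δ / 4) * ((1 / 2 + δ / 2 / 2) * k) ≤
                (1 - δ / 4) * #{j | R.Adj (e i) j} :=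
              mul_le_mul_of_nonneg_left h3 (by linarith)
            nlinarith
          have h5 := hnbr u
          have h6 : (h + 1) * (k - (1 - δ / 4) * #{j | R.Adj (e i) j}) ≤ ((h : ℝ) + 1) * (k / 2) :=
            mul_le_mul_of_nonneg_left (by linarith) (by positivity)
          have h7 : (1 / 2 + δ / 2) * (k * h) ≤ (1 / 2 + δ / 2) * n := by gcongr; linarith
          have h8 : 2 * k ≤ δ * h * k := by gcongr
          nlinarith
        obtain ⟨j, hj, hju⟩ := hex
        have h1 := hY j u (by simpa using hju)
        have h2 := (hdens _ _ hj.symm).card_atypical_lt hε0.le (by positivity) Subset.rfl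
          (hA.trans sdiff_subset) (((hεX _).trans hεL).trans hAL)
          (by exact_mod_cast hL0.trans_le hAL)
        have h3 : #(Y j ∩ ({x | G.Adj u x} : Finset β)) ≤
            #{x ∈ univ.biUnion Y | G.Adj u x ∧ δ / 64 * #A ≤ #{a ∈ A | G.Adj x a}} +
            #{x ∈ X j | (#{a ∈ A | G.Adj x a} : ℝ) < δ / 64 * #A} := by
          refine (card_le_card ?_).trans (card_union_le _ _)
          intro x hx
          simp only [mem_inter, mem_filter, mem_univ, true_and] at hx
          simp only [mem_union, mem_filter, mem_biUnion, mem_univ, true_and]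
          by_cases hlt : (#{a ∈ A | G.Adj x a} : ℝ) < δ / 64 * #A
          · exact .inr ⟨hYX j hx.1, hlt⟩
          · exact .inl ⟨⟨j, hx.1⟩, hx.2, not_lt.1 hlt⟩
        have h4 : (#(Y j ∩ ({x | G.Adj u x} : Finset β)) : ℝ) ≤
            #{x ∈ univ.biUnion Y | G.Adj u x ∧ δ / 64 * #A ≤ #{a ∈ A | G.Adj x a}} +
            #{x ∈ X j | (#{a ∈ A | G.Adj x a} : ℝ) < δ / 64 * #A} := by exact_mod_cast h3
        have h5 := hεX j
        linarith }
  refine ⟨{i : {i // i ∉ bad} // f i ≠ i}, inferInstance, γ * h / 2, F, ?_, ?_, ?_⟩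
  · have h1 : γ / (8 * K) * n ≤ γ / (8 * K) * (4 * K * h) := by gcongr
    have h2 : γ / (8 * K) * (4 * K * h) = γ * h / 2 := by field_simp; norm_num
    linarith
  · have h1 : Fintype.card {i : {i // i ∉ bad} // f i ≠ i} ≤ Fintype.card κ₀ :=
      Fintype.card_le_of_injective e he
    have h2 : (Fintype.card {i : {i // i ∉ bad} // f i ≠ i} : ℝ) ≤ k := Nat.cast_le.2 h1
    have h3 : (Fintype.card {i : {i // i ∉ bad} // f i ≠ i} : ℝ) * (γ * h / 2) ≤ k * (γ * h / 2) := by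
      gcongr
    have h4 : γ * (k * h) ≤ γ * n := by gcongr; linarith
    nlinarith
  · set M : Finset κ₀ := univ.map ⟨e, he⟩ with hM
    have h1 : ∑ i, (#(F.U i) : ℝ) = ∑ j ∈ M, ((#(X j) : ℝ) - w) := by
      rw [hM, sum_map]
      refine sum_congr rfl fun i _ => ?_
      have : #(F.U i) = #(X (e i)) - w := by
        rw [show F.U i = X (e i) \ Y (e i) from rfl, card_sdiff_of_subset (hYX _), hYc]
      rw [this, Nat.cast_sub (by rw [← hYc (e i)]; exact card_le_card (hYX _))]
      rfl
    have h2 : #Mᶜ ≤ #bad + 1 := by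
      have h3 : Mᶜ ⊆ bad ∪ ({i | f i = i} : Finset {i // i ∉ bad}).map
          (Function.Embedding.subtype _) := by
        intro j hj
        rw [mem_union, or_iff_not_imp_left]
        intro hjb
        rw [mem_map]
        refine ⟨⟨j, hjb⟩, ?_, rfl⟩
        rw [mem_filter]
        refine ⟨mem_univ _, ?_⟩
        by_contra hne
        rw [mem_compl] at hj
        exact hj (mem_map.2 ⟨⟨⟨j, hjb⟩, hne⟩, mem_univ _, rfl⟩)
      refine (card_le_card h3).trans ((card_union_le _ _).trans ?_)
      rw [card_map]
      refine Nat.add_le_add_left (card_le_one.2 fun x hx y hy => ?_) _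
      exact hf1 x y (by simpa using hx) (by simpa using hy)
    have h3 : (#Mᶜ : ℝ) ≤ #bad + 1 := by exact_mod_cast h2
    have h4 : ∑ j ∈ M, (#(X j) : ℝ) + ∑ j ∈ Mᶜ, (#(X j) : ℝ) = N := by
      rw [sum_add_sum_compl, hsum]
    have h5 : ∑ j ∈ Mᶜ, (#(X j) : ℝ) ≤ #Mᶜ * (h + 1) := by
      rw [← nsmul_eq_mul]
      exact sum_le_card_nsmul _ _ _ fun j _ => hXu j
    have h6 : (#Mᶜ : ℝ) * (h + 1) ≤ (2 * (ε * k)) * (2 * h) := by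
      gcongr
      · linarith
      · linarith
    have h7 : (#M : ℝ) ≤ k := Nat.cast_le.2 (card_le_univ M)
    have h8 : (#M : ℝ) * w ≤ k * (θ * h) := by gcongr
    have h9 : (4 * ε + θ) * (k * h) ≤ γ * n := by
      have : 4 * ε + θ ≤ γ := by linarith
      have h10 : k * h ≤ n := by linarith
      gcongr
    rw [h1, sum_sub_distrib, sum_const, nsmul_eq_mul]
    linarith

end Frame

section PartialEmb

variable {α β : Type*} [DecidableEq α]

/-- `φ` restricted to `D` is an embedding of the induced graph. -/
def PartialEmb (T : SimpleGraph α) (G : SimpleGraph β) (D : Finset α) (φ : α → β) : Prop :=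
  Set.InjOn φ D ∧ ∀ u ∈ D, ∀ v ∈ D, T.Adj u v → G.Adj (φ u) (φ v)

lemma PartialEmb.insert [DecidableEq β] {T : SimpleGraph α} {G : SimpleGraph β} {D : Finset α}
    {φ : α → β}
    (h : PartialEmb T G D φ) (O : TreeOrder T) {x : α} {c : β} (hD : ∀ y ∈ D, O.par y ∈ D)
    (hx : x ∉ D) (hpar : x ≠ O.root → O.par x ∈ D) (hc : c ∉ D.image φ)
    (hadj : x ≠ O.root → G.Adj (φ (O.par x)) c) :
    PartialEmb T G (insert x D) (Function.update φ x c) := by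
  have hne : ∀ y ∈ D, y ≠ x := fun y hy h => hx (h ▸ hy)
  have hup : ∀ y ∈ D, Function.update φ x c y = φ y := fun y hy =>
    Function.update_of_ne (hne y hy) _ _
  have key : ∀ y ∈ D, T.Adj x y → G.Adj c (φ y) := by
    intro y hy hxy
    rcases O.adj_cases x y hxy with ⟨h1, h2⟩ | ⟨h1, h2⟩
    · exact h2 ▸ (hadj h1).symm
    · exact absurd (h2 ▸ hD y hy) hx
  constructor
  · rw [coe_insert, Set.injOn_insert (by simpa using hx)]
    constructor
    · exact h.1.congr fun y hy => (hup y hy).symm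
    · rintro ⟨y, hy, hyx⟩
      rw [Function.update_self, hup y hy] at hyx
      exact hc (mem_image.2 ⟨y, hy, hyx⟩)
  · intro u hu v hv huv
    rw [mem_insert] at hu hv
    rcases hu with rfl | hu <;> rcases hv with rfl | hv
    · exact absurd huv (T.irrefl)
    · rw [Function.update_self, hup v hv]
      exact key v hv huv
    · rw [Function.update_self, hup u hu]
      exact (key u hu huv.symm).symm
    · rw [hup u hu, hup v hv]
      exact h.2 u hu v hv huv

lemma PartialEmb.mono {T : SimpleGraph α} {G : SimpleGraph β} {D D' : Finset α} {φ : α → β}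
    (h : PartialEmb T G D φ) (hD : D' ⊆ D) : PartialEmb T G D' φ :=
  ⟨h.1.mono hD, fun u hu v hv => h.2 u (hD hu) v (hD hv)⟩

lemma PartialEmb.congr {T : SimpleGraph α} {G : SimpleGraph β} {D : Finset α} {φ ψ : α → β}
    (h : PartialEmb T G D φ) (hφ : ∀ x ∈ D, ψ x = φ x) : PartialEmb T G D ψ :=
  ⟨h.1.congr fun x hx => (hφ x hx).symm, fun u hu v hv huv => by
    rw [hφ u hu, hφ v hv]; exact h.2 u hu v hv huv⟩

end PartialEmb

section Potential

variable {α β : Type*} [DecidableEq α]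

open scoped Classical in
/-- The conditional expectation of `2 ^ (-#good)`, up to a supermartingale estimate, where `t ∈ S`
is good if each `x ∈ cl t` is mapped to a neighbour of `z t x`, and `D` has been placed. -/
noncomputable def potential (G : SimpleGraph β) (δ : ℝ) (S : Finset α) (cl : α → Finset α)
    (z : α → α → β) (D : Finset α) (ψ : α → β) : ℝ :=
  ∏ t ∈ S, (1 - 1 / 2 * ∏ x ∈ cl t, if x ∈ D then (if G.Adj (z t x) (ψ x) then 1 else 0) else δ)

lemma potential_factor_nonneg {δ : ℝ} (hδ : 0 ≤ δ) (hδ1 : δ ≤ 1)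
    (cl : Finset α) (D : Finset α) (P : α → Prop) [DecidablePred P] :
    0 ≤ 1 - 1 / 2 * ∏ x ∈ cl, if x ∈ D then (if P x then 1 else 0) else δ := by
  have : ∏ x ∈ cl, (if x ∈ D then (if P x then 1 else 0) else δ) ≤ 1 := by
    refine prod_le_one (fun x _ => ?_) fun x _ => ?_
    · split_ifs <;> simp [hδ]
    · split_ifs <;> simp [hδ1]
  linarith

open scoped Classical in
lemma sum_potential_le {G : SimpleGraph β} {δ : ℝ} (hδ : 0 ≤ δ) (hδ1 : δ ≤ 1) {S : Finset α}
    {cl : α → Finset α} (hcl : ∀ t ∈ S, ∀ t' ∈ S, t ≠ t' → Disjoint (cl t) (cl t'))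
    {z : α → α → β} {D : Finset α} {ψ : α → β} {x : α} (hx : x ∉ D) {C : Finset β}
    (hC : ∀ v, δ * #C ≤ #{c ∈ C | G.Adj v c}) :
    ∑ c ∈ C, potential G δ S cl z (insert x D) (Function.update ψ x c) ≤
      #C * potential G δ S cl z D ψ := by
  have hsame : ∀ t, x ∉ cl t → ∀ c,
      (1 - 1 / 2 * ∏ y ∈ cl t, if y ∈ insert x D then
        (if G.Adj (z t y) (Function.update ψ x c y) then 1 else 0) else δ) =
      1 - 1 / 2 * ∏ y ∈ cl t, if y ∈ D then (if G.Adj (z t y) (ψ y) then 1 else 0) else δ := by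
    intro t ht c
    congr 2
    refine prod_congr rfl fun y hy => ?_
    have hyx : y ≠ x := fun h => ht (h ▸ hy)
    simp only [Function.update_of_ne hyx, mem_insert, hyx, false_or]
  by_cases hex : ∃ t ∈ S, x ∈ cl t
  · obtain ⟨t, ht, hxt⟩ := hex
    have hother : ∀ t' ∈ S.erase t, x ∉ cl t' := fun t' ht' hxt' =>
      disjoint_left.1 (hcl t ht t' (mem_of_mem_erase ht') (ne_of_mem_erase ht').symm) hxt hxt'
    set Q := ∏ t' ∈ S.erase t, (1 - 1 / 2 * ∏ y ∈ cl t', if y ∈ D then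
      (if G.Adj (z t' y) (ψ y) then 1 else 0) else δ) with hQ
    have hQ0 : 0 ≤ Q := prod_nonneg fun t' _ =>
      potential_factor_nonneg hδ hδ1 (cl t') D (fun y => G.Adj (z t' y) (ψ y))
    set P := ∏ y ∈ (cl t).erase x, if y ∈ D then (if G.Adj (z t y) (ψ y) then 1 else 0) else δ
      with hP
    have hP0 : 0 ≤ P := prod_nonneg fun y _ => by split_ifs <;> simp [hδ]
    have h1 : potential G δ S cl z D ψ = (1 - 1 / 2 * (δ * P)) * Q := by
      rw [potential, ← mul_prod_erase S _ ht, ← mul_prod_erase (cl t) _ hxt, if_neg hx]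
    have h2 : ∀ c, potential G δ S cl z (insert x D) (Function.update ψ x c) =
        Q - 1 / 2 * P * Q * if G.Adj (z t x) c then 1 else 0 := by
      intro c
      rw [potential, ← mul_prod_erase S _ ht, prod_congr rfl fun t' ht' => hsame t' (hother t' ht') c,
        ← hQ, ← mul_prod_erase (cl t) _ hxt, if_pos (mem_insert_self _ _), Function.update_self]
      have : ∏ y ∈ (cl t).erase x, (if y ∈ insert x D then
          (if G.Adj (z t y) (Function.update ψ x c y) then 1 else 0) else δ) = P := by
        refine prod_congr rfl fun y hy => ?_
        have hyx := ne_of_mem_erase hy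
        simp only [Function.update_of_ne hyx, mem_insert, hyx, false_or]
      rw [this]
      ring
    rw [sum_congr rfl fun c _ => h2 c, sum_sub_distrib, ← mul_sum, sum_boole, sum_const,
      nsmul_eq_mul, h1]
    have h3 := mul_le_mul_of_nonneg_left (hC (z t x)) (mul_nonneg hP0 hQ0)
    linarith
  · push Not at hex
    have : ∀ c, potential G δ S cl z (insert x D) (Function.update ψ x c) =
        potential G δ S cl z D ψ := fun c => prod_congr rfl fun t ht => hsame t (hex t ht) c
    simp [this]

end Potential

section RandomStart

variable {α β : Type*} [Fintype α] [Fintype β] [DecidableEq α] [DecidableEq β]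

lemma TreeOrder.par_mem_filter {T : SimpleGraph α} (O : TreeOrder T) {E : Finset α}
    (hE : ∀ y ∈ E, O.par y ∈ E) (k : ℕ) :
    ∀ y ∈ ({y ∈ E | O.rk y < k} : Finset α), O.par y ∈ ({y ∈ E | O.rk y < k} : Finset α) := by
  intro y hy
  rw [mem_filter] at hy ⊢
  refine ⟨hE y hy.1, ?_⟩
  by_cases h : y = O.root
  · rw [h, O.par_root, ← h]; exact hy.2
  · exact (O.rk_par y h).trans hy.2

open scoped Classical in
lemma card_filter_adj_filter_adj {G : SimpleGraph β} {δ : ℝ}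
    (hdeg : ∀ v, (1 / 2 + δ) * Fintype.card β ≤ #{w | G.Adj v w}) (u v : β) :
    2 * δ * Fintype.card β ≤ #{w | G.Adj u w ∧ G.Adj v w} := by
  have h1 := card_union_add_card_inter ({w | G.Adj u w} : Finset β) ({w | G.Adj v w} : Finset β)
  have h2 : #(({w | G.Adj u w} : Finset β) ∪ ({w | G.Adj v w} : Finset β)) ≤ Fintype.card β :=
    card_le_univ _
  rw [← filter_and] at h1
  have h3 : (#{w | G.Adj u w} : ℝ) + #{w | G.Adj v w} ≤
      Fintype.card β + #{w | G.Adj u w ∧ G.Adj v w} := by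
    exact_mod_cast h1 ▸ Nat.add_le_add_right h2 _
  linarith [hdeg u, hdeg v]

lemma card_filter_sdiff_ge (A B : Finset β) (p : β → Prop) [DecidablePred p] :
    (#{x ∈ A | p x} : ℝ) - #B ≤ #{x ∈ A \ B | p x} := by
  have h : ({x ∈ A | p x} : Finset β) ⊆ {x ∈ A \ B | p x} ∪ B := by
    intro x hx
    simp only [mem_union, mem_filter, mem_sdiff] at hx ⊢
    tauto
  have := (card_le_card h).trans (card_union_le _ _)
  rw [sub_le_iff_le_add]
  exact_mod_cast this

open scoped Classical in
lemma exists_random_start {T : SimpleGraph α} {G : SimpleGraph β} (O : TreeOrder T) {δ : ℝ}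
    (hδ : 0 < δ) (hδ1 : δ ≤ 1 / 4)
    (hdeg : ∀ v, (1 / 2 + δ) * Fintype.card β ≤ #{w | G.Adj v w}) {D₀ : Finset α}
    (hD₀ : ∀ x ∈ D₀, O.par x ∈ D₀) (hcard : #D₀ ≤ δ / 2 * Fintype.card β) {S : Finset α} {m : ℕ}
    {cl : α → Finset α} (hcl : ∀ t ∈ S, cl t ⊆ D₀)
    (hdisj : ∀ t ∈ S, ∀ t' ∈ S, t ≠ t' → Disjoint (cl t) (cl t'))
    (hm : ∀ t ∈ S, #(cl t) ≤ m) {a : ℝ} (ha : a ≤ δ ^ m * #S / 4) (hβ : 0 < Fintype.card β)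
    (hn : 2 * (Fintype.card β : ℝ) ^ 2 ≤ Real.exp a) (φ : α → β) :
    RandomExtension (4 / Fintype.card β) φ D₀ (fun ψ => PartialEmb T G D₀ ψ ∧
      ∀ v w, a ≤ #{t ∈ S | ∀ x ∈ cl t, G.Adj (if x = t then w else v) (ψ x)}) 0 0 := by
  set n : ℝ := (Fintype.card β : ℝ) with hn'
  have hn0 : 0 < n := Nat.cast_pos.2 hβ
  set W : Finset α → (α → β) → ℝ := fun D ψ => ∑ v, ∑ w,
    potential G δ S cl (fun t x => if x = t then w else v) D ψ with hW
  have hpot0 : ∀ z D ψ, 0 ≤ potential G δ S cl z D ψ := fun z D ψ =>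
    prod_nonneg fun t' _ =>
      potential_factor_nonneg hδ.le (by linarith) (cl t') D (fun y => G.Adj (z t' y) (ψ y))
  have hit : RandomExtension (2 / n) φ D₀ (PartialEmb T G D₀) (W D₀) (W ∅ φ) := by
    refine RandomExtension.iterate O.rk_injective (by positivity) (PartialEmb T G) W
      ⟨by simp, by simp⟩ ?_
    intro x hx ψ hψ hP
    set D : Finset α := {y ∈ D₀ | O.rk y < O.rk x} with hD
    have hxD : x ∉ D := by simp [hD]
    have hDc : #(D.image ψ) ≤ δ / 2 * n := by
      refine le_trans ?_ hcard
      exact_mod_cast card_image_le.trans (card_le_card (filter_subset _ _))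
    set N : Finset β := if x = O.root then univ else ({w | G.Adj (ψ (O.par x)) w} : Finset β) with hN
    have hN1 : (1 / 2 + δ) * n ≤ #N := by
      by_cases h : x = O.root
      · simp only [hN, h, if_true, card_univ]
        nlinarith
      · simp only [hN, h, if_false]
        exact hdeg _
    have hN2 : ∀ v, 2 * δ * n ≤ #{w ∈ N | G.Adj v w} := by
      intro v
      by_cases h : x = O.root
      · simp only [hN, h, if_true]
        nlinarith [hdeg v]
      · simp only [hN, h, if_false, filter_filter]
        exact card_filter_adj_filter_adj hdeg _ _
    refine ⟨N \ D.image ψ, ?_, ?_, ?_⟩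
    · have := card_filter_sdiff_ge N (D.image ψ) (fun _ => True)
      simp only [filter_true] at this
      rw [div_mul_eq_mul_div, le_div_iff₀ hn0]
      nlinarith
    · intro c hc
      rw [mem_sdiff] at hc
      refine hP.insert O (O.par_mem_filter hD₀ _) hxD ?_ hc.2 ?_
      · exact fun h => mem_filter.2 ⟨hD₀ x hx, O.rk_par x h⟩
      · intro h
        have := hc.1
        simpa [hN, h] using this
    · have key : ∀ v w, _ := fun v w => sum_potential_le hδ.le (by linarith) hdisj hxD
        (z := fun t x => if x = t then w else v) (ψ := ψ) (C := N \ D.image ψ) (G := G) (by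
          intro v
          have h1 := card_filter_sdiff_ge N (D.image ψ) (fun w => G.Adj v w)
          have h2 : (#(N \ D.image ψ) : ℝ) ≤ n := Nat.cast_le.2 (card_le_univ _)
          nlinarith [hN2 v])
      simp only [hW]
      rw [sum_comm, mul_sum]
      refine sum_le_sum fun v _ => ?_
      rw [sum_comm, mul_sum]
      exact sum_le_sum fun w _ => key v w
  have hWle : W ∅ φ ≤ n ^ 2 * Real.exp (-(2 * a)) := by
    have : ∀ v w, potential G δ S cl (fun t x => if x = t then w else v) ∅ φ ≤
        Real.exp (-(2 * a)) := by
      intro v w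
      simp only [potential, notMem_empty, if_false, prod_const]
      calc ∏ t ∈ S, (1 - 1 / 2 * δ ^ #(cl t)) ≤ ∏ t ∈ S, Real.exp (-(1 / 2 * δ ^ m)) := by
            refine prod_le_prod (fun t _ => ?_) fun t ht => ?_
            · have : δ ^ #(cl t) ≤ 1 := pow_le_one₀ hδ.le (by linarith)
              linarith
            · have h1 : δ ^ m ≤ δ ^ #(cl t) :=
                pow_le_pow_of_le_one hδ.le (by linarith) (hm t ht)
              have h2 := Real.add_one_le_exp (-(1 / 2 * δ ^ m))
              linarith
        _ = Real.exp (#S * -(1 / 2 * δ ^ m)) := by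
            rw [prod_const, ← Real.exp_nat_mul]
        _ ≤ _ := by
            rw [Real.exp_le_exp]
            linarith
    calc W ∅ φ ≤ ∑ v : β, ∑ w : β, Real.exp (-(2 * a)) :=
          sum_le_sum fun v _ => sum_le_sum fun w _ => this v w
      _ = _ := by
          simp only [sum_const, card_univ, nsmul_eq_mul]
          ring
  have hWpos : 0 < W ∅ φ := by
    have : ∀ v w, 0 < potential G δ S cl (fun t x => if x = t then w else v) ∅ φ := by
      intro v w
      simp only [potential, notMem_empty, if_false, prod_const]
      refine prod_pos fun t _ => ?_
      have : δ ^ #(cl t) ≤ 1 := pow_le_one₀ hδ.le (by linarith)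
      linarith
    have hne : (univ : Finset β).Nonempty := by
      rw [← card_pos, card_univ]; exact hβ
    exact sum_pos (fun v _ => sum_pos (fun w _ => this v w) hne) hne
  have hcond := hit.condition (by positivity) (fun ψ => sum_nonneg fun v _ => sum_nonneg fun w _ =>
    hpot0 _ _ _) hWpos
  refine hcond.mono (by positivity) (by rw [← mul_div_assoc]; norm_num) fun ψ _ hψ =>
    ⟨hψ.1, fun v w => ?_⟩
  have h1 : potential G δ S cl (fun t x => if x = t then w else v) D₀ ψ ≤ W D₀ ψ :=
    (single_le_sum (f := fun w => potential G δ S cl (fun t x => if x = t then w else v) D₀ ψ)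
      (fun w _ => hpot0 _ _ _) (mem_univ w)).trans
    (single_le_sum (f := fun v => ∑ w, potential G δ S cl (fun t x => if x = t then w else v) D₀ ψ)
      (fun v _ => sum_nonneg fun w _ => hpot0 _ _ _) (mem_univ v))
  have h2 : potential G δ S cl (fun t x => if x = t then w else v) D₀ ψ =
      (1 / 2) ^ #{t ∈ S | ∀ x ∈ cl t, G.Adj (if x = t then w else v) (ψ x)} := by
    rw [potential, ← prod_const, prod_filter]
    refine prod_congr rfl fun t ht => ?_
    have : ∏ x ∈ cl t, (if x ∈ D₀ then
        (if G.Adj (if x = t then w else v) (ψ x) then (1 : ℝ) else 0) else δ) =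
        if ∀ x ∈ cl t, G.Adj (if x = t then w else v) (ψ x) then 1 else 0 := by
      rw [prod_congr rfl fun x hx => if_pos (hcl t ht hx), prod_boole]
      congr
    rw [this]
    split_ifs <;> norm_num
  set g := #{t ∈ S | ∀ x ∈ cl t, G.Adj (if x = t then w else v) (ψ x)} with hg
  have h3 : Real.exp (-(g : ℝ)) ≤ (1 / 2) ^ g := by
    have : Real.exp (-1) ≤ 1 / 2 := by
      rw [Real.exp_neg, inv_le_comm₀ (Real.exp_pos _) (by norm_num)]
      have := Real.add_one_le_exp (1 : ℝ)
      norm_num at this ⊢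
      exact this
    calc Real.exp (-(g : ℝ)) = Real.exp (-1) ^ g := by
          rw [← Real.exp_nat_mul]; ring_nf
      _ ≤ _ := pow_le_pow_left₀ (Real.exp_pos _).le this _
  have h4 : Real.exp (-(g : ℝ)) ≤ Real.exp (-a) := by
    calc Real.exp (-(g : ℝ)) ≤ 2 * W ∅ φ := by rw [← h2] at h3; linarith [hψ.2]
      _ ≤ (2 * n ^ 2) * Real.exp (-(2 * a)) := by linarith
      _ ≤ Real.exp a * Real.exp (-(2 * a)) := by gcongr
      _ = _ := by rw [← Real.exp_add]; ring_nf
  rw [Real.exp_le_exp] at h4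
  linarith

end RandomStart

section Separated

variable {α : Type*} [Fintype α] [DecidableEq α]

open scoped Classical in
/-- The set consisting of `t` and its neighbours. -/
noncomputable def SimpleGraph.closedNbhd (T : SimpleGraph α) (t : α) : Finset α :=
  insert t ({x | T.Adj t x} : Finset α)

lemma SimpleGraph.mem_closedNbhd {T : SimpleGraph α} {t x : α} :
    x ∈ T.closedNbhd t ↔ x = t ∨ T.Adj t x := by
  simp [SimpleGraph.closedNbhd]

lemma SimpleGraph.mem_closedNbhd_comm {T : SimpleGraph α} {t x : α} :
    x ∈ T.closedNbhd t ↔ t ∈ T.closedNbhd x := by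
  rw [SimpleGraph.mem_closedNbhd, SimpleGraph.mem_closedNbhd, T.adj_comm, eq_comm]

lemma SimpleGraph.exists_separated {T : SimpleGraph α} {m : ℕ} (hT : ∀ t, #(T.closedNbhd t) ≤ m)
    (I : Finset α) :
    ∃ S ⊆ I, (∀ t ∈ S, ∀ t' ∈ S, t ≠ t' → Disjoint (T.closedNbhd t) (T.closedNbhd t')) ∧
      #I ≤ #S * (m * m) := by
  classical
  obtain ⟨S, hS, hmax⟩ := exists_max_image
    {S ∈ I.powerset | ∀ t ∈ S, ∀ t' ∈ S, t ≠ t' → Disjoint (T.closedNbhd t) (T.closedNbhd t')}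
    card ⟨∅, by simp⟩
  rw [mem_filter, mem_powerset] at hS
  refine ⟨S, hS.1, hS.2, ?_⟩
  have hcov : I ⊆ S.biUnion fun s => (T.closedNbhd s).biUnion T.closedNbhd := by
    intro t ht
    by_contra hcon
    simp only [mem_biUnion, not_exists, not_and] at hcon
    have hdis : ∀ s ∈ S, Disjoint (T.closedNbhd s) (T.closedNbhd t) := fun s hs =>
      Finset.disjoint_left.2 fun x hx hxt => hcon s hs x hx (SimpleGraph.mem_closedNbhd_comm.1 hxt)
    have htS : t ∉ S := fun h => by
      have := hdis t h
      rw [Finset.disjoint_left] at this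
      exact this (SimpleGraph.mem_closedNbhd.2 (.inl rfl)) (SimpleGraph.mem_closedNbhd.2 (.inl rfl))
    have := hmax (insert t S) (by
      rw [mem_filter, mem_powerset]
      refine ⟨insert_subset ht hS.1, fun u hu v hv huv => ?_⟩
      rw [mem_insert] at hu hv
      rcases hu with rfl | hu <;> rcases hv with rfl | hv
      · exact absurd rfl huv
      · exact (hdis v hv).symm
      · exact hdis u hu
      · exact hS.2 u hu v hv huv)
    rw [card_insert_of_notMem htS] at this
    omega
  refine (card_le_card hcov).trans (card_biUnion_le_card_mul _ _ _ fun s _ => ?_)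
  exact (card_biUnion_le_card_mul _ _ m fun x _ => hT x).trans (Nat.mul_le_mul_right _ (hT s))

open scoped Classical in
lemma TreeOrder.card_boundary_le {T : SimpleGraph α} (O : TreeOrder T) {blk : α → ℕ} {B : ℕ}
    (hB : ∀ x, blk x < B)
    (hroot : ∀ x y, (x = O.root ∨ blk (O.par x) < blk x) → (y = O.root ∨ blk (O.par y) < blk y) →
      blk x = blk y → x = y) (hpar : ∀ x, blk (O.par x) ≤ blk x) (j : ℕ) :
    #{t | blk t < j ∧ ¬ ∀ x ∈ T.closedNbhd t, blk x < j} ≤ B := by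
  have hsub : ({t | blk t < j ∧ ¬ ∀ x ∈ T.closedNbhd t, blk x < j} : Finset α) ⊆
      ({x | blk (O.par x) < blk x} : Finset α).image O.par := by
    intro t ht
    simp only [mem_filter, mem_univ, true_and, not_forall, SimpleGraph.mem_closedNbhd] at ht
    obtain ⟨htj, x, hx, hxj⟩ := ht
    rcases hx with rfl | hx
    · exact absurd htj hxj
    rcases O.adj_cases t x hx with ⟨-, h⟩ | ⟨-, h⟩
    · have := hpar t
      rw [h] at this
      omega
    · exact mem_image.2 ⟨x, by simp only [mem_filter, mem_univ, true_and, h]; omega, h⟩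
  refine (card_le_card hsub).trans (card_image_le.trans ?_)
  rw [← card_range B]
  refine card_le_card_of_injOn blk (fun x _ => by simpa using hB x) ?_
  intro x hx y hy hxy
  simp only [coe_filter, Set.mem_ofPred_eq, mem_univ, true_and] at hx hy
  exact hroot x y (.inr hx) (.inr hy) hxy

lemma TreeOrder.exists_separated {T : SimpleGraph α} (O : TreeOrder T) {m : ℕ}
    (hT : ∀ t, #(T.closedNbhd t) ≤ m) {blk : α → ℕ} {B : ℕ}
    (hB : ∀ x, blk x < B)
    (hroot : ∀ x y, (x = O.root ∨ blk (O.par x) < blk x) → (y = O.root ∨ blk (O.par y) < blk y) →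
      blk x = blk y → x = y) (hpar : ∀ x, blk (O.par x) ≤ blk x) (j : ℕ) :
    ∃ S : Finset α, (∀ t ∈ S, ∀ x ∈ T.closedNbhd t, blk x < j) ∧
      (∀ t ∈ S, ∀ t' ∈ S, t ≠ t' → Disjoint (T.closedNbhd t) (T.closedNbhd t')) ∧
      #{x | blk x < j} ≤ #S * (m * m) + B := by
  classical
  obtain ⟨S, hS, h1, h2⟩ := SimpleGraph.exists_separated hT
    {t | blk t < j ∧ ∀ x ∈ T.closedNbhd t, blk x < j}
  refine ⟨S, fun t ht => (mem_filter.1 (hS ht)).2.2, h1, ?_⟩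
  have h3 := O.card_boundary_le hB hroot hpar j
  have h4 : ({x | blk x < j} : Finset α) ⊆
      ({t | blk t < j ∧ ∀ x ∈ T.closedNbhd t, blk x < j} : Finset α) ∪
      ({t | blk t < j ∧ ¬ ∀ x ∈ T.closedNbhd t, blk x < j} : Finset α) := by
    intro x hx
    simp only [mem_filter, mem_univ, true_and, mem_union] at hx ⊢
    tauto
  have := (card_le_card h4).trans (card_union_le _ _)
  omega

lemma exists_prefix_card {blk : α → ℕ} {B s : ℕ} (hB : ∀ x, blk x < B)
    (hs : ∀ j, #{x | blk x = j} ≤ s) {k : ℕ} (hk : k ≤ Fintype.card α) :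
    ∃ j, j ≤ B ∧ k ≤ #{x | blk x < j} ∧ #{x | blk x < j} ≤ k + s := by
  have hex : ∃ j, k ≤ #{x | blk x < j} := ⟨B, by simpa [hB] using hk⟩
  refine ⟨Nat.find hex, Nat.find_min' hex (by simpa [hB] using hk), Nat.find_spec hex, ?_⟩
  rcases h : Nat.find hex with _ | j
  · simp
  · have h1 : ¬ k ≤ #{x | blk x < j} := Nat.find_min hex (h ▸ Nat.lt_succ_self j)
    have h2 : ({x | blk x < j + 1} : Finset α) ⊆ ({x | blk x < j} : Finset α) ∪ ({x | blk x = j} : Finset α) := by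
      intro x hx
      simp only [mem_filter, mem_univ, true_and, mem_union] at hx ⊢
      omega
    have := (card_le_card h2).trans (card_union_le _ _)
    have := hs j
    omega

end Separated

section RandomBlock

variable {α β : Type*} [Fintype α] [Fintype β] [DecidableEq α] [DecidableEq β]

open scoped Classical in
lemma random_block {T : SimpleGraph α} {G : SimpleGraph β} (O : TreeOrder T) {D E : Finset α}
    {ρ : α} (hD : ∀ y ∈ D, O.par y ∈ D) (hDE : Disjoint D E) (hρ : ρ ∈ E) (hρr : ρ ≠ O.root)
    (hρD : O.par ρ ∈ D) (hE : ∀ x ∈ E, x ≠ ρ → x ≠ O.root ∧ O.par x ∈ E)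
    {φ : α → β} (hφ : PartialEmb T G D φ) {A : Bool → Finset β} {W : Finset β} {q d L w s : ℝ}
    (hd : 0 ≤ d) (hA : ∀ b, Disjoint (A b) (D.image φ)) (hW : Disjoint W (D.image φ))
    (hL : ∀ b, L ≤ #(A b))
    (hAA : ∀ b, (#{a ∈ A b | (#{a' ∈ A !b | G.Adj a a'} : ℝ) < d * #(A !b)} : ℝ) ≤ d / 2 * L)
    (hWA : ∀ u, w ≤ #{x ∈ W | G.Adj u x ∧
      d * #(A !(O.col ρ)) ≤ #{a ∈ A !(O.col ρ) | G.Adj x a}})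
    (hs : #E ≤ s) (hq : 0 ≤ q) (hqw : 1 ≤ q * (w - s)) (hqL : 1 ≤ q * (d / 2 * L - s)) :
    RandomExtension q φ E (fun χ => PartialEmb T G (D ∪ E) χ ∧ χ ρ ∈ W ∧
      ∀ y ∈ E, y ≠ ρ → χ y ∈ A (O.col y)) 0 0 := by
  have := RandomExtension.iterate_zero (φ := φ) (E := E) O.rk_injective hq
    (fun E' χ => PartialEmb T G (D ∪ E') χ ∧ ∀ y ∈ E', (y = ρ → χ y ∈ W) ∧
      (y ≠ ρ → χ y ∈ A (O.col y)) ∧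
      d * #(A !(O.col y)) ≤ #{a ∈ A !(O.col y) | G.Adj (χ y) a}) ⟨by simpa using hφ, by simp⟩ ?_
  · exact this.mono hq le_rfl fun ψ _ h => ⟨h.1, (h.2 ρ hρ).1 rfl, fun y hy hyρ => (h.2 y hy).2.1 hyρ⟩
  intro x hx ψ hψ hP
  set E' : Finset α := {y ∈ E | O.rk y < O.rk x} with hE'
  have hxE' : x ∉ E' := by simp [hE']
  have hxD : x ∉ D := fun h => Finset.disjoint_left.1 hDE h hx
  have hψD : ∀ z ∈ D, ψ z = φ z := fun z hz => hψ z fun h =>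
    Finset.disjoint_left.1 hDE hz (mem_filter.1 h).1
  have himD : D.image ψ = D.image φ := image_congr fun z hz => hψD z hz
  have hcard : (#(E'.image ψ) : ℝ) ≤ s := by
    refine le_trans ?_ hs
    exact_mod_cast card_image_le.trans (card_le_card (filter_subset _ _))
  have hclosed : ∀ y ∈ D ∪ E', O.par y ∈ D ∪ E' := by
    intro y hy
    rcases mem_union.1 hy with hy | hy
    · exact mem_union_left _ (hD y hy)
    · rw [hE', mem_filter] at hy
      by_cases hyρ : y = ρ
      · exact mem_union_left _ (hyρ ▸ hρD)
      · obtain ⟨h1, h2⟩ := hE y hy.1 hyρ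
        exact mem_union_right _ (mem_filter.2 ⟨h2, (O.rk_par y h1).trans hy.2⟩)
  have hup : ∀ c, ∀ y ∈ E', Function.update ψ x c y = ψ y := fun c y hy =>
    Function.update_of_ne (ne_of_mem_of_not_mem hy hxE') _ _
  have hroot : x ≠ O.root := by
    by_cases h : x = ρ
    · exact h ▸ hρr
    · exact (hE x hx h).1
  have hpar : O.par x ∈ D ∪ E' := by
    by_cases h : x = ρ
    · exact mem_union_left _ (h ▸ hρD)
    · exact mem_union_right _ (mem_filter.2 ⟨(hE x hx h).2, O.rk_par x hroot⟩)
  have fin : ∀ C₀ : Finset β, Disjoint C₀ (D.image φ) → 1 ≤ q * (#C₀ - s) →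
      (∀ c ∈ C₀, G.Adj (ψ (O.par x)) c ∧ (x = ρ → c ∈ W) ∧ (x ≠ ρ → c ∈ A (O.col x)) ∧
        d * #(A !(O.col x)) ≤ #{a ∈ A !(O.col x) | G.Adj c a}) →
      ∃ C : Finset β, 1 ≤ q * #C ∧ ∀ v ∈ C, PartialEmb T G (D ∪ insert x E')
        (Function.update ψ x v) ∧ ∀ y ∈ insert x E', (y = ρ → Function.update ψ x v y ∈ W) ∧
        (y ≠ ρ → Function.update ψ x v y ∈ A (O.col y)) ∧
        d * #(A !(O.col y)) ≤ #{a ∈ A !(O.col y) | G.Adj (Function.update ψ x v y) a} := by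
    intro C₀ hC₀ hqC h
    refine ⟨C₀ \ E'.image ψ, hqC.trans (mul_le_mul_of_nonneg_left ?_ hq), fun v hv => ⟨?_, ?_⟩⟩
    · have := card_filter_sdiff_ge C₀ (E'.image ψ) (fun _ => True)
      simp only [filter_true] at this
      linarith
    · rw [mem_sdiff] at hv
      rw [union_insert]
      refine hP.1.insert O hclosed (by simp [hxD, hxE']) (fun _ => hpar) ?_ fun _ => (h v hv.1).1
      rw [image_union, mem_union, himD, not_or]
      exact ⟨Finset.disjoint_left.1 hC₀ hv.1, hv.2⟩
    · intro y hy
      rcases mem_insert.1 hy with rfl | hy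
      · rw [Function.update_self]
        exact (h v (mem_sdiff.1 hv).1).2
      · rw [hup v y hy]
        exact hP.2 y hy
  by_cases hxρ : x = ρ
  · refine fin {y ∈ W | G.Adj (ψ (O.par x)) y ∧
      d * #(A !(O.col ρ)) ≤ #{a ∈ A !(O.col ρ) | G.Adj y a}}
      (hW.mono_left (filter_subset _ _)) ?_ ?_
    · refine hqw.trans (mul_le_mul_of_nonneg_left ?_ hq)
      linarith [hWA (ψ (O.par x))]
    · intro c hc
      rw [mem_filter] at hc
      exact ⟨hc.2.1, fun _ => hc.1, fun h => absurd hxρ h, by rw [hxρ]; exact hc.2.2⟩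
  · have hparE : O.par x ∈ E' := mem_filter.2 ⟨(hE x hx hxρ).2, O.rk_par x hroot⟩
    have hcol : (!(O.col (O.par x))) = O.col x := by
      have := O.col_par x hroot
      revert this
      cases O.col x <;> cases O.col (O.par x) <;> simp
    have h1 := (hP.2 _ hparE).2.2
    rw [hcol] at h1
    have h2 := hAA (O.col x)
    refine fin {y ∈ A (O.col x) | G.Adj (ψ (O.par x)) y ∧
      d * #(A !(O.col x)) ≤ #{a ∈ A !(O.col x) | G.Adj y a}}
      ((hA _).mono_left (filter_subset _ _)) ?_ ?_
    · refine hqL.trans (mul_le_mul_of_nonneg_left ?_ hq)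
      have h3 : ({y ∈ A (O.col x) | G.Adj (ψ (O.par x)) y} : Finset β) ⊆
          {y ∈ A (O.col x) | G.Adj (ψ (O.par x)) y ∧
            d * #(A !(O.col x)) ≤ #{a ∈ A !(O.col x) | G.Adj y a}} ∪
          ({a ∈ A (O.col x) | (#{a' ∈ A !(O.col x) | G.Adj a a'} : ℝ) < d * #(A !(O.col x))} :
            Finset β) := by
        intro y hy
        simp only [mem_union, mem_filter] at hy ⊢
        rcases le_or_gt (d * #(A !(O.col x)) : ℝ) (#{a' ∈ A !(O.col x) | G.Adj y a'} : ℝ)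
          with h | h
        · exact .inl ⟨hy.1, hy.2, h⟩
        · exact .inr ⟨hy.1, h⟩
      have h4 := Nat.cast_le (α := ℝ).2 ((card_le_card h3).trans (card_union_le _ _))
      push_cast at h4
      have h5 := mul_le_mul_of_nonneg_left (hL (O.col x)) hd
      linarith
    · intro c hc
      rw [mem_filter] at hc
      exact ⟨hc.2.1, fun h => absurd h hxρ, fun _ => hc.1, hc.2.2⟩

end RandomBlock

namespace Frame

variable {α β κ : Type} [Fintype α] [Fintype β] [DecidableEq α] [DecidableEq β] [Fintype κ]
  {G : SimpleGraph β} {I₀ : Finset β} {d L c : ℝ}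

/-- After removing `X`, paired clusters have almost the same size. -/
def Balanced (F : Frame G I₀ κ d L c) (s : ℕ) (X : Finset β) : Prop :=
  ∀ i, #(F.U i \ X) ≤ #(F.U (F.mate i) \ X) + s

omit [DecidableEq α] [Fintype α] in
lemma Balanced.exists_large {F : Frame G I₀ κ d L c} {s : ℕ} {X : Finset β} (h : F.Balanced s X)
    (hX : Fintype.card κ * (L + s) < ∑ i, (#(F.U i \ X) : ℝ)) :
    ∃ i, L ≤ #(F.U i \ X) ∧ L ≤ #(F.U (F.mate i) \ X) := by
  by_contra! hcon
  refine absurd hX (not_lt.2 ?_)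
  rw [← nsmul_eq_mul, ← card_univ]
  refine sum_le_card_nsmul _ _ _ fun i _ => ?_
  rcases lt_or_ge (#(F.U i \ X) : ℝ) L with h1 | h1
  · have : (0 : ℝ) ≤ s := by positivity
    linarith
  · have h2 := hcon i h1
    have h3 : (#(F.U i \ X) : ℝ) ≤ #(F.U (F.mate i) \ X) + s := by exact_mod_cast h i
    linarith

omit [DecidableEq α] [Fintype α] in
lemma Balanced.exists_oriented {F : Frame G I₀ κ d L c} {s : ℕ} {X : Finset β}
    (h : F.Balanced s X)
    (hX : Fintype.card κ * (L + s) < ∑ i, (#(F.U i \ X) : ℝ)) (a b : ℕ) :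
    ∃ i, L ≤ #(F.U i \ X) ∧ L ≤ #(F.U (F.mate i) \ X) ∧
      ((b ≤ a ∧ #(F.U (F.mate i) \ X) ≤ #(F.U i \ X)) ∨
        (a ≤ b ∧ #(F.U i \ X) ≤ #(F.U (F.mate i) \ X))) := by
  obtain ⟨i, h1, h2⟩ := h.exists_large hX
  have h3 : L ≤ #(F.U (F.mate (F.mate i)) \ X) := by rwa [F.mate_mate]
  rcases le_total a b with hab | hab <;>
    rcases le_total #(F.U i \ X) #(F.U (F.mate i) \ X) with hf | hf
  · exact ⟨i, h1, h2, .inr ⟨hab, hf⟩⟩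
  · exact ⟨F.mate i, h2, h3, .inr ⟨hab, by rwa [F.mate_mate]⟩⟩
  · exact ⟨F.mate i, h2, h3, .inl ⟨hab, by rwa [F.mate_mate]⟩⟩
  · exact ⟨i, h1, h2, .inl ⟨hab, hf⟩⟩

lemma random_step {T : SimpleGraph α} (F : Frame G I₀ κ d L c) (O : TreeOrder T) {D E : Finset α}
    {ρ : α} (hD : ∀ y ∈ D, O.par y ∈ D) (hDE : Disjoint D E) (hρ : ρ ∈ E) (hρr : ρ ≠ O.root)
    (hρD : O.par ρ ∈ D) (hE : ∀ x ∈ E, x ≠ ρ → x ≠ O.root ∧ O.par x ∈ E)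
    {φ : α → β} (hφ : PartialEmb T G D φ) {s : ℕ} {q b : ℝ} (hd : 0 ≤ d) (hs : #E ≤ s)
    (hbal : F.Balanced s (D.image φ))
    (hlarge : Fintype.card κ * (L + s) < ∑ i, (#(F.U i \ D.image φ) : ℝ))
    (hb : #(F.W ∩ D.image φ) ≤ b)
    (hq : 0 ≤ q) (hqw : 1 ≤ q * (c * Fintype.card β - b - s)) (hqL : 1 ≤ q * (d / 2 * L - s)) :
    RandomExtension q φ E (fun χ => PartialEmb T G (D ∪ E) χ ∧
      #(F.W ∩ (D ∪ E).image χ) ≤ #(F.W ∩ D.image φ) + 1 ∧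
      F.Balanced s ((D ∪ E).image χ)) 0 0 := by
  classical
  set X := D.image φ with hX
  set N : Bool → Finset α := fun b => {y ∈ E | y ≠ ρ ∧ O.col y = b} with hN
  have hNs : ∀ b, #(N b) ≤ s := fun b => (card_le_card (filter_subset _ _)).trans hs
  set i₀ := O.col ρ with hi₀
  obtain ⟨i, hi1, hi2, hi3⟩ := hbal.exists_oriented hlarge #(N !i₀) #(N i₀)
  set V : Bool → κ := fun b => if b = i₀ then F.mate i else i with hV
  have hV0 : V i₀ = F.mate i := by simp [hV]
  have hV1 : V (!i₀) = i := by simp [hV]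
  have hVm : ∀ b, F.mate (V b) = V !b := by
    intro b
    rcases Bool.eq_or_eq_not b i₀ with h | h
    · rw [h, hV0, hV1, F.mate_mate]
    · rw [h, Bool.not_not, hV0, hV1]
  have hVL : ∀ b, L ≤ #(F.U (V b) \ X) := by
    intro b
    rcases Bool.eq_or_eq_not b i₀ with h | h
    · rwa [h, hV0]
    · rwa [h, hV1]
  have hrb := random_block O hD hDE hρ hρr hρD hE hφ (A := fun b => F.U (V b) \ X) (W := F.W \ X)
    (q := q) (d := d) (L := L) (w := c * Fintype.card β - b) (s := s) hd
    (fun b => sdiff_disjoint) sdiff_disjoint hVL ?_ ?_ (by exact_mod_cast hs) hq hqw hqL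
  rotate_left
  · intro b
    have := F.card_atypical (V b) (F.U (V b) \ X) sdiff_subset (F.U (V !b) \ X)
      (by rw [hVm]; exact sdiff_subset) (hVL b) (hVL !b)
    exact this
  · intro u
    have h1 := F.card_reservoir u (V !i₀) (F.U (V !i₀) \ X) sdiff_subset (hVL _)
    have h2 := card_filter_sdiff_ge F.W (F.W ∩ X) (fun x => G.Adj u x ∧
      d * #(F.U (V !i₀) \ X) ≤ #{a ∈ F.U (V !i₀) \ X | G.Adj x a})
    rw [sdiff_inter_self_left] at h2
    linarith
  refine hrb.mono hq le_rfl fun χ hχ ⟨hP, hρW, hcol⟩ => ⟨hP, ?_, ?_⟩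
  · have hXD : D.image χ = X := image_congr fun z hz => hχ z (Finset.disjoint_left.1 hDE hz)
    have hsub : F.W ∩ (D ∪ E).image χ ⊆ insert (χ ρ) (F.W ∩ X) := by
      intro v hv
      rw [image_union, hXD, mem_inter, mem_union] at hv
      rw [mem_insert, mem_inter]
      rcases hv.2 with h | h
      · exact .inr ⟨hv.1, h⟩
      · obtain ⟨y, hy, rfl⟩ := mem_image.1 h
        by_cases hyρ : y = ρ
        · exact .inl (by rw [hyρ])
        · exact absurd hv.1 (Finset.disjoint_left.1 (F.disjoint_W _)
            (mem_sdiff.1 (hcol y hy hyρ)).1)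
    exact (card_le_card hsub).trans (card_insert_le _ _)
  · have hXD : D.image χ = X := image_congr fun z hz => hχ z (Finset.disjoint_left.1 hDE hz)
    have hsame : ∀ k, (∀ b, k ≠ V b) → F.U k \ (D ∪ E).image χ = F.U k \ X := by
      intro k hk
      rw [image_union, hXD]
      ext v
      simp only [mem_sdiff, mem_union, not_or]
      refine ⟨fun h => ⟨h.1, h.2.1⟩, fun h => ⟨h.1, h.2, fun hv => ?_⟩⟩
      obtain ⟨y, hy, rfl⟩ := mem_image.1 hv
      by_cases hyρ : y = ρ
      · subst hyρ
        exact Finset.disjoint_left.1 (F.disjoint_W k) h.1 (mem_sdiff.1 hρW).1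
      · exact Finset.disjoint_left.1 (F.disjoint_U k _ (hk (O.col y))) h.1
          (mem_sdiff.1 (hcol y hy hyρ)).1
    have hVne : ∀ b, V b ≠ V !b := fun b => by rw [← hVm]; exact (F.mate_ne _).symm
    have hused : ∀ b, #(F.U (V b) \ (D ∪ E).image χ) + #(N b) = #(F.U (V b) \ X) := by
      intro b
      have h1 : (N b).image χ ⊆ F.U (V b) \ X := by
        intro v hv
        obtain ⟨y, hy, rfl⟩ := mem_image.1 hv
        simp only [hN, mem_filter] at hy
        have := hcol y hy.1 hy.2.1
        rwa [hy.2.2] at this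
      have h2 : F.U (V b) \ (D ∪ E).image χ = (F.U (V b) \ X) \ (N b).image χ := by
        rw [image_union, hXD]
        ext v
        simp only [mem_sdiff, mem_union, not_or]
        refine ⟨fun h => ⟨⟨h.1, h.2.1⟩, fun hv => h.2.2 ?_⟩, fun h => ⟨h.1.1, h.1.2, fun hv => ?_⟩⟩
        · exact image_subset_image (filter_subset _ _) hv
        · obtain ⟨y, hy, rfl⟩ := mem_image.1 hv
          by_cases hyρ : y = ρ
          · subst hyρ
            exact Finset.disjoint_left.1 (F.disjoint_W _) h.1.1 (mem_sdiff.1 hρW).1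
          · rcases Bool.eq_or_eq_not (O.col y) b with hb | hb
            · exact h.2 (mem_image_of_mem _ (mem_filter.2 ⟨hy, hyρ, hb⟩))
            · have := (mem_sdiff.1 (hcol y hy hyρ)).1
              rw [hb] at this
              exact Finset.disjoint_left.1 (F.disjoint_U _ _ (hVne b)) h.1.1 this
      have h3 : #((N b).image χ) = #(N b) := by
        refine card_image_of_injOn (hP.1.mono ?_)
        exact_mod_cast (filter_subset _ _).trans subset_union_right
      rw [h2, ← h3, card_sdiff_add_card_eq_card h1]
    have hu0 := hused i₀
    have hu1 := hused !i₀
    have hn0 := hNs i₀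
    have hn1 := hNs !i₀
    rw [hV0] at hu0
    rw [hV1] at hu1
    have hb0 := hbal i
    have hb1 := hbal (F.mate i)
    rw [F.mate_mate] at hb1
    intro k
    by_cases hk : ∃ b, k = V b
    · obtain ⟨b, rfl⟩ := hk
      rw [hVm]
      rcases Bool.eq_or_eq_not b i₀ with h | h
      · rw [h, hV0, hV1]; omega
      · rw [h, Bool.not_not, hV0, hV1]; omega
    · push Not at hk
      rw [hsame k hk, hsame (F.mate k) ?_]
      · exact hbal k
      · intro b hb
        refine hk (!b) ?_
        rw [← hVm, ← hb, F.mate_mate]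

end Frame

namespace Frame

variable {α β κ : Type} [Fintype α] [Fintype β] [DecidableEq α] [DecidableEq β] [Fintype κ]
  {G : SimpleGraph β} {I₀ : Finset β} {d L c : ℝ}

omit [DecidableEq α] [Fintype α] in
lemma sum_card_sdiff_ge (F : Frame G I₀ κ d L c) {X : Finset β} (hX : I₀ ⊆ X) :
    #I₀ + ∑ i, #(F.U i) ≤ #X + ∑ i, #(F.U i \ X) := by
  have h1 : ∑ i, #(F.U i ∩ X) ≤ #(X \ I₀) := by
    rw [← card_biUnion fun i _ j _ hij =>
      (F.disjoint_U i j hij).mono inter_subset_left inter_subset_left]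
    refine card_le_card fun v hv => ?_
    obtain ⟨i, -, hi⟩ := mem_biUnion.1 hv
    rw [mem_inter] at hi
    exact mem_sdiff.2 ⟨hi.2, Finset.disjoint_left.1 (F.disjoint_I i) hi.1⟩
  have h2 : ∑ i, #(F.U i) = ∑ i, #(F.U i ∩ X) + ∑ i, #(F.U i \ X) := by
    rw [← sum_add_distrib]
    exact sum_congr rfl fun i _ => (card_inter_add_card_sdiff _ _).symm
  have h3 := card_sdiff_add_card_eq_card hX
  omega

lemma random_extend {T : SimpleGraph α} (F : Frame G I₀ κ d L c) (O : TreeOrder T)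
    {blk : α → ℕ} {B s : ℕ} (hpar : ∀ x, blk (O.par x) ≤ blk x) (hs : ∀ j, #{x | blk x = j} ≤ s)
    (hroot : ∀ x y, (x = O.root ∨ blk (O.par x) < blk x) → (y = O.root ∨ blk (O.par y) < blk y) →
      blk x = blk y → x = y) {j₀ J : ℕ} (hj₀ : j₀ ≤ J) (hJ : J ≤ B) (hr : blk O.root < j₀)
    {φ : α → β} (hφ : PartialEmb T G {x | blk x < j₀} φ)
    (hI₀ : ({x | blk x < j₀} : Finset α).image φ = I₀) {q : ℝ} (hd : 0 ≤ d)
    (hlarge : Fintype.card κ * (L + s) + #{x | blk x < J} < #I₀ + ∑ i, (#(F.U i) : ℝ))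
    (hq : 0 ≤ q) (hs1 : 1 ≤ s)
    (hqw : 1 ≤ q * (c * Fintype.card β - B - s)) (hqL : 1 ≤ q * (d / 2 * L - s)) :
    RandomExtension q φ {x | j₀ ≤ blk x ∧ blk x < J} (PartialEmb T G {x | blk x < J}) 0 0 := by
  set D : ℕ → Finset α := fun j => {x | blk x < j} with hD
  have key : ∀ j, j₀ ≤ j → j ≤ J → RandomExtension q φ {x | j₀ ≤ blk x ∧ blk x < j}
      (fun ψ => PartialEmb T G (D j) ψ ∧ #(F.W ∩ (D j).image ψ) ≤ j - j₀ ∧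
        F.Balanced s ((D j).image ψ)) 0 0 := by
    intro j hj
    induction j, hj using Nat.le_induction with
    | base =>
      intro _
      have : ({x | j₀ ≤ blk x ∧ blk x < j₀} : Finset α) = ∅ := by
        ext x; simp
      rw [this]
      refine RandomExtension.refl ⟨hφ, ?_, ?_⟩ (by simp)
      · rw [hI₀, disjoint_iff_inter_eq_empty.1 F.W_disjoint_I]
        simp
      · intro i
        rw [hI₀, sdiff_eq_self_of_disjoint (F.disjoint_I i),
          sdiff_eq_self_of_disjoint (F.disjoint_I _)]
        exact (F.card_le i).trans (by omega)
    | succ j hj ih =>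
      intro hjJ
      have hE : ({x | j₀ ≤ blk x ∧ blk x < j + 1} : Finset α) =
          ({x | j₀ ≤ blk x ∧ blk x < j} : Finset α) ∪ ({x | blk x = j} : Finset α) := by
        ext x
        simp only [mem_filter, mem_univ, true_and, mem_union]
        omega
      have hDj : D (j + 1) = D j ∪ ({x | blk x = j} : Finset α) := by
        ext x
        simp only [hD, mem_filter, mem_univ, true_and, mem_union]
        omega
      rw [hE]
      refine RandomExtension.bind hq ?_ (ih (by omega)) fun ψ hψ ⟨hP, hW, hbal⟩ => ?_
      · rw [Finset.disjoint_left]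
        intro x hx hx'
        simp only [mem_filter, mem_univ, true_and] at hx hx'
        omega
      rw [hDj]
      set E : Finset α := {x | blk x = j} with hEdef
      obtain hEe | hne := E.eq_empty_or_nonempty
      · rw [hEe, union_empty]
        exact RandomExtension.refl ⟨hP, hW.trans (by omega), hbal⟩ (by simp)
      obtain ⟨ρ, hρ, hρmin⟩ := exists_min_image E O.rk hne
      have hρj : blk ρ = j := by simpa [hEdef] using hρ
      have hρr : ρ ≠ O.root := by rintro rfl; omega
      have hρpar : blk (O.par ρ) < blk ρ := by
        refine lt_of_le_of_ne (hpar ρ) fun h => ?_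
        have h1 := hρmin (O.par ρ) (by simp [hEdef, h, hρj])
        have h2 := O.rk_par ρ hρr
        omega
      have hsub : (D j₀).image φ ⊆ (D j).image ψ := by
        intro v hv
        obtain ⟨y, hy, rfl⟩ := mem_image.1 hv
        simp only [hD, mem_filter, mem_univ, true_and] at hy
        rw [← hψ y (by simp only [mem_filter, mem_univ, true_and]; omega)]
        exact mem_image_of_mem _ (by simp only [hD, mem_filter, mem_univ, true_and]; omega)
      have hXD : #((D j).image ψ) ≤ #(D J) := by
        refine card_image_le.trans (card_le_card fun x hx => ?_)
        simp only [hD, mem_filter, mem_univ, true_and] at hx ⊢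
        omega
      have hst := F.random_step O (D := D j) (E := E) (ρ := ρ) (φ := ψ) (s := s) (q := q) (b := B)
        ?_ ?_ hρ hρr ?_ ?_ hP hd (hs j) hbal ?_ ?_ hq hqw hqL
      · exact hst.mono hq le_rfl fun χ _ ⟨h1, h2, h3⟩ => ⟨h1, h2.trans (by omega), h3⟩
      · intro y hy
        simp only [hD, mem_filter, mem_univ, true_and] at hy ⊢
        exact (hpar y).trans_lt hy
      · rw [Finset.disjoint_left]
        intro x hx hx'
        simp only [hD, hEdef, mem_filter, mem_univ, true_and] at hx hx'
        omega
      · simp only [hD, mem_filter, mem_univ, true_and]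
        omega
      · intro x hx hxρ
        have hxj : blk x = j := by simpa [hEdef] using hx
        refine ⟨by rintro rfl; omega, ?_⟩
        simp only [hEdef, mem_filter, mem_univ, true_and]
        by_contra hne
        exact hxρ (hroot x ρ (.inr (lt_of_le_of_ne (hpar x) (by omega))) (.inr hρpar)
          (by omega))
      · have h1 := F.sum_card_sdiff_ge (hI₀ ▸ hsub)
        have h2 : (#I₀ : ℝ) + ∑ i, (#(F.U i) : ℝ) ≤ #(D J) + ∑ i, (#(F.U i \ (D j).image ψ) : ℝ) := by
          exact_mod_cast h1.trans (Nat.add_le_add_right hXD _)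
        linarith
      · have : #(F.W ∩ (D j).image ψ) ≤ B := hW.trans (by omega)
        exact_mod_cast this
  exact (key J hj₀ le_rfl).mono hq le_rfl fun ψ _ h => h.1

end Frame

section RandomBijection

lemma pow_mul_factorial_sub_le {m r : ℕ} (h : r ≤ m) :
    (m : ℝ) ^ r * (m - r).factorial ≤ 3 ^ r * m.factorial := by
  induction r generalizing m with
  | zero => simp
  | succ r ih =>
    obtain ⟨m, rfl⟩ : ∃ k, m = k + 1 := ⟨m - 1, by omega⟩
    have hr : r ≤ m := by omega
    have h1 : ((m + 1 : ℕ) : ℝ) ^ r ≤ 3 * (m : ℝ) ^ r := by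
      rcases Nat.eq_zero_or_pos m with rfl | hm
      · obtain rfl : r = 0 := by omega
        norm_num
      have hm0 : (0 : ℝ) < m := by exact_mod_cast hm
      have h2 : ((m + 1 : ℕ) : ℝ) ≤ m * Real.exp (1 / m) := by
        have := mul_le_mul_of_nonneg_left (Real.add_one_le_exp (1 / m : ℝ)) hm0.le
        push_cast
        calc (m : ℝ) + 1 = m * (1 / m + 1) := by field_simp; ring
          _ ≤ _ := this
      calc ((m + 1 : ℕ) : ℝ) ^ r ≤ (m * Real.exp (1 / m)) ^ r :=
            pow_le_pow_left₀ (by positivity) h2 _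
        _ = Real.exp (r * (1 / m)) * (m : ℝ) ^ r := by
            rw [mul_pow, ← Real.exp_nat_mul, mul_comm]
        _ ≤ Real.exp 1 * (m : ℝ) ^ r := by
            gcongr
            rw [mul_one_div, div_le_one hm0]
            exact_mod_cast hr
        _ ≤ _ := by
            gcongr
            exact (Real.exp_one_lt_d9.trans (by norm_num)).le
    have h3 := ih hr
    rw [Nat.add_sub_add_right, Nat.factorial_succ]
    push_cast at h1 ⊢
    rw [pow_succ, pow_succ]
    have hf : (0 : ℝ) ≤ ((m - r).factorial : ℝ) := by positivity
    calc ((m : ℝ) + 1) ^ r * (m + 1) * (m - r).factorial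
        ≤ (3 * (m : ℝ) ^ r) * (m + 1) * (m - r).factorial := by gcongr
      _ = 3 * (m + 1) * ((m : ℝ) ^ r * (m - r).factorial) := by ring
      _ ≤ 3 * (m + 1) * (3 ^ r * m.factorial) := by gcongr
      _ = _ := by ring

lemma card_perm_fixing_le {γ : Type*} [Fintype γ] [DecidableEq γ] (X : Finset γ) :
    #{π : Equiv.Perm γ | ∀ z ∈ X, π z = z} ≤ (Fintype.card γ - #X).factorial := by
  have h1 := Fintype.card_congr (Equiv.Perm.subtypeEquivSubtypePerm fun z : γ => z ∉ X)
  rw [Fintype.card_perm, Fintype.card_subtype_compl, Fintype.card_coe,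
    Fintype.card_subtype] at h1
  rw [h1]
  simp

variable {α β : Type*} [Fintype α] [Fintype β] [DecidableEq α] [DecidableEq β]

lemma card_equiv_agree_le {γ ε : Type*} [Fintype γ] [DecidableEq γ] [Fintype ε] [DecidableEq ε]
    (X : Finset γ) (y : γ → ε) :
    #{σ : γ ≃ ε | ∀ z ∈ X, σ z = y z} ≤ (Fintype.card γ - #X).factorial := by
  obtain h | ⟨σ₀, hσ₀⟩ := ({σ : γ ≃ ε | ∀ z ∈ X, σ z = y z} : Finset _).eq_empty_or_nonempty
  · simp [h]
  refine le_trans ?_ (card_perm_fixing_le X)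
  refine card_le_card_of_injOn (fun σ => σ.trans σ₀.symm) ?_ ?_
  · intro σ hσ
    simp only [coe_filter, mem_univ, true_and, Set.mem_ofPred_eq, mem_filter] at hσ hσ₀ ⊢
    intro z hz
    simp [hσ z hz, ← hσ₀ z hz]
  · intro σ _ σ' _ h
    ext z
    have := congrArg (fun e : Equiv.Perm γ => σ₀ (e z)) h
    simpa using this

lemma exists_random_bijection {Λ : Finset α} {L : Finset β} (h : #Λ = #L) (φ : α → β) :
    RandomExtension (3 / #Λ) φ Λ (fun s => Set.InjOn s Λ ∧ ∀ x ∈ Λ, s x ∈ L) 0 0 := by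
  set ex : ({x // x ∈ Λ} ≃ {v // v ∈ L}) → α → β := fun σ x =>
    if h : x ∈ Λ then σ ⟨x, h⟩ else φ x with hex
  have hexm : ∀ σ x (hx : x ∈ Λ), ex σ x = σ ⟨x, hx⟩ := fun σ x hx => by simp [hex, hx]
  set w : ℝ := ((#Λ).factorial : ℝ)⁻¹ with hw
  have hw0 : 0 ≤ w := by positivity
  have hsum : ∀ p : (α → β) → Prop, ∀ _ : DecidablePred p,
      ∑ ψ with p ψ, ∑ σ, (if ex σ = ψ then w else 0) = w * #{σ | p (ex σ)} := by
    intro p _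
    rw [sum_comm]
    simp only [sum_ite_eq, mem_filter, mem_univ, true_and]
    rw [← sum_filter, sum_const, nsmul_eq_mul, mul_comm]
  refine ⟨fun ψ => ∑ σ, if ex σ = ψ then w else 0, fun ψ => by positivity, ?_, ?_, ?_, by simp⟩
  · have := hsum (fun _ => True) inferInstance
    simp only [filter_true, card_univ] at this
    rw [this, Fintype.card_equiv (Fintype.equivOfCardEq (by simpa using h)), Fintype.card_coe,
      hw, inv_mul_cancel₀ (by positivity)]
  · intro ψ hψ
    obtain ⟨σ, -, hσ⟩ := exists_ne_zero_of_sum_ne_zero hψ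
    have : ex σ = ψ := by by_contra hne; simp [hne] at hσ
    subst this
    refine ⟨fun x hx => by simp [hex, hx], fun x hx x' hx' hxx => ?_, fun x hx => ?_⟩
    · rw [hexm σ x hx, hexm σ x' hx'] at hxx
      simpa using σ.injective (Subtype.ext hxx)
    · rw [hexm σ x hx]
      exact (σ _).2
  · intro X hX y
    rw [hsum]
    have hcard : #{σ | ∀ x ∈ X, ex σ x = y x} ≤ (#Λ - #X).factorial := by
      obtain he | ⟨σ₀, hσ₀⟩ := ({σ | ∀ x ∈ X, ex σ x = y x} : Finset _).eq_empty_or_nonempty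
      · simp [he]
      have h1 := card_equiv_agree_le (X.subtype (· ∈ Λ)) σ₀
      rw [card_subtype, filter_true_of_mem fun x hx => hX hx, Fintype.card_coe] at h1
      refine le_trans (card_le_card fun σ hσ => ?_) h1
      simp only [mem_filter, mem_univ, true_and, mem_subtype] at hσ hσ₀ ⊢
      rintro ⟨z, hz⟩ hzX
      apply Subtype.ext
      rw [← hexm σ z hz, ← hexm σ₀ z hz, hσ z hzX, hσ₀ z hzX]
    have h2 := pow_mul_factorial_sub_le (card_le_card hX)
    have h3 : (#{σ | ∀ x ∈ X, ex σ x = y x} : ℝ) ≤ (#Λ - #X).factorial := Nat.cast_le.2 hcard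
    obtain he | hne := X.eq_empty_or_nonempty
    · subst he
      simp only [card_empty, pow_zero, Nat.sub_zero] at h3 ⊢
      rw [hw, inv_mul_le_one₀ (by positivity)]
      exact h3
    have hΛ : (0 : ℝ) < #Λ := Nat.cast_pos.2 (hne.mono hX).card_pos
    rw [div_pow, le_div_iff₀ (by positivity), hw, mul_assoc, inv_mul_le_iff₀ (by positivity)]
    calc _ ≤ ((#Λ - #X).factorial : ℝ) * (#Λ : ℝ) ^ #X := by gcongr
      _ = (#Λ : ℝ) ^ #X * (#Λ - #X).factorial := mul_comm _ _
      _ ≤ _ := h2.trans_eq (mul_comm _ _)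

end RandomBijection

section RandomSwap

variable {α β : Type*} [Fintype α] [Fintype β] [DecidableEq α] [DecidableEq β]

open scoped Classical in
lemma exists_random_swap {T : SimpleGraph α} {G : SimpleGraph β} (O : TreeOrder T) {D S : Finset α}
    (hr : O.root ∈ D) {s : α → β} {a : ℝ} (ha : 0 < a)
    (hgood : ∀ v w, a ≤ #{t ∈ S | ∀ x ∈ T.closedNbhd t, G.Adj (if x = t then w else v) (s x)})
    (hD : (#Dᶜ : ℝ) ≤ a / 2) :
    RandomExtension (2 / a) id Dᶜ (fun t : α → α => ∀ l ∈ Dᶜ, t l ∈ S ∧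
      (∀ l' ∈ Dᶜ, t l = t l' → l = l') ∧
      ∀ x ∈ T.closedNbhd (t l), G.Adj (if x = t l then s (t (O.par l)) else s l) (s x)) 0 0 := by
  refine RandomExtension.iterate_zero O.rk_injective (by positivity) (fun E t => ∀ l ∈ E, t l ∈ S ∧
      (∀ l' ∈ E, t l = t l' → l = l') ∧
      ∀ x ∈ T.closedNbhd (t l), G.Adj (if x = t l then s (t (O.par l)) else s l) (s x))
      (by simp) ?_
  intro x hx t _ hP
  set E : Finset α := {y ∈ Dᶜ | O.rk y < O.rk x} with hE
  have hmem : ∀ y ∈ E, y ∉ D ∧ O.rk y < O.rk x := fun y hy => by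
    rw [hE, mem_filter, mem_compl] at hy; exact hy
  have hroot : ∀ y, y ∉ D → y ≠ O.root := fun y hy h => hy (h ▸ hr)
  have hup : ∀ v, ∀ y, O.rk y < O.rk x → Function.update t x v y = t y := fun v y hy =>
    Function.update_of_ne (by rintro rfl; exact lt_irrefl _ hy) _ _
  refine ⟨{τ ∈ S | ∀ y ∈ T.closedNbhd τ, G.Adj (if y = τ then s (t (O.par x)) else s x) (s y)} \
    E.image t, ?_, ?_⟩
  · have h1 := card_filter_sdiff_ge {τ ∈ S | ∀ y ∈ T.closedNbhd τ,
      G.Adj (if y = τ then s (t (O.par x)) else s x) (s y)} (E.image t) (fun _ => True)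
    simp only [filter_true] at h1
    have h2 : (#(E.image t) : ℝ) ≤ #Dᶜ := by
      exact_mod_cast card_image_le.trans (card_le_card (filter_subset _ _))
    have h3 := hgood (s x) (s (t (O.par x)))
    rw [div_mul_eq_mul_div, le_div_iff₀ ha]
    linarith
  · intro v hv
    rw [mem_sdiff, mem_filter] at hv
    have hxpar := O.rk_par x (hroot x (mem_compl.1 hx))
    intro l hl
    rcases mem_insert.1 hl with rfl | hl
    · rw [Function.update_self, hup v _ hxpar]
      refine ⟨hv.1.1, fun l' hl' hll => ?_, hv.1.2⟩
      rcases mem_insert.1 hl' with rfl | hl'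
      · rfl
      · rw [hup v l' (hmem l' hl').2] at hll
        exact absurd (mem_image.2 ⟨l', hl', hll.symm⟩) hv.2
    · obtain ⟨h1, h2, h3⟩ := hP l hl
      have hlE := hmem l hl
      rw [hup v l hlE.2, hup v _ ((O.rk_par l (hroot l hlE.1)).trans hlE.2)]
      refine ⟨h1, fun l' hl' hll => ?_, h3⟩
      rcases mem_insert.1 hl' with rfl | hl'
      · rw [Function.update_self] at hll
        exact absurd (mem_image.2 ⟨l, hl, hll⟩) hv.2
      · rw [hup v l' (hmem l' hl').2] at hll
        exact h2 l' hl' hll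

open scoped Classical in
/-- The involution that swaps each `l ∉ D` with `t l`. -/
noncomputable def swapMap (D : Finset α) (t : α → α) (x : α) : α :=
  if x ∈ Dᶜ then t x else if h : ∃ l ∈ Dᶜ, t l = x then h.choose else x

variable {D S : Finset α} {t : α → α}

lemma swapMap_of_notMem {x : α} (hx : x ∈ Dᶜ) : swapMap D t x = t x := if_pos hx

lemma swapMap_apply (ht : ∀ l ∈ Dᶜ, t l ∈ D ∧ ∀ l' ∈ Dᶜ, t l = t l' → l = l') {l : α}
    (hl : l ∈ Dᶜ) : swapMap D t (t l) = l := by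
  have hex : ∃ l' ∈ Dᶜ, t l' = t l := ⟨l, hl, rfl⟩
  rw [swapMap, if_neg (by simpa using (ht l hl).1), dif_pos hex]
  exact (ht _ hex.choose_spec.1).2 l hl hex.choose_spec.2

lemma swapMap_eq_self {x : α} (hx : x ∈ D) (h : ∀ l ∈ Dᶜ, t l ≠ x) : swapMap D t x = x := by
  rw [swapMap, if_neg (by simpa using hx), dif_neg (by push Not; exact h)]

lemma swapMap_injective (ht : ∀ l ∈ Dᶜ, t l ∈ D ∧ ∀ l' ∈ Dᶜ, t l = t l' → l = l') :
    Function.Injective (swapMap D t) := by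
  refine Function.Involutive.injective fun x => ?_
  by_cases hx : x ∈ Dᶜ
  · rw [swapMap_of_notMem hx, swapMap_apply ht hx]
  · by_cases h : ∃ l ∈ Dᶜ, t l = x
    · obtain ⟨l, hl, rfl⟩ := h
      rw [swapMap_apply ht hl, swapMap_of_notMem hl]
    · push Not at h
      have hx' : x ∈ D := by simpa using hx
      rw [swapMap_eq_self hx' h, swapMap_eq_self hx' h]

lemma adj_comp_swapMap {T : SimpleGraph α} {G : SimpleGraph β} (O : TreeOrder T)
    (hD : ∀ y ∈ D, O.par y ∈ D) (hS : ∀ τ ∈ S, T.closedNbhd τ ⊆ D)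
    (hdisj : ∀ τ ∈ S, ∀ τ' ∈ S, τ ≠ τ' → Disjoint (T.closedNbhd τ) (T.closedNbhd τ'))
    {s : α → β} (hs : PartialEmb T G D s) (htD : ∀ x ∈ D, t x = x)
    (ht : ∀ l ∈ Dᶜ, t l ∈ S ∧ (∀ l' ∈ Dᶜ, t l = t l' → l = l') ∧
      ∀ x ∈ T.closedNbhd (t l), G.Adj (if x = t l then s (t (O.par l)) else s l) (s x))
    {u v : α} (huv : T.Adj u v) : G.Adj (s (swapMap D t u)) (s (swapMap D t v)) := by
  have hSD : ∀ τ ∈ S, τ ∈ D := fun τ hτ => hS τ hτ (SimpleGraph.mem_closedNbhd.2 (.inl rfl))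
  have ht' : ∀ l ∈ Dᶜ, t l ∈ D ∧ ∀ l' ∈ Dᶜ, t l = t l' → l = l' := fun l hl =>
    ⟨hSD _ (ht l hl).1, (ht l hl).2.1⟩
  have hself : ∀ x y, T.Adj x y → (∃ l ∈ Dᶜ, t l = x) → y ∈ D → swapMap D t y = y := by
    rintro x y hxy ⟨l, hl, rfl⟩ hy
    refine swapMap_eq_self hy fun l' hl' h => ?_
    subst h
    have := hdisj _ (ht l hl).1 _ (ht l' hl').1 hxy.ne
    rw [Finset.disjoint_left] at this
    exact this (SimpleGraph.mem_closedNbhd.2 (.inr hxy)) (SimpleGraph.mem_closedNbhd.2 (.inl rfl))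
  have hmoved : ∀ x y, T.Adj x y → (∃ l ∈ Dᶜ, t l = x) → y ∈ D →
      G.Adj (s (swapMap D t x)) (s (swapMap D t y)) := by
    intro x y hxy hex hy
    rw [hself x y hxy hex hy]
    obtain ⟨l, hl, rfl⟩ := hex
    have := (ht l hl).2.2 y (SimpleGraph.mem_closedNbhd.2 (.inr hxy))
    rw [if_neg hxy.ne'] at this
    rwa [swapMap_apply ht' hl]
  have hDD : ∀ x y, T.Adj x y → x ∈ D → y ∈ D →
      G.Adj (s (swapMap D t x)) (s (swapMap D t y)) := by
    intro x y hxy hx hy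
    by_cases h1 : ∃ l ∈ Dᶜ, t l = x
    · exact hmoved x y hxy h1 hy
    by_cases h2 : ∃ l ∈ Dᶜ, t l = y
    · exact (hmoved y x hxy.symm h2 hx).symm
    push Not at h1 h2
    rw [swapMap_eq_self hx h1, swapMap_eq_self hy h2]
    exact hs.2 x hx y hy hxy
  have hup : ∀ x, x ≠ O.root → T.Adj x (O.par x) →
      G.Adj (s (swapMap D t x)) (s (swapMap D t (O.par x))) := by
    intro x hx hxy
    by_cases hxD : x ∈ D
    · exact hDD x _ hxy hxD (hD x hxD)
    have hxD' : x ∈ Dᶜ := mem_compl.2 hxD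
    have h1 : swapMap D t (O.par x) = t (O.par x) := by
      by_cases hp : O.par x ∈ D
      · rw [htD _ hp]
        refine swapMap_eq_self hp fun l hl h => hxD ?_
        refine hS _ (ht l hl).1 ?_
        rw [h]
        exact SimpleGraph.mem_closedNbhd.2 (.inr hxy.symm)
      · exact swapMap_of_notMem (mem_compl.2 hp)
    have := (ht x hxD').2.2 (t x) (SimpleGraph.mem_closedNbhd.2 (.inl rfl))
    rw [if_pos rfl] at this
    rw [h1, swapMap_of_notMem hxD']
    exact this.symm
  rcases O.adj_cases u v huv with ⟨h1, rfl⟩ | ⟨h1, rfl⟩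
  · exact hup u h1 huv
  · exact (hup v h1 huv.symm).symm

end RandomSwap

section RandomSwitch

variable {α β : Type*} [Fintype α] [Fintype β] [DecidableEq α] [DecidableEq β]

/-- The value that a bijection must take at `b` if swapping is to produce the values `y`. -/
noncomputable def forcedValue (A : Finset α) (φ y : α → β) (b : α) : β :=
  open scoped Classical in if h : ∃ a ∈ A, φ a = y b then y h.choose else y b

lemma forcedValue_eq {A : Finset α} {φ y : α → β} (hφ : Set.InjOn φ A) {a b : α} (ha : a ∈ A)
    (h : φ a = y b) : forcedValue A φ y b = y a := by
  have hex : ∃ a ∈ A, φ a = y b := ⟨a, ha, h⟩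
  rw [forcedValue, dif_pos hex, hφ hex.choose_spec.1 ha (hex.choose_spec.2.trans h.symm)]

lemma swap_forced {D X A B R : Finset α} {φ y s : α → β} (hs : Function.Injective s)
    (hsφ : ∀ x ∈ D, s x = φ x) (hA : A = {x ∈ X | x ∈ D ∧ φ x ≠ y x}) (hB : B = {x ∈ X | x ∉ D})
    (hR : R = {b ∈ B | ∃ a ∈ A, φ a = y b}) {t₀ : α → α}
    (ht₀ : ∀ l ∈ Dᶜ, t₀ l ∈ D ∧ ∀ l' ∈ Dᶜ, t₀ l = t₀ l' → l = l')
    (hy₀ : ∀ x ∈ X, s (swapMap D t₀ x) = y x) :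
    (∀ b ∈ R, s b = forcedValue A φ y b) ∧ ∃ J ⊆ Dᶜ, #A + #B ≤ #J + #R ∧ ∀ t : α → α,
      (∀ l ∈ Dᶜ, t l ∈ D ∧ ∀ l' ∈ Dᶜ, t l = t l' → l = l') →
      (∀ x ∈ X, s (swapMap D t x) = y x) → ∀ l ∈ J, t l = t₀ l := by
  have hAD : ∀ x ∈ A, x ∈ X ∧ x ∈ D ∧ φ x ≠ y x := fun x hx => by rwa [hA, mem_filter] at hx
  have hBD : ∀ x ∈ B, x ∈ X ∧ x ∈ Dᶜ := fun x hx => by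
    rw [hB, mem_filter] at hx; exact ⟨hx.1, mem_compl.2 hx.2⟩
  have hφA : Set.InjOn φ A := fun x hx x' hx' h => hs <| by
    rw [hsφ x (hAD x hx).2.1, hsφ x' (hAD x' hx').2.1, h]
  have hforceA : ∀ t : α → α, (∀ l ∈ Dᶜ, t l ∈ D ∧ ∀ l' ∈ Dᶜ, t l = t l' → l = l') →
      (∀ x ∈ X, s (swapMap D t x) = y x) → ∀ x ∈ A, ∃ l ∈ Dᶜ, t l = x ∧ s l = y x := by
    intro t ht hy x hx
    obtain ⟨hxX, hxD, hne⟩ := hAD x hx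
    have h1 := hy x hxX
    by_cases hex : ∃ l ∈ Dᶜ, t l = x
    · obtain ⟨l, hl, rfl⟩ := hex
      rw [swapMap_apply ht hl] at h1
      exact ⟨l, hl, rfl, h1⟩
    · push Not at hex
      rw [swapMap_eq_self hxD hex, hsφ x hxD] at h1
      exact absurd h1 hne
  have hforceB : ∀ t : α → α, (∀ l ∈ Dᶜ, t l ∈ D ∧ ∀ l' ∈ Dᶜ, t l = t l' → l = l') →
      (∀ x ∈ X, s (swapMap D t x) = y x) → ∀ x ∈ B, s (t x) = y x := by
    intro t ht hy x hx
    rw [← hy x (hBD x hx).1, swapMap_of_notMem (hBD x hx).2]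
  set A' : Finset α := {l ∈ Dᶜ | ∃ x ∈ A, s l = y x} with hA'
  have hA'card : #A ≤ #A' := by
    refine card_le_card_of_injOn (swapMap D t₀) ?_ (swapMap_injective ht₀).injOn
    intro x hx
    obtain ⟨l, hl, rfl, hsl⟩ := hforceA t₀ ht₀ hy₀ x hx
    rw [swapMap_apply ht₀ hl]
    exact mem_coe.2 (mem_filter.2 ⟨hl, _, hx, hsl⟩)
  have hforceA' : ∀ t : α → α, (∀ l ∈ Dᶜ, t l ∈ D ∧ ∀ l' ∈ Dᶜ, t l = t l' → l = l') →
      (∀ x ∈ X, s (swapMap D t x) = y x) → ∀ l ∈ Dᶜ, ∀ x ∈ A, s l = y x → t l = x := by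
    intro t ht hy l _ x hx h
    obtain ⟨l', _, h2, h3⟩ := hforceA t ht hy x hx
    rw [hs (h.trans h3.symm), h2]
  have hinter : A' ∩ B ⊆ R := by
    intro l hl
    rw [mem_inter, hA', mem_filter] at hl
    obtain ⟨⟨hlD, x, hx, h⟩, hlB⟩ := hl
    have h1 := hforceA' t₀ ht₀ hy₀ l hlD x hx h
    have h2 := hforceB t₀ ht₀ hy₀ l hlB
    rw [h1, hsφ x (hAD x hx).2.1] at h2
    rw [hR, mem_filter]
    exact ⟨hlB, x, hx, h2⟩
  refine ⟨fun b hb => ?_, A' ∪ B, ?_, ?_, ?_⟩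
  · rw [hR, mem_filter] at hb
    obtain ⟨hbB, a, ha, hab⟩ := hb
    have h1 := hforceB t₀ ht₀ hy₀ b hbB
    have h2 : t₀ b = a := hs (by rw [h1, ← hab, hsφ a (hAD a ha).2.1])
    have h3 := hy₀ a (hAD a ha).1
    rw [← h2, swapMap_apply ht₀ (hBD b hbB).2, h2] at h3
    rw [h3, forcedValue_eq hφA ha hab]
  · exact union_subset (filter_subset _ _) fun b hb => (hBD b hb).2
  · have h1 := card_union_add_card_inter A' B
    have h2 := card_le_card hinter
    omega
  · intro t ht hy l hl
    rcases mem_union.1 hl with hl | hl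
    · rw [hA', mem_filter] at hl
      obtain ⟨hlD, x, hx, h⟩ := hl
      rw [hforceA' t ht hy l hlD x hx h, hforceA' t₀ ht₀ hy₀ l hlD x hx h]
    · exact hs ((hforceB t ht hy l hl).trans (hforceB t₀ ht₀ hy₀ l hl).symm)

open scoped Classical in
lemma exists_random_switch {T : SimpleGraph α} {G : SimpleGraph β} (O : TreeOrder T)
    {D S : Finset α} (hr : O.root ∈ D) (hD : ∀ y ∈ D, O.par y ∈ D)
    (hS : ∀ τ ∈ S, T.closedNbhd τ ⊆ D)
    (hdisj : ∀ τ ∈ S, ∀ τ' ∈ S, τ ≠ τ' → Disjoint (T.closedNbhd τ) (T.closedNbhd τ'))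
    (hcard : Fintype.card α = Fintype.card β) {φ : α → β} (hφ : PartialEmb T G D φ) {a Q : ℝ}
    (ha : 0 < a)
    (hgood : ∀ v w, a ≤ #{t ∈ S | ∀ x ∈ T.closedNbhd t, G.Adj (if x = t then w else v) (φ x)})
    (hDa : (#Dᶜ : ℝ) ≤ a / 2) (hQ1 : Q ≤ 1) (hQa : 2 / a ≤ Q) (hQD : 3 / #Dᶜ ≤ Q) :
    ∃ μ : (α → β) → ℝ, (∀ χ, 0 ≤ μ χ) ∧ ∑ χ, μ χ = 1 ∧
      (∀ χ, μ χ ≠ 0 → Function.Injective χ ∧ ∀ u v, T.Adj u v → G.Adj (χ u) (χ v)) ∧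
      ∀ (X : Finset α) (y : α → β), ∑ χ with ∀ x ∈ X, χ x = y x, μ χ ≤
        Q ^ #{x ∈ X | x ∉ D ∨ φ x ≠ y x} := by
  have hSD : ∀ τ ∈ S, τ ∈ D := fun τ hτ => hS τ hτ (SimpleGraph.mem_closedNbhd.2 (.inl rfl))
  have hQ0 : 0 ≤ Q := le_trans (by positivity) hQa
  have himc : #Dᶜ = #(D.image φ)ᶜ := by
    rw [card_compl, card_compl, card_image_of_injOn hφ.1, hcard]
  obtain ⟨lam, l0, l1, ls, lp, -⟩ := exists_random_bijection himc φ
  have hsinj : ∀ s, lam s ≠ 0 → Function.Injective s := by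
    intro s hs x x' h
    obtain ⟨h1, h2, h3⟩ := ls s hs
    have hD' : ∀ x ∈ D, s x = φ x := fun x hx => h1 x (by simpa using hx)
    have hcross : ∀ x ∈ D, ∀ x' ∉ D, s x ≠ s x' := by
      intro x hx x' hx' h
      have := h3 x' (mem_compl.2 hx')
      rw [← h, hD' x hx, mem_compl] at this
      exact this (mem_image_of_mem _ hx)
    by_cases hx : x ∈ D <;> by_cases hx' : x' ∈ D
    · exact hφ.1 hx hx' (by rw [← hD' x hx, ← hD' x' hx', h])
    · exact absurd h (hcross x hx x' hx')
    · exact absurd h.symm (hcross x' hx' x hx)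
    · exact h2 (by simpa using hx) (by simpa using hx') h
  have hsφ : ∀ s, lam s ≠ 0 → ∀ x ∈ D, s x = φ x := fun s hs x hx =>
    (ls s hs).1 x (by simpa using hx)
  have key : ∀ s, ∃ η : (α → α) → ℝ, lam s ≠ 0 → (∀ t, 0 ≤ η t) ∧ ∑ t, η t = 1 ∧
      (∀ t, η t ≠ 0 → (∀ x ∉ Dᶜ, t x = id x) ∧ (∀ l ∈ Dᶜ, t l ∈ S ∧
        (∀ l' ∈ Dᶜ, t l = t l' → l = l') ∧
        ∀ x ∈ T.closedNbhd (t l), G.Adj (if x = t l then s (t (O.par l)) else s l) (s x))) ∧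
      (∀ X ⊆ Dᶜ, ∀ y : α → α, ∑ t with ∀ x ∈ X, t x = y x, η t ≤ (2 / a) ^ #X) := by
    intro s
    by_cases hs : lam s = 0
    · exact ⟨0, fun h => absurd hs h⟩
    obtain ⟨η, h0, h1, h2, h3, -⟩ := exists_random_swap (T := T) (G := G) (S := S) O hr (s := s) ha
      (by
        intro v w
        refine (hgood v w).trans_eq ?_
        congr 2
        refine filter_congr fun t ht => forall₂_congr fun x hx => ?_
        rw [hsφ s hs x (hS t ht hx)]) hDa
    exact ⟨η, fun _ => ⟨h0, h1, h2, h3⟩⟩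
  choose η hη using key
  set μ : (α → β) → ℝ := fun χ => ∑ s, ∑ t, if s ∘ swapMap D t = χ then lam s * η s t else 0
    with hμ
  have hηl : ∀ s t, 0 ≤ lam s * η s t := by
    intro s t
    by_cases hs : lam s = 0
    · simp [hs]
    · exact mul_nonneg (l0 s) ((hη s hs).1 t)
  have hsum : ∀ p : (α → β) → Prop, ∀ _ : DecidablePred p, ∑ χ with p χ, μ χ =
      ∑ s, lam s * ∑ t with p (s ∘ swapMap D t), η s t := by
    intro p _
    simp only [hμ]
    rw [sum_comm]
    refine sum_congr rfl fun s _ => ?_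
    rw [sum_comm, mul_sum, sum_filter]
    refine sum_congr rfl fun t _ => ?_
    simp only [sum_ite_eq, mem_filter, mem_univ, true_and]
  refine ⟨μ, fun χ => sum_nonneg fun s _ => sum_nonneg fun t _ => ?_, ?_, ?_, ?_⟩
  · split_ifs
    · exact hηl s t
    · rfl
  · have := hsum (fun _ => True) inferInstance
    simp only [filter_true] at this
    rw [this, ← l1]
    refine sum_congr rfl fun s _ => ?_
    by_cases hs : lam s = 0
    · simp [hs]
    · rw [(hη s hs).2.1, mul_one]
  · intro χ hχ
    obtain ⟨s, -, hs⟩ := exists_ne_zero_of_sum_ne_zero hχ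
    obtain ⟨t, -, ht⟩ := exists_ne_zero_of_sum_ne_zero hs
    have hst : s ∘ swapMap D t = χ := by by_contra h; simp [h] at ht
    rw [if_pos hst] at ht
    have hs0 := left_ne_zero_of_mul ht
    have h1 := (hη s hs0).2.2.1 t (right_ne_zero_of_mul ht)
    subst hst
    refine ⟨(hsinj s hs0).comp (swapMap_injective fun l hl =>
      ⟨hSD _ (h1.2 l hl).1, (h1.2 l hl).2.1⟩), fun u v huv => ?_⟩
    exact adj_comp_swapMap O hD hS hdisj (hφ.congr (hsφ s hs0))
      (fun x hx => h1.1 x (by simpa using hx)) h1.2 huv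
  · intro X y
    set A : Finset α := {x ∈ X | x ∈ D ∧ φ x ≠ y x} with hA
    set B : Finset α := {x ∈ X | x ∉ D} with hB
    set R : Finset α := {b ∈ B | ∃ a ∈ A, φ a = y b} with hR
    have hAB : #{x ∈ X | x ∉ D ∨ φ x ≠ y x} = #A + #B := by
      rw [← card_union_of_disjoint]
      · congr 1
        ext x
        simp only [hA, hB, mem_filter, mem_union]
        tauto
      · rw [Finset.disjoint_left]
        intro x hx hx'
        simp only [hA, hB, mem_filter] at hx hx'
        exact hx'.2 hx.2.1
    have hRB : R ⊆ B := filter_subset _ _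
    have hRD : R ⊆ Dᶜ := fun b hb => by
      have := hRB hb
      rw [hB, mem_filter] at this
      exact mem_compl.2 this.2
    rw [hsum _ inferInstance, hAB]
    calc ∑ s, lam s * ∑ t with ∀ x ∈ X, (s ∘ swapMap D t) x = y x, η s t
        ≤ ∑ s, if ∀ b ∈ R, s b = forcedValue A φ y b then lam s * Q ^ (#A + #B - #R) else 0 := by
          refine sum_le_sum fun s _ => ?_
          by_cases hs : lam s = 0
          · simp [hs]
          obtain ⟨e0, e1, es, ep⟩ := hη s hs
          by_cases hex : ∃ t, η s t ≠ 0 ∧ ∀ x ∈ X, (s ∘ swapMap D t) x = y x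
          · obtain ⟨t₀, ht₀, hy₀⟩ := hex
            have hcond : ∀ t, η s t ≠ 0 → ∀ l ∈ Dᶜ, t l ∈ D ∧ ∀ l' ∈ Dᶜ, t l = t l' → l = l' :=
              fun t ht l hl => ⟨hSD _ ((es t ht).2 l hl).1, ((es t ht).2 l hl).2.1⟩
            obtain ⟨h1, J, hJ, hJc, hJt⟩ := swap_forced (hsinj s hs) (hsφ s hs) hA hB hR
              (hcond t₀ ht₀) hy₀
            rw [if_pos h1]
            refine mul_le_mul_of_nonneg_left ?_ (l0 s)
            calc ∑ t with ∀ x ∈ X, (s ∘ swapMap D t) x = y x, η s t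
                ≤ ∑ t with ∀ l ∈ J, t l = t₀ l, η s t := by
                  rw [sum_filter, sum_filter]
                  refine sum_le_sum fun t _ => ?_
                  by_cases ht : η s t = 0
                  · simp [ht]
                  · split_ifs with h2 h3
                    · rfl
                    · exact absurd (hJt t (hcond t ht) h2) h3
                    · exact e0 t
                    · rfl
              _ ≤ (2 / a) ^ #J := ep J hJ t₀
              _ ≤ Q ^ #J := pow_le_pow_left₀ (by positivity) hQa _
              _ ≤ _ := pow_le_pow_of_le_one hQ0 hQ1 (by omega)
          · have : ∑ t with ∀ x ∈ X, (s ∘ swapMap D t) x = y x, η s t = 0 := by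
              refine sum_eq_zero fun t ht => ?_
              by_contra hne
              exact hex ⟨t, hne, by simpa using ht⟩
            rw [this, mul_zero]
            split_ifs
            · exact mul_nonneg (l0 s) (by positivity)
            · rfl
      _ = (∑ s with ∀ b ∈ R, s b = forcedValue A φ y b, lam s) * Q ^ (#A + #B - #R) := by
          rw [← sum_filter, sum_mul]
      _ ≤ Q ^ #R * Q ^ (#A + #B - #R) := by
          refine mul_le_mul_of_nonneg_right ?_ (by positivity)
          exact (lp R hRD _).trans (pow_le_pow_left₀ (by positivity) hQD _)
      _ = _ := by
          rw [← pow_add]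
          congr 1
          have := card_le_card hRB
          omega

end RandomSwitch

section Mixture

variable {α β : Type*} [Fintype α] [Fintype β] [DecidableEq α] [DecidableEq β]

lemma sum_mul_pow_disagreement_le {q Q : ℝ} (hq : 0 ≤ q) (hqQ : q ≤ Q) {D : Finset α}
    {ν : (α → β) → ℝ} (hν : ∀ ψ, 0 ≤ ν ψ)
    (hsp : ∀ X ⊆ D, ∀ y : α → β, ∑ ψ with ∀ x ∈ X, ψ x = y x, ν ψ ≤ q ^ #X)
    (X : Finset α) (y : α → β) :
    ∑ ψ, ν ψ * Q ^ #{x ∈ X | x ∉ D ∨ ψ x ≠ y x} ≤ (2 * Q) ^ #X := by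
  have hQ : 0 ≤ Q := hq.trans hqQ
  calc ∑ ψ, ν ψ * Q ^ #{x ∈ X | x ∉ D ∨ ψ x ≠ y x}
      ≤ ∑ ψ, ∑ A ∈ X.powerset, if ∀ x ∈ (X \ A) ∩ D, ψ x = y x then
          (if X \ A ⊆ D then ν ψ * Q ^ #A else 0) else 0 := by
        refine sum_le_sum fun ψ _ => ?_
        have h0 : ∀ A ∈ X.powerset, 0 ≤ if ∀ x ∈ (X \ A) ∩ D, ψ x = y x then
          (if X \ A ⊆ D then ν ψ * Q ^ #A else 0) else 0 := fun A _ => by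
          have := mul_nonneg (hν ψ) (pow_nonneg hQ #A)
          split_ifs <;> first | exact this | exact le_rfl
        refine le_trans ?_ (single_le_sum h0 (mem_powerset.2
          (filter_subset (fun x => x ∉ D ∨ ψ x ≠ y x) X)))
        rw [if_pos, if_pos]
        · intro x hx
          simp only [mem_sdiff, mem_filter] at hx
          tauto
        · intro x hx
          simp only [mem_inter, mem_sdiff, mem_filter] at hx
          tauto
    _ = ∑ A ∈ X.powerset, if X \ A ⊆ D then
          (∑ ψ with ∀ x ∈ (X \ A) ∩ D, ψ x = y x, ν ψ) * Q ^ #A else 0 := by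
        rw [sum_comm]
        refine sum_congr rfl fun A _ => ?_
        rw [← sum_filter]
        split_ifs
        · rw [sum_mul]
        · simp
    _ ≤ ∑ A ∈ X.powerset, Q ^ #X := by
        refine sum_le_sum fun A hA => ?_
        split_ifs with h
        · rw [inter_eq_left.2 h, ← card_sdiff_add_card_eq_card (mem_powerset.1 hA), pow_add]
          exact mul_le_mul_of_nonneg_right
            ((hsp _ h y).trans (pow_le_pow_left₀ hq hqQ _)) (by positivity)
        · positivity
    _ = (2 * Q) ^ #X := by rw [sum_const, card_powerset, nsmul_eq_mul, mul_pow]; norm_num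

lemma IsVertexSpread.of_finset {q : ℝ} {μ : (α → β) → ℝ}
    (h : ∀ (X : Finset α) (y : α → β), ∑ χ with ∀ x ∈ X, χ x = y x, μ χ ≤ q ^ #X) :
    IsVertexSpread q μ := by
  intro k x y hx _
  cases isEmpty_or_nonempty (Fin k)
  · obtain rfl : k = 0 := by
      by_contra hk
      exact IsEmpty.false (⟨0, Nat.pos_of_ne_zero hk⟩ : Fin k)
    by_cases hf : Nonempty (α → β)
    · obtain ⟨f⟩ := hf
      simpa using h ∅ f
    · rw [not_nonempty_iff] at hf
      simp
  · have := h (univ.image x) (y ∘ Function.invFun x)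
    rw [card_image_of_injective _ hx, card_univ, Fintype.card_fin] at this
    simpa [Function.leftInverse_invFun hx _] using this

lemma RandomExtension.exists_vertexSpread {q Q c : ℝ} {φ₀ : α → β} {D : Finset α}
    {P R : (α → β) → Prop} {F : (α → β) → ℝ} (h : RandomExtension q φ₀ D P F c) (hq : 0 ≤ q)
    (hqQ : q ≤ Q)
    (hμ : ∀ φ, P φ → ∃ μ : (α → β) → ℝ, (∀ χ, 0 ≤ μ χ) ∧ ∑ χ, μ χ = 1 ∧ (∀ χ, μ χ ≠ 0 → R χ) ∧
      ∀ (X : Finset α) (y : α → β), ∑ χ with ∀ x ∈ X, χ x = y x, μ χ ≤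
        Q ^ #{x ∈ X | x ∉ D ∨ φ x ≠ y x}) :
    ∃ μ : (α → β) → ℝ, (∀ χ, 0 ≤ μ χ) ∧ ∑ χ, μ χ = 1 ∧ (∀ χ, μ χ ≠ 0 → R χ) ∧
      IsVertexSpread (2 * Q) μ := by
  obtain ⟨ν, n0, n1, ns, np, -⟩ := h
  have key : ∀ φ, ∃ μ : (α → β) → ℝ, ν φ ≠ 0 → (∀ χ, 0 ≤ μ χ) ∧ ∑ χ, μ χ = 1 ∧
      (∀ χ, μ χ ≠ 0 → R χ) ∧
      ∀ (X : Finset α) (y : α → β), ∑ χ with ∀ x ∈ X, χ x = y x, μ χ ≤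
        Q ^ #{x ∈ X | x ∉ D ∨ φ x ≠ y x} := by
    intro φ
    by_cases h : ν φ = 0
    · exact ⟨0, fun h' => absurd h h'⟩
    · obtain ⟨μ, hμ⟩ := hμ φ (ns φ h).2
      exact ⟨μ, fun _ => hμ⟩
  choose η hη using key
  refine ⟨fun χ => ∑ φ, ν φ * η φ χ, ?_, ?_, ?_, .of_finset ?_⟩
  · intro χ
    refine sum_nonneg fun φ _ => ?_
    by_cases h : ν φ = 0
    · simp [h]
    · exact mul_nonneg (n0 φ) ((hη φ h).1 χ)
  · rw [sum_comm, ← n1]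
    refine sum_congr rfl fun φ _ => ?_
    by_cases h : ν φ = 0
    · simp [h]
    · rw [← mul_sum, (hη φ h).2.1, mul_one]
  · intro χ hχ
    obtain ⟨φ, -, hφ⟩ := exists_ne_zero_of_sum_ne_zero hχ
    exact (hη φ (left_ne_zero_of_mul hφ)).2.2.1 χ (right_ne_zero_of_mul hφ)
  · intro X y
    refine le_trans ?_ (sum_mul_pow_disagreement_le hq hqQ n0 np X y)
    rw [sum_comm]
    refine sum_le_sum fun φ _ => ?_
    by_cases h : ν φ = 0
    · simp [h]
    · rw [← mul_sum]
      exact mul_le_mul_of_nonneg_left ((hη φ h).2.2.2 X y) (n0 φ)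

end Mixture

section Assembly

variable {α β : Type} [Fintype α] [Fintype β] [DecidableEq α] [DecidableEq β]

lemma TreeOrder.blk_root_le {T : SimpleGraph α} (O : TreeOrder T) {blk : α → ℕ}
    (hpar : ∀ x, blk (O.par x) ≤ blk x) (x : α) : blk O.root ≤ blk x := by
  obtain ⟨k, hk⟩ := O.exists_iterate_eq_root x
  rw [← hk]
  clear hk
  induction k with
  | zero => exact le_rfl
  | succ k ih =>
    rw [Function.iterate_succ_apply']
    exact (hpar _).trans ih

open scoped Classical in
lemma exists_vertexSpread_of_prefixes {T : SimpleGraph α} {G : SimpleGraph β} (O : TreeOrder T)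
    {δ d l c γ : ℝ} (hδ : 0 < δ) (hδ1 : δ ≤ 1 / 4)
    (hdeg : ∀ v, (1 / 2 + δ) * Fintype.card β ≤ #{w | G.Adj v w})
    (hcard : Fintype.card α = Fintype.card β) {blk : α → ℕ} {B s m : ℕ}
    (hpar : ∀ x, blk (O.par x) ≤ blk x) (hs : ∀ j, #{x | blk x = j} ≤ s)
    (hroot : ∀ x y, (x = O.root ∨ blk (O.par x) < blk x) → (y = O.root ∨ blk (O.par y) < blk y) →
      blk x = blk y → x = y) {j₀ J : ℕ} (hj₀ : j₀ ≤ J) (hJ : J ≤ B) (hr : blk O.root < j₀)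
    (hD₀ : #{x | blk x < j₀} ≤ δ / 2 * Fintype.card β) {S : Finset α}
    (hS : ∀ t ∈ S, ∀ x ∈ T.closedNbhd t, blk x < j₀)
    (hdisj : ∀ t ∈ S, ∀ t' ∈ S, t ≠ t' → Disjoint (T.closedNbhd t) (T.closedNbhd t'))
    (hm : ∀ t, #(T.closedNbhd t) ≤ m) {a : ℝ} (ha : 0 < a) (haS : a ≤ δ ^ m * #S / 4)
    (hn : 2 * (Fintype.card β : ℝ) ^ 2 ≤ Real.exp a)
    (hframe : ∀ I₀ : Finset β, #I₀ ≤ δ / 2 * Fintype.card β →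
      ∃ (κ : Type) (_ : Fintype κ) (L : ℝ) (F : Frame G I₀ κ d L c), l * Fintype.card β ≤ L ∧
        Fintype.card κ * L ≤ γ * Fintype.card β ∧
        Fintype.card β - #I₀ - γ * Fintype.card β ≤ ∑ i, (#(F.U i) : ℝ))
    (hd : 0 ≤ d) (hs1 : 1 ≤ s) (hsl : s ≤ l * Fintype.card β)
    (hDJ : #{x | blk x < J} < (1 - 3 * γ) * Fintype.card β)
    (hDa : (#({x | blk x < J} : Finset α)ᶜ : ℝ) ≤ a / 2) {Q : ℝ}
    (hQ1 : Q ≤ 1) (hQn : 4 / Fintype.card β ≤ Q) (hQa : 2 / a ≤ Q)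
    (hQD : 3 / #({x | blk x < J} : Finset α)ᶜ ≤ Q)
    (hqw : 1 ≤ Q * (c * Fintype.card β - B - s))
    (hqL : 1 ≤ Q * (d / 2 * (l * Fintype.card β) - s)) :
    ∃ μ : (α → β) → ℝ, (∀ χ, 0 ≤ μ χ) ∧ ∑ χ, μ χ = 1 ∧
      (∀ χ, μ χ ≠ 0 → Function.Injective χ ∧ ∀ u v, T.Adj u v → G.Adj (χ u) (χ v)) ∧
      IsVertexSpread (2 * Q) μ := by
  have hQ0 : 0 ≤ Q := le_trans (by positivity) hQn
  have hα : 0 < Fintype.card α := Fintype.card_pos_iff.2 ⟨O.root⟩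
  have hβ : 0 < Fintype.card β := hcard ▸ hα
  obtain ⟨φ₀⟩ : Nonempty (α → β) := by
    have := Fintype.card_pos_iff.1 hβ
    infer_instance
  have hclosed : ∀ j, ∀ x ∈ ({x | blk x < j} : Finset α), O.par x ∈ ({x | blk x < j} : Finset α) := by
    intro j x hx
    rw [mem_filter] at hx ⊢
    exact ⟨mem_univ _, (hpar x).trans_lt hx.2⟩
  have hSD : ∀ t ∈ S, T.closedNbhd t ⊆ ({x | blk x < j₀} : Finset α) := fun t ht x hx =>
    mem_filter.2 ⟨mem_univ _, hS t ht x hx⟩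
  have hDD : ({x | blk x < j₀} : Finset α) ⊆ ({x | blk x < J} : Finset α) := by
    intro x hx
    rw [mem_filter] at hx ⊢
    exact ⟨mem_univ _, hx.2.trans_le hj₀⟩
  have hunion : ({x | blk x < j₀} : Finset α) ∪ ({x | j₀ ≤ blk x ∧ blk x < J} : Finset α) =
      ({x | blk x < J} : Finset α) := by
    ext x
    simp only [mem_union, mem_filter, mem_univ, true_and]
    omega
  have hdis : Disjoint ({x | blk x < j₀} : Finset α)
      ({x | j₀ ≤ blk x ∧ blk x < J} : Finset α) := by
    rw [Finset.disjoint_left]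
    intro x hx hx'
    simp only [mem_filter, mem_univ, true_and] at hx hx'
    omega
  have hstart := (exists_random_start O hδ hδ1 hdeg (hclosed j₀) hD₀ hSD hdisj (fun t _ => hm t)
    haS hβ hn φ₀).mono (Q' := fun ψ => PartialEmb T G ({x | blk x < j₀} : Finset α) ψ ∧
      ∀ v w, a ≤ #{t ∈ S | ∀ x ∈ T.closedNbhd t, G.Adj (if x = t then w else v) (ψ x)})
    (by positivity) hQn (fun _ _ h => h)
  have hext : RandomExtension Q φ₀ ({x | blk x < J} : Finset α)
      (fun ψ => PartialEmb T G ({x | blk x < J} : Finset α) ψ ∧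
        ∀ v w, a ≤ #{t ∈ S | ∀ x ∈ T.closedNbhd t, G.Adj (if x = t then w else v) (ψ x)}) 0 0 := by
    rw [← hunion]
    refine RandomExtension.bind hQ0 hdis hstart fun ψ _ hψ => ?_
    rw [hunion]
    have hIc : (#(({x | blk x < j₀} : Finset α).image ψ) : ℝ) ≤ δ / 2 * Fintype.card β :=
      le_trans (Nat.cast_le.2 card_image_le) hD₀
    obtain ⟨κ, _, L, F, hlL, hκL, hU⟩ := hframe _ hIc
    have hsL : (s : ℝ) ≤ L := hsl.trans hlL
    have hκs : (Fintype.card κ : ℝ) * s ≤ γ * Fintype.card β :=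
      (mul_le_mul_of_nonneg_left hsL (Nat.cast_nonneg _)).trans hκL
    have hrun := F.random_extend O hpar hs hroot hj₀ hJ hr hψ.1 rfl (q := Q) hd (by linarith) hQ0
      hs1 hqw (hqL.trans (mul_le_mul_of_nonneg_left (by
        have := mul_le_mul_of_nonneg_left hlL ((show (0 : ℝ) ≤ d / 2 by linarith))
        linarith) hQ0))
    refine hrun.mono hQ0 le_rfl fun χ hχ hχ' => ⟨hχ', fun v w => ?_⟩
    refine (hψ.2 v w).trans (Nat.cast_le.2 (card_le_card fun t ht => ?_))
    rw [mem_filter] at ht ⊢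
    refine ⟨ht.1, fun x hx => ?_⟩
    rw [hχ x (Finset.disjoint_left.1 hdis (hSD t ht.1 hx))]
    exact ht.2 x hx
  refine hext.exists_vertexSpread hQ0 le_rfl fun φ hφ => ?_
  have := exists_random_switch O (D := ({x | blk x < J} : Finset α))
    (mem_filter.2 ⟨mem_univ _, hr.trans_le hj₀⟩) (hclosed J)
    (fun t ht => (hSD t ht).trans hDD) hdisj hcard hφ.1 ha hφ.2 hDa hQ1 hQa hQD
  exact this

end Assembly

lemma two_mul_sq_le_exp {κ N : ℝ} (hκ : 0 < κ) (hN : 12 / κ ^ 3 ≤ N) :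
    2 * N ^ 2 ≤ Real.exp (κ * N) := by
  have hN0 : 0 ≤ N := le_trans (by positivity) hN
  have h := Real.pow_div_factorial_le_exp (κ * N) (by positivity) 3
  rw [div_le_iff₀ (by positivity)] at hN
  refine le_trans ?_ h
  rw [show ((Nat.factorial 3 : ℕ) : ℝ) = 6 by norm_num [Nat.factorial], le_div_iff₀ (by norm_num)]
  nlinarith [mul_le_mul_of_nonneg_left hN (sq_nonneg N)]

set_option maxHeartbeats 1000000 in
open scoped Classical in
lemma exists_vertexSpread_of_degree (Δ : ℕ) {δ : ℝ} (hδ : 0 < δ) (hδ1 : δ ≤ 1 / 4) :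
    ∃ (n₀ : ℕ) (C : ℝ), 0 < C ∧ ∀ n : ℕ, n₀ ≤ n → ∀ G T : SimpleGraph (Fin n),
      (∀ v, (1 / 2 + δ) * n ≤ #{w | G.Adj v w}) → T.IsTree → (∀ v, #{w | T.Adj v w} ≤ Δ) →
      ∃ μ : (Fin n → Fin n) → ℝ, (∀ χ, 0 ≤ μ χ) ∧ ∑ χ, μ χ = 1 ∧
        (∀ χ, μ χ ≠ 0 → Function.Injective χ ∧ ∀ u v, T.Adj u v → G.Adj (χ u) (χ v)) ∧
        IsVertexSpread (C / n) μ := by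
  set m : ℕ := Δ + 1 with hm
  set κ : ℝ := δ ^ m * (δ / (8 * (m * m))) / 4 with hκ
  have hm1 : (1 : ℝ) ≤ m := by rw [hm]; push_cast; linarith [Nat.cast_nonneg (α := ℝ) Δ]
  have hκ0 : 0 < κ := by positivity
  have hκ1 : κ ≤ 1 / 4 := by
    have h1 : δ ^ m ≤ 1 := pow_le_one₀ hδ.le (by linarith)
    have h2 : δ / (8 * (m * m)) ≤ 1 := by
      rw [div_le_one (by positivity)]
      nlinarith
    rw [hκ]
    have := mul_le_one₀ h1 (by positivity) h2
    linarith
  obtain ⟨d, l, c, hd, hl, hc, N₀, hF⟩ := exists_frame hδ (by linarith : δ ≤ 1)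
    (by positivity : 0 < κ / 16) (by linarith)
  set p : ℕ := ⌈16 / δ + 4 / c⌉₊ with hp
  have hp0 : 16 / δ + 4 / c ≤ p := Nat.le_ceil _
  have hpδ : 16 / δ ≤ p := by have : 0 < 4 / c := by positivity
                              linarith
  have hpc : 4 / c ≤ p := by have : 0 < 16 / δ := by positivity
                             linarith
  have hpR : (0 : ℝ) < p := lt_of_lt_of_le (by positivity) hpδ
  have hp1 : 1 ≤ p := Nat.cast_pos.1 hpR
  set s : ℕ := Δ * p + p + 1 with hs
  set σ : ℝ := (s : ℝ) + 2 with hσ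
  have hσ0 : 0 < σ := by positivity
  set K : ℝ := 4 + 2 / κ + 12 / κ + 2 / c + 4 / (d * l) with hK
  have k1 : 0 < 2 / κ := by positivity
  have k2 : 0 < 12 / κ := by positivity
  have k3 : 0 < 2 / c := by positivity
  have k4 : 0 < 4 / (d * l) := by positivity
  have hK0 : 0 < K := by positivity
  set M : ℝ := K + 16 / δ + 4 * σ / δ + 4 * σ / κ + σ / l + 4 * σ / c + 4 * σ / (d * l) +
    12 / κ ^ 3 + 1 with hM
  refine ⟨N₀ + ⌈M⌉₊, 2 * K, by positivity, fun n hn G T hG hT hΔ => ?_⟩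
  set N : ℝ := (n : ℝ) with hN
  have hMN : M ≤ N := (Nat.le_ceil M).trans (Nat.cast_le.2 (by omega))
  have m1 : 0 < 16 / δ := by positivity
  have m2 : 0 < 4 * σ / δ := by positivity
  have m3 : 0 < 4 * σ / κ := by positivity
  have m4 : 0 < σ / l := by positivity
  have m5 : 0 < 4 * σ / c := by positivity
  have m6 : 0 < 4 * σ / (d * l) := by positivity
  have m7 : 0 < 12 / κ ^ 3 := by positivity
  have hKN : K ≤ N := by linarith
  have n1 : 16 ≤ N * δ := (div_le_iff₀ hδ).1 (by linarith)
  have n2 : 4 * σ ≤ N * δ := (div_le_iff₀ hδ).1 (by linarith)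
  have n3 : 4 * σ ≤ N * κ := (div_le_iff₀ hκ0).1 (by linarith)
  have n4 : σ ≤ N * l := (div_le_iff₀ hl).1 (by linarith)
  have n5 : 4 * σ ≤ N * c := (div_le_iff₀ hc).1 (by linarith)
  have n6 : 4 * σ ≤ N * (d * l) := (div_le_iff₀ (by positivity)).1 (by linarith)
  have n7 : 12 / κ ^ 3 ≤ N := by linarith
  have hN0 : 0 < N := by linarith
  clear_value M
  obtain ⟨O⟩ := hT.nonempty_treeOrder
  have hchild : ∀ v, #{x | x ≠ O.root ∧ O.par x = v} ≤ Δ := by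
    intro v
    refine (card_le_card fun x hx => ?_).trans (hΔ v)
    simp only [mem_filter, mem_univ, true_and] at hx ⊢
    exact hx.2 ▸ (O.adj_par x hx.1).symm
  have hnbhd : ∀ t, #(T.closedNbhd t) ≤ m := by
    intro t
    have : T.closedNbhd t ⊆ insert t ({w | T.Adj t w} : Finset (Fin n)) := by
      intro x hx
      simpa using SimpleGraph.mem_closedNbhd.1 hx
    exact (card_le_card this).trans ((card_insert_le _ _).trans (Nat.succ_le_succ (hΔ t)))
  obtain ⟨blk, B, hB, hBp, hpar, hsz, hroot⟩ := O.exists_blocks hchild hp1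
  rw [Fintype.card_fin] at hBp
  have hBpR : (B : ℝ) * p ≤ N + p := by rw [hN]; exact_mod_cast hBp
  have hB1 : (B : ℝ) ≤ N / p + 1 := by
    rw [div_add_one hpR.ne', le_div_iff₀ hpR]
    exact hBpR
  have hBδ : (B : ℝ) ≤ N * δ / 8 := by
    have : N / p ≤ N * δ / 16 := by
      rw [div_le_iff₀ hpR]
      linarith [mul_le_mul_of_nonneg_left ((div_le_iff₀ hδ).1 hpδ) hN0.le]
    linarith
  have hBc : (B : ℝ) ≤ N * c / 4 + 1 := by
    have : N / p ≤ N * c / 4 := by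
      rw [div_le_iff₀ hpR]
      linarith [mul_le_mul_of_nonneg_left ((div_le_iff₀ hc).1 hpc) hN0.le]
    linarith
  have hk : ∀ r : ℝ, 0 ≤ r → r ≤ 1 → ∃ j ≤ B, r * N ≤ #{x | blk x < j} ∧
      (#{x | blk x < j} : ℝ) ≤ r * N + σ := by
    intro r hr hr1
    have h1 : ⌈r * N⌉₊ ≤ Fintype.card (Fin n) := by
      rw [Fintype.card_fin]
      exact Nat.ceil_le.2 (mul_le_of_le_one_left hN0.le hr1)
    obtain ⟨j, hj, h2, h3⟩ := exists_prefix_card hB hsz h1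
    refine ⟨j, hj, (Nat.le_ceil _).trans (Nat.cast_le.2 h2), ?_⟩
    have h4 : (#{x | blk x < j} : ℝ) ≤ ⌈r * N⌉₊ + s := by exact_mod_cast h3
    have h5 := Nat.ceil_lt_add_one (mul_nonneg hr hN0.le)
    linarith
  obtain ⟨j₀, -, hj1, hj2⟩ := hk (δ / 4) (by positivity) (by linarith)
  obtain ⟨J, hJB, hJ1, hJ2⟩ := hk (1 - κ / 2) (by linarith) (by linarith)
  have hκN : κ * N ≤ 1 / 4 * N := mul_le_mul_of_nonneg_right hκ1 hN0.le
  have hδN : δ * N ≤ 1 / 4 * N := mul_le_mul_of_nonneg_right hδ1 hN0.le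
  have hjJ : j₀ ≤ J := by
    by_contra! h
    have : #({x | blk x < J} : Finset (Fin n)) ≤ #({x | blk x < j₀} : Finset (Fin n)) :=
      card_le_card fun x hx => by
        rw [mem_filter] at hx ⊢
        exact ⟨mem_univ _, hx.2.trans h⟩
    have : (#({x | blk x < J} : Finset (Fin n)) : ℝ) ≤ #({x | blk x < j₀} : Finset (Fin n)) :=
      Nat.cast_le.2 this
    linarith
  have hr : blk O.root < j₀ := by
    have : 0 < #({x | blk x < j₀} : Finset (Fin n)) :=
      Nat.cast_pos.1 (lt_of_lt_of_le (by positivity : 0 < δ / 4 * N) hj1)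
    obtain ⟨x, hx⟩ := card_pos.1 this
    exact (O.blk_root_le hpar x).trans_lt (mem_filter.1 hx).2
  obtain ⟨S, hS, hdisj, hScard⟩ := O.exists_separated hnbhd hB hroot hpar j₀
  have hSR : (#{x | blk x < j₀} : ℝ) ≤ #S * (m * m) + B := by exact_mod_cast hScard
  have hSN : δ / (8 * (m * m)) * N ≤ #S := by
    rw [div_mul_eq_mul_div, div_le_iff₀ (by positivity)]
    linarith
  have hDc : (#({x | blk x < J} : Finset (Fin n))ᶜ : ℝ) =
      N - #({x | blk x < J} : Finset (Fin n)) := by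
    rw [card_compl, Nat.cast_sub (card_le_univ _), Fintype.card_fin]
  have hQ : ∀ x, x ≤ K → x / N ≤ K / N := fun x hx => div_le_div_of_nonneg_right hx hN0.le
  have hQ' : ∀ x y : ℝ, 0 < y → x / y ≤ K → x ≤ K / N * (y * N) := fun x y hy hx => by
    rw [div_le_iff₀ hy] at hx
    calc x ≤ K * y := hx
      _ = K / N * (y * N) := by field_simp
  have hmain := exists_vertexSpread_of_prefixes (G := G) (d := d) (l := l) (c := c) (γ := κ / 16) O
    hδ hδ1 (by simpa using hG) rfl hpar hsz hroot hjJ hJB hr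
    (by rw [Fintype.card_fin]; linarith) hS hdisj hnbhd (a := κ * N) (by positivity)
    (by
      have := mul_le_mul_of_nonneg_left hSN (pow_nonneg hδ.le m)
      rw [hκ]
      linarith)
    (by rw [Fintype.card_fin]; exact two_mul_sq_le_exp hκ0 n7)
    (fun I₀ hI₀ => hF G I₀ (by rw [Fintype.card_fin]; omega) (by simpa using hG) hI₀)
    hd.le (by omega) (by rw [Fintype.card_fin]; linarith)
    (by rw [Fintype.card_fin]; linarith) (by rw [hDc]; linarith) (Q := K / N)
    ((div_le_one hN0).2 hKN) (by rw [Fintype.card_fin]; exact hQ _ (by linarith))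
    (by rw [← div_div]; exact hQ _ (by linarith))
    (by
      have h1 : κ / 4 * N ≤ #({x | blk x < J} : Finset (Fin n))ᶜ := by rw [hDc]; linarith
      calc 3 / (#({x | blk x < J} : Finset (Fin n))ᶜ : ℝ) ≤ 3 / (κ / 4 * N) :=
            div_le_div_of_nonneg_left (by norm_num) (by positivity) h1
        _ = 12 / κ / N := by field_simp; norm_num
        _ ≤ K / N := hQ _ (by linarith))
    (by
      rw [Fintype.card_fin]
      refine (hQ' 1 (c / 2) (by positivity) ?_).trans
        (mul_le_mul_of_nonneg_left ?_ (by positivity))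
      · rw [one_div_div]; linarith
      · linarith)
    (by
      rw [Fintype.card_fin]
      refine (hQ' 1 (d * l / 4) (by positivity) ?_).trans
        (mul_le_mul_of_nonneg_left ?_ (by positivity))
      · rw [one_div_div]; linarith
      · linarith)
  rwa [← mul_div_assoc] at hmain

/-- Vertex-spread embeddings of bounded-degree spanning trees: for every `Δ` and `δ > 0` there
are `n₀` and `C > 0` such that for every graph `G` on `n ≥ n₀` vertices with
`δ(G) ≥ (1/2 + δ)n` and every `n`-vertex tree `T` with `Δ(T) ≤ Δ`, there is a
`(C/n)`-vertex-spread distribution on graph embeddings of `T` into `G`. -/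
theorem statement19 :
    ∀ (Δ : ℕ) (δ : ℝ), 0 < δ →
    ∃ n₀ : ℕ, ∃ C : ℝ, 0 < C ∧
    ∀ n : ℕ, n₀ ≤ n →
    ∀ (G : SimpleGraph (Fin n)) (_ : DecidableRel G.Adj),
    (∀ v, (1 / 2 + δ) * n ≤ (G.degree v : ℝ)) →
    ∀ (T : SimpleGraph (Fin n)) (_ : DecidableRel T.Adj),
    T.IsTree → (∀ v, T.degree v ≤ Δ) →
    ∃ μ : (Fin n → Fin n) → ℝ,
      (∀ φ, 0 ≤ μ φ) ∧ (∑ φ : Fin n → Fin n, μ φ = 1) ∧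
      (∀ φ, μ φ ≠ 0 →
        Function.Injective φ ∧ ∀ u v, T.Adj u v → G.Adj (φ u) (φ v)) ∧
      IsVertexSpread (C / (n : ℝ)) μ := by
  classical
  intro Δ δ hδ
  obtain ⟨n₀, C, hC, h⟩ := exists_vertexSpread_of_degree Δ (lt_min hδ (by norm_num : (0 : ℝ) < 1 / 4))
    (min_le_right _ _)
  have hdeg : ∀ {n : ℕ} (H : SimpleGraph (Fin n)) (_ : DecidableRel H.Adj) (v : Fin n),
      H.degree v = #{w | H.Adj v w} := by
    intro n H _ v
    rw [← SimpleGraph.card_neighborFinset_eq_degree, SimpleGraph.neighborFinset_eq_filter]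
  refine ⟨n₀, C, hC, fun n hn G _ hG T _ hT hΔ => ?_⟩
  refine h n hn G T (fun v => ?_) hT fun v => ?_
  · have := hG v
    rw [hdeg] at this
    refine le_trans (mul_le_mul_of_nonneg_right ?_ (Nat.cast_nonneg _)) (this.trans (le_of_eq ?_))
    · linarith [min_le_left δ (1 / 4)]
    · congr
  · have := hΔ v
    rw [hdeg] at this
    convert this
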